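/- There exists an absolute constant C > 0 with the following property. For each n, choose x, y, z independently and uniformly at random from the symmetric group Sym(n) and set S = {x^{±1}, y^{±1}, z^{±1}}. Then the probability that the subgroup ⟨S⟩ generated by S contains the alternating group Alt(n) and every element of ⟨S⟩ is a product of at most C·n²·log n elements of S tends to 1 as n → ∞. -/

import Mathlib

namespace ThreeGen
open Finset Equiv
set_option linter.unusedSectionVars false

section Full
variable {α : Type*} [Fintype α] [DecidableEq α]

/-- A permutation is *full* if it has no proper nonempty invariant subset, i.e. it is a single
cycle through all points. -/
def IsFull (h : Perm α) : Prop :=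
  ∀ A : Finset α, (∀ i ∈ A, h i ∈ A) → A = ∅ ∨ A = univ

noncomputable instance : DecidablePred (IsFull : Perm α → Prop) := fun _ => Classical.dec _

theorem mem_of_perm_mem {h : Perm α} {A : Finset α} (hA : ∀ i ∈ A, h i ∈ A) {i : α}
    (hi : h i ∈ A) : i ∈ A := by
  have : A.image h = A := by
    apply Finset.eq_of_subset_of_card_le
    · intro j hj
      obtain ⟨k, hk, rfl⟩ := Finset.mem_image.1 hj
      exact hA k hk
    · rw [Finset.card_image_of_injective _ h.injective]
  rw [← this] at hi
  obtain ⟨k, hk, hki⟩ := Finset.mem_image.1 hi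
  rwa [← h.injective hki]

theorem isFull_iff_sameCycle {h : Perm α} : IsFull h ↔ ∀ x y, h.SameCycle x y := by
  classical
  constructor
  · intro hf x y
    have := hf (univ.filter fun z => h.SameCycle x z) (by
      intro i hi
      simp only [mem_filter, mem_univ, true_and] at hi ⊢
      exact Perm.sameCycle_apply_right.2 hi)
    rcases this with h0 | h1
    · exfalso
      have : x ∈ univ.filter fun z => h.SameCycle x z := by simp [Perm.SameCycle.refl]
      rw [h0] at this
      simp at this
    · have : y ∈ univ.filter fun z => h.SameCycle x z := by rw [h1]; simp
      simpa using this
  · intro hs A hA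
    by_cases hne : A = ∅
    · exact Or.inl hne
    · right
      obtain ⟨x, hx⟩ := Finset.nonempty_iff_ne_empty.2 hne
      ext y
      simp only [mem_univ, iff_true]
      obtain ⟨i, hi⟩ := (hs x y).exists_nat_pow_eq
      rw [← hi]
      clear hi
      induction i with
      | zero => simpa using hx
      | succ k ih => rw [pow_succ', Perm.mul_apply]; exact hA _ ih

theorem IsFull.isCycleOn {h : Perm α} (hf : IsFull h) :
    h.IsCycleOn ((univ : Finset α) : Set α) := by
  refine ⟨by simp, fun x _ y _ => isFull_iff_sameCycle.1 hf x y⟩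

theorem IsFull.pow_card {h : Perm α} (hf : IsFull h) : h ^ Fintype.card α = 1 := by
  ext x
  have := hf.isCycleOn.pow_card_apply (mem_univ x)
  simpa using this

theorem isFull_iff_cycleType {h : Perm α} (hc : 2 ≤ Fintype.card α) :
    IsFull h ↔ h.cycleType = {Fintype.card α} := by
  have : Nontrivial α := Fintype.one_lt_card_iff_nontrivial.1 hc
  constructor
  · intro hf
    have hne : ∀ x, h x ≠ x := fun x =>
      hf.isCycleOn.apply_ne (by simpa using this) (by simp)
    have hcyc : h.IsCycle := by
      obtain ⟨x, _⟩ := exists_pair_ne α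
      exact ⟨x, hne x, fun y _ => isFull_iff_sameCycle.1 hf x y⟩
    rw [hcyc.cycleType]
    congr 1
    rw [← Finset.card_univ]
    congr 1
    ext x
    simp [hne]
  · intro ht
    have hcyc : h.IsCycle := by
      rw [← Perm.card_cycleType_eq_one, ht]; simp
    rw [hcyc.cycleType, Multiset.singleton_inj] at ht
    have hsupp : h.support = univ := Finset.card_eq_iff_eq_univ _ |>.1 ht
    rw [isFull_iff_sameCycle]
    intro x y
    exact hcyc.sameCycle (by rw [← Perm.mem_support, hsupp]; simp)
      (by rw [← Perm.mem_support, hsupp]; simp)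

theorem isFull_of_subsingleton [Subsingleton α] (h : Perm α) : IsFull h := by
  rw [isFull_iff_sameCycle]
  intro x y
  rw [Subsingleton.elim y x]

theorem card_isFull [Nonempty α] :
    #(univ.filter fun h : Perm α => IsFull h) = (Fintype.card α - 1).factorial := by
  rcases Nat.lt_or_ge (Fintype.card α) 2 with hc | hc
  · have h1 : Fintype.card α = 1 := by
      have := Fintype.card_pos (α := α); omega
    have : Subsingleton α := Fintype.card_le_one_iff_subsingleton.1 h1.le
    rw [Finset.filter_true_of_mem (fun h _ => isFull_of_subsingleton h), Finset.card_univ,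
      Fintype.card_perm, h1]
    rfl
  · simp_rw [isFull_iff_cycleType hc]
    rw [Equiv.Perm.card_of_cycleType_singleton hc le_rfl]
    simp

theorem IsFull.sign [Nonempty α] {h : Perm α} (hf : IsFull h) :
    Perm.sign h = (-1) ^ (Fintype.card α - 1) := by
  rcases Nat.lt_or_ge (Fintype.card α) 2 with hc | hc
  · have h1 : Fintype.card α = 1 := by
      have := Fintype.card_pos (α := α); omega
    have : Subsingleton α := Fintype.card_le_one_iff_subsingleton.1 h1.le
    rw [Subsingleton.elim h 1, h1]
    simp
  · rw [Perm.sign_of_cycleType, (isFull_iff_cycleType hc).1 hf]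
    obtain ⟨k, hk⟩ := Nat.exists_eq_add_of_le hc
    rw [hk]
    simp only [Multiset.sum_singleton, Multiset.card_singleton]
    rw [show 2 + k + 1 = (2 + k - 1) + 2 by omega, pow_add]
    simp

theorem IsFull.conj {β : Type*} [Fintype β] [DecidableEq β] (e : α ≃ β) {h : Perm α} :
    IsFull (e.permCongr h) ↔ IsFull h := by
  constructor
  · intro hf A hA
    have := hf (A.map e.toEmbedding) (by
      intro i hi
      simp only [Finset.mem_map_equiv, permCongr_apply, symm_apply_apply] at hi ⊢
      exact hA _ hi)
    rcases this with h0 | h1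
    · left; simpa using h0
    · right
      ext y
      have : e y ∈ A.map e.toEmbedding := by rw [h1]; simp
      simpa using this
  · intro hf A hA
    have := hf (A.map e.symm.toEmbedding) (by
      intro i hi
      simp only [Finset.mem_map_equiv, symm_symm] at hi ⊢
      simpa using hA _ hi)
    rcases this with h0 | h1
    · left; simpa using h0
    · right
      ext y
      have : e.symm y ∈ A.map e.symm.toEmbedding := by rw [h1]; simp
      simpa using this

end Full

section Mixed
variable {α : Type*} [Fintype α] [DecidableEq α]

/-- Determinant of the `0/1` matrix of a self-map. -/
noncomputable def fnDet (g : α → α) : ℝ :=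
  Matrix.det (Matrix.of fun i => (Pi.single (g i) (1 : ℝ) : α → ℝ))

theorem fnDet_comp (g h : α → α) : fnDet (g ∘ h) = fnDet g * fnDet h := by
  unfold fnDet
  rw [mul_comm, ← Matrix.det_mul]
  congr 1
  ext i j
  rw [Matrix.mul_apply, Finset.sum_eq_single (h i)] <;> simp +contextual [Pi.single_apply]

theorem fnDet_perm (σ : Perm α) : fnDet σ = ((Perm.sign σ : ℤ) : ℝ) := by
  rw [← Matrix.det_permutation σ]
  unfold fnDet
  congr 1
  ext i j
  simp [PEquiv.toMatrix_apply, Pi.single_apply, eq_comm]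

theorem fnDet_of_not_injective {g : α → α} (hg : ¬ Function.Injective g) : fnDet g = 0 := by
  simp only [Function.Injective, not_forall] at hg
  obtain ⟨a, b, hab, hne⟩ := hg
  exact Matrix.det_zero_of_row_eq hne (by ext j; simp [hab])

/-- `fnDet` of the map that agrees with `f` on `A` and fixes all other points. -/
noncomputable def W (f : α → α) (A : Finset α) : ℝ := fnDet (A.piecewise f id)

theorem W_empty (f : α → α) : W f ∅ = 1 := by
  have := fnDet_perm (1 : Perm α)
  simpa [W] using this

theorem W_univ (v : Perm α) : W v univ = ((Perm.sign v : ℤ) : ℝ) := by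
  simp [W, fnDet_perm]

theorem W_eq_zero_of_not_mem {f : α → α} {A : Finset α} {i : α} (hi : i ∈ A) (hf : f i ∉ A) :
    W f A = 0 := by
  apply fnDet_of_not_injective
  intro hinj
  have : A.piecewise f id i = A.piecewise f id (f i) := by simp [hi, hf]
  have := hinj this
  exact hf (this ▸ hi)

theorem W_mul {v w : α → α} {A : Finset α} (hw : ∀ i ∈ A, w i ∈ A) : W (v ∘ w) A = W v A * W w A := by
  unfold W
  rw [← fnDet_comp]
  congr 1
  ext i
  by_cases hi : i ∈ A
  · simp [hi, hw i hi]
  · simp [hi]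

/-- The restriction of `h` to an invariant set, extended by the identity. -/
theorem W_eq_sign_subtypePerm {h : Perm α} {A : Finset α} (hA : ∀ i, h i ∈ A ↔ i ∈ A) :
    W h A = ((Perm.sign (h.subtypePerm (p := (· ∈ A)) hA) : ℤ) : ℝ) := by
  rw [← Perm.sign_ofSubtype, ← fnDet_perm]
  unfold W
  congr 1
  ext i
  by_cases hi : i ∈ A
  · rw [Perm.ofSubtype_apply_of_mem _ hi]; simp [hi]
  · rw [Perm.ofSubtype_apply_of_not_mem _ hi]; simp [hi]

theorem W_eq_zero_of_image {f : α → α} {A : Finset α} (hf : ¬ Set.InjOn f A) : W f A = 0 := by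
  apply fnDet_of_not_injective
  intro hinj
  apply hf
  intro i hi j hj hij
  apply hinj
  have hi' : i ∈ A := hi
  have hj' : j ∈ A := hj
  simp [hi', hj', hij]

theorem W_congr {f g : α → α} {A : Finset α} (h : ∀ i ∈ A, f i = g i) : W f A = W g A := by
  unfold W
  congr 1
  ext i
  by_cases hi : i ∈ A
  · simp [hi, h i hi]
  · simp [hi]

/-- Multilinear expansion of a determinant whose rows are `c i • e i + d i • e (f i)`. -/
theorem det_expand (c d : α → ℝ) (f : α → α) :
    Matrix.det (Matrix.of fun i => c i • (Pi.single i (1 : ℝ) : α → ℝ) + d i • Pi.single (f i) 1)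
      = ∑ A : Finset α, (∏ i ∈ A, d i) * (∏ i ∈ Aᶜ, c i) * W f A := by
  have h1 := (Matrix.detRowAlternating (n := α) (R := ℝ)).toMultilinearMap.map_add_univ
    (fun i => d i • (Pi.single (f i) (1 : ℝ) : α → ℝ)) (fun i => c i • (Pi.single i (1 : ℝ) : α → ℝ))
  have h0 : Matrix.det (Matrix.of fun i => c i • (Pi.single i (1 : ℝ) : α → ℝ) + d i • Pi.single (f i) 1)
    = (Matrix.detRowAlternating (n := α) (R := ℝ)).toMultilinearMap
      ((fun i => d i • (Pi.single (f i) (1 : ℝ) : α → ℝ)) + (fun i => c i • (Pi.single i (1 : ℝ) : α → ℝ))) := by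
    change _ = Matrix.det _
    congr 1
    ext i j
    simp [add_comm]
  rw [h0, h1]
  apply Finset.sum_congr rfl
  intro A _
  have h2 : A.piecewise (fun i => d i • (Pi.single (f i) (1 : ℝ) : α → ℝ))
      (fun i => c i • (Pi.single i (1 : ℝ) : α → ℝ)) =
      fun i => (A.piecewise d c i) • (Pi.single (A.piecewise f id i) (1 : ℝ) : α → ℝ) := by
    ext i j
    by_cases hi : i ∈ A <;> simp [hi]
  rw [h2, MultilinearMap.map_smul_univ]
  congr 1
  rw [Finset.prod_piecewise]
  simp [Finset.compl_eq_univ_sdiff]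

/-- A full permutation restricted to an invariant set on which it is a single cycle. -/
def FullOn (h : Perm α) (A : Finset α) : Prop :=
  (∀ i ∈ A, h i ∈ A) ∧ ∀ B ⊆ A, (∀ i ∈ B, h i ∈ B) → B = ∅ ∨ B = A

noncomputable instance (A : Finset α) : DecidablePred (fun h : Perm α => FullOn h A) :=
  fun _ => Classical.dec _

theorem mem_iff_of_perm_mem {h : Perm α} {A : Finset α} (hA : ∀ i ∈ A, h i ∈ A) (i : α) :
    h i ∈ A ↔ i ∈ A := ⟨mem_of_perm_mem hA, hA i⟩

theorem fullOn_iff {h : Perm α} {A : Finset α} (hA : ∀ i, h i ∈ A ↔ i ∈ A) :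
    FullOn h A ↔ IsFull (h.subtypePerm (p := (· ∈ A)) hA) := by
  constructor
  · rintro ⟨_, h2⟩ B hB
    have := h2 (B.map (Function.Embedding.subtype _)) (by
      intro i hi
      simp only [mem_map, Function.Embedding.subtype_apply, Subtype.exists, exists_and_right,
        exists_eq_right] at hi
      exact hi.1) (by
      intro i hi
      simp only [mem_map, Function.Embedding.subtype_apply, Subtype.exists, exists_and_right,
        exists_eq_right] at hi ⊢
      obtain ⟨hi, hiB⟩ := hi
      exact ⟨(hA i).2 hi, hB _ hiB⟩)
    rcases this with h0 | h1
    · left; simpa using h0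
    · right
      ext ⟨y, hy⟩
      rw [← h1] at hy
      simp only [mem_map, Function.Embedding.subtype_apply, Subtype.exists, exists_and_right,
        exists_eq_right] at hy
      simpa using hy.2
  · intro hf
    refine ⟨fun i hi => (hA i).2 hi, fun B hBA hB => ?_⟩
    have := hf (B.subtype (· ∈ A)) (by
      rintro ⟨i, hi⟩ hiB
      simp only [mem_subtype] at hiB ⊢
      exact hB _ hiB)
    rcases this with h0 | h1
    · left
      ext y
      simp only [notMem_empty, iff_false]
      intro hy
      have : (⟨y, hBA hy⟩ : {x // x ∈ A}) ∈ B.subtype (· ∈ A) := by simpa using hy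
      rw [h0] at this
      simp at this
    · right
      apply Finset.Subset.antisymm hBA
      intro y hy
      have : (⟨y, hy⟩ : {x // x ∈ A}) ∈ B.subtype (· ∈ A) := by rw [h1]; simp
      simpa using this

theorem FullOn.W_eq {h : Perm α} {A : Finset α} (hf : FullOn h A) (hne : A.Nonempty) :
    W h A = (-1) ^ (#A - 1) := by
  have hA := mem_iff_of_perm_mem hf.1
  have : Nonempty {x // x ∈ A} := hne.to_subtype
  rw [W_eq_sign_subtypePerm hA, ((fullOn_iff hA).1 hf).sign]
  simp

end Mixed

section Indicator
variable {α : Type*} [Fintype α] [DecidableEq α]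

theorem sum_W_not_mem (π : Perm α) (o : α) :
    ∑ A ∈ univ.filter (fun A : Finset α => o ∉ A), (-1 : ℝ) ^ #A * W π A =
      if IsFull π then 1 else 0 := by
  split_ifs with hf
  · rw [Finset.sum_eq_single ∅]
    · simp [W_empty]
    · intro A hA hne
      have hoA : o ∉ A := by simpa using hA
      have : ¬ ∀ i ∈ A, π i ∈ A := by
        intro hinv
        rcases hf A hinv with h | h
        · exact hne h
        · exact hoA (h ▸ mem_univ o)
      push Not at this
      obtain ⟨i, hi, hi'⟩ := this
      rw [W_eq_zero_of_not_mem hi hi', mul_zero]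
    · simp
  · have hexp := det_expand (fun _ => (1 : ℝ)) (fun i => if i = o then 0 else (-1 : ℝ)) (π : α → α)
    have hsum : ∑ A ∈ univ.filter (fun A : Finset α => o ∉ A), (-1 : ℝ) ^ #A * W π A =
        ∑ A : Finset α, (∏ i ∈ A, if i = o then 0 else (-1 : ℝ)) * (∏ i ∈ Aᶜ, (1 : ℝ)) * W π A := by
      rw [Finset.sum_filter]
      apply Finset.sum_congr rfl
      intro A _
      by_cases hoA : o ∈ A
      · rw [Finset.prod_eq_zero hoA (by simp), if_neg (by simpa using hoA)]
        simp
      · rw [if_pos hoA]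
        have : ∏ i ∈ A, (if i = o then 0 else (-1 : ℝ)) = (-1) ^ #A := by
          rw [← Finset.prod_const]
          apply Finset.prod_congr rfl
          intro i hi
          rw [if_neg]
          rintro rfl
          exact hoA hi
        rw [this]; simp
    rw [hsum, ← hexp]
    unfold IsFull at hf
    push Not at hf
    obtain ⟨B, hB, hB0, hB1⟩ := hf
    have hB' := mem_iff_of_perm_mem hB
    obtain ⟨D, hD, hoD, hDne⟩ : ∃ D : Finset α, (∀ i, π i ∈ D ↔ i ∈ D) ∧ o ∉ D ∧ D.Nonempty := by
      by_cases hoB : o ∈ B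
      · refine ⟨Bᶜ, fun i => by simp [hB'], by simpa using hoB, ?_⟩
        rw [Finset.nonempty_iff_ne_empty]
        simpa using hB1
      · exact ⟨B, hB', hoB, hB0⟩
    rw [← Matrix.exists_mulVec_eq_zero_iff]
    refine ⟨fun i => if i ∈ D then 1 else 0, ?_, ?_⟩
    · obtain ⟨x, hx⟩ := hDne
      intro h
      have := congrFun h x
      simp [hx] at this
    · ext i
      by_cases hio : i = o
      · subst hio
        simp [Matrix.mulVec, dotProduct, Pi.single_apply, hoD]
      · simp [Matrix.mulVec, dotProduct, Pi.single_apply, hio, Finset.sum_add_distrib, hD]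

theorem sum_W_alternating [Nonempty α] (π : Perm α) :
    ∑ A : Finset α, (-1 : ℝ) ^ #A * W π A = 0 := by
  have hexp := det_expand (fun _ => (1 : ℝ)) (fun _ => (-1 : ℝ)) (π : α → α)
  simp only [Finset.prod_const, one_pow, mul_one] at hexp
  rw [← hexp, ← Matrix.exists_mulVec_eq_zero_iff]
  refine ⟨fun _ => 1, ?_, ?_⟩
  · intro h
    obtain ⟨x⟩ := ‹Nonempty α›
    have := congrFun h x
    simp at this
  · ext i
    simp [Matrix.mulVec, dotProduct, Pi.single_apply, Finset.sum_add_distrib]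

theorem card_mul_indicator [Nonempty α] (π : Perm α) :
    (Fintype.card α : ℝ) * (if IsFull π then 1 else 0) =
      - ∑ A : Finset α, (#A : ℝ) * (-1) ^ #A * W π A := by
  have h1 : ∑ o : α, ∑ A ∈ univ.filter (fun A : Finset α => o ∉ A), (-1 : ℝ) ^ #A * W π A =
      (Fintype.card α : ℝ) * (if IsFull π then 1 else 0) := by
    simp_rw [sum_W_not_mem]
    simp
  rw [← h1]
  simp_rw [Finset.sum_filter]
  rw [Finset.sum_comm]
  have h2 : ∀ A : Finset α, ∑ o : α, (if o ∉ A then (-1 : ℝ) ^ #A * W π A else 0) =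
      ((Fintype.card α : ℝ) - #A) * ((-1 : ℝ) ^ #A * W π A) := by
    intro A
    rw [← Finset.sum_filter, Finset.sum_const, nsmul_eq_mul]
    congr 1
    have : (univ.filter fun o => o ∉ A) = Aᶜ := by ext; simp
    rw [this, Finset.card_compl, Nat.cast_sub (Finset.card_le_univ A)]
  simp_rw [h2, sub_mul, Finset.sum_sub_distrib, ← Finset.mul_sum, sum_W_alternating]
  simp [mul_assoc]

/-- The number of full `h` such that `h * v` is full as well. -/
noncomputable def fullPairs (v : Perm α) : ℕ := #(univ.filter fun h : Perm α => IsFull h ∧ IsFull (h * v))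

/-- The sum over full `h` of the local signs `W (h * v) A`. -/
noncomputable def fullSum (v : Perm α) (A : Finset α) : ℝ :=
  ∑ h ∈ univ.filter (fun h : Perm α => IsFull h), W (h * v : Perm α) A

theorem card_mul_fullPairs [Nonempty α] (v : Perm α) :
    (Fintype.card α : ℝ) * fullPairs v = - ∑ A : Finset α, (#A : ℝ) * (-1) ^ #A * fullSum v A := by
  have h1 : (fullPairs v : ℝ) = ∑ h ∈ univ.filter (fun h : Perm α => IsFull h),
      if IsFull (h * v) then 1 else 0 := by
    rw [fullPairs, ← Finset.filter_filter, Finset.card_filter]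
    push_cast
    rfl
  rw [h1, Finset.mul_sum]
  simp_rw [card_mul_indicator, Finset.sum_neg_distrib, fullSum, Finset.mul_sum]
  rw [Finset.sum_comm]

end Indicator

section FullSum
variable {α : Type*} [Fintype α] [DecidableEq α]

theorem isFull_mul_swap_iff {h : Perm α} {A : Finset α} {p q : α} (hp : p ∉ A) (hq : q ∈ A)
    (hA : ∀ i ∈ A, h i ∈ A) :
    IsFull (h * swap p q) ↔ FullOn h A ∧ FullOn h Aᶜ := by
  have hA' := mem_iff_of_perm_mem hA
  have hpq : p ≠ q := fun e => hp (e ▸ hq)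
  constructor
  · intro hf
    have key : ∀ B : Finset α, p ∉ B → q ∉ B → (∀ i ∈ B, h i ∈ B) → B = ∅ := by
      intro B hpB hqB hB
      rcases hf B (by
        intro i hi
        rw [Perm.mul_apply, swap_apply_of_ne_of_ne]
        · exact hB i hi
        · rintro rfl; exact hpB hi
        · rintro rfl; exact hqB hi) with h0 | h0
      · exact h0
      · exact absurd (h0 ▸ mem_univ p) hpB
    refine ⟨⟨hA, fun B hBA hB => ?_⟩, ⟨fun i => by simp [hA'], fun B hBA hB => ?_⟩⟩
    · have hB' := mem_iff_of_perm_mem hB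
      by_cases hqB : q ∈ B
      · right
        have := key (A \ B) (by simp [hp]) (by simp [hqB]) (by simp [hA', hB'])
        rw [Finset.sdiff_eq_empty_iff_subset] at this
        exact Finset.Subset.antisymm hBA this
      · left
        exact key B (fun h => hp (hBA h)) hqB hB
    · have hB' := mem_iff_of_perm_mem hB
      by_cases hpB : p ∈ B
      · right
        have := key (Aᶜ \ B) (by simp [hpB]) (by simp [hq]) (by simp [hA', hB'])
        rw [Finset.sdiff_eq_empty_iff_subset] at this
        exact Finset.Subset.antisymm hBA this
      · left
        refine key B hpB (fun h => ?_) hB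
        have := hBA h
        simp [hq] at this
  · rintro ⟨⟨_, h1⟩, ⟨_, h2⟩⟩ B hB
    have hB' := mem_iff_of_perm_mem hB
    have hother : ∀ i, i ≠ p → i ≠ q → (h i ∈ B ↔ i ∈ B) := by
      intro i hip hiq
      rw [← hB' i, Perm.mul_apply, swap_apply_of_ne_of_ne hip hiq]
    have hhp : h p ∈ B ↔ q ∈ B := by
      rw [← hB' q]; simp
    have hhq : h q ∈ B ↔ p ∈ B := by
      rw [← hB' p]; simp
    by_cases hpB : p ∈ B <;> by_cases hqB : q ∈ B
    · right
      have hall : ∀ i, h i ∈ B ↔ i ∈ B := by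
        intro i
        by_cases hip : i = p
        · subst hip; simp [hhp, hqB, hpB]
        by_cases hiq : i = q
        · subst hiq; simp [hhq, hqB, hpB]
        exact hother i hip hiq
      have e1 := h1 (A ∩ B) Finset.inter_subset_left (by simp [hA', hall])
      have e2 := h2 (Aᶜ ∩ B) Finset.inter_subset_left (by simp [hA', hall])
      have f1 : A ⊆ B := by
        rcases e1 with e | e
        · have : q ∈ A ∩ B := by simp [hq, hqB]
          rw [e] at this; simp at this
        · exact Finset.inter_eq_left.1 e
      have f2 : Aᶜ ⊆ B := by
        rcases e2 with e | e
        · have : p ∈ Aᶜ ∩ B := by simp [hp, hpB]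
          rw [e] at this; simp at this
        · exact Finset.inter_eq_left.1 e
      ext i
      simp only [mem_univ, iff_true]
      by_cases hi : i ∈ A
      · exact f1 hi
      · exact f2 (by simpa using hi)
    · exfalso
      -- `p ∈ B`, `q ∉ B`
      rcases h1 (A ∩ B) Finset.inter_subset_left (by
        intro i hi
        simp only [mem_inter] at hi ⊢
        refine ⟨hA _ hi.1, (hother i ?_ ?_).2 hi.2⟩
        · rintro rfl; exact hp hi.1
        · rintro rfl; exact hqB hi.2) with e | e
      · have : h q ∈ A ∩ B := by simp [hA', hq, hhq, hpB]
        rw [e] at this; simp at this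
      · exact hqB (Finset.inter_eq_left.1 e hq)
    · exfalso
      rcases h1 (A \ B) Finset.sdiff_subset (by
        intro i hi
        simp only [mem_sdiff] at hi ⊢
        refine ⟨hA _ hi.1, fun hh => hi.2 ((hother i ?_ ?_).1 hh)⟩
        · rintro rfl; exact hp hi.1
        · rintro rfl; exact hi.2 hqB) with e | e
      · rw [Finset.sdiff_eq_empty_iff_subset] at e
        exact hpB (hhq.1 (e (hA q hq)))
      · have : q ∈ A \ B := by rw [e]; exact hq
        simp [hqB] at this
    · left
      have hall : ∀ i, h i ∈ B ↔ i ∈ B := by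
        intro i
        by_cases hip : i = p
        · subst hip; simp [hhp, hqB, hpB]
        by_cases hiq : i = q
        · subst hiq; simp [hhq, hqB, hpB]
        exact hother i hip hiq
      have e1 := h1 (A ∩ B) Finset.inter_subset_left (by simp [hA', hall])
      have e2 := h2 (Aᶜ ∩ B) Finset.inter_subset_left (by simp [hA', hall])
      have f1 : A ∩ B = ∅ := by
        rcases e1 with e | e
        · exact e
        · exact absurd (Finset.inter_eq_left.1 e hq) hqB
      have f2 : Aᶜ ∩ B = ∅ := by
        rcases e2 with e | e
        · exact e
        · exact absurd (Finset.inter_eq_left.1 e (by simpa using hp)) hpB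
      ext i
      simp only [notMem_empty, iff_false]
      intro hiB
      by_cases hi : i ∈ A
      · have : i ∈ A ∩ B := by simp [hi, hiB]
        rw [f1] at this; simp at this
      · have : i ∈ Aᶜ ∩ B := by simp [hi, hiB]
        rw [f2] at this; simp at this

theorem fullOn_iff_of_pred {h : Perm α} {A : Finset α} {p : α → Prop} [Fintype {x // p x}]
    (hp : ∀ i, p i ↔ i ∈ A) (hA : ∀ i, p (h i) ↔ p i) :
    FullOn h A ↔ IsFull (h.subtypePerm (p := p) hA) := by
  obtain rfl : p = (· ∈ A) := by ext i; exact hp i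
  rw [fullOn_iff hA]
  convert Iff.rfl

theorem card_fullOn_fullOn_compl {A : Finset α} (hne : A.Nonempty) (hne' : Aᶜ.Nonempty) :
    #(univ.filter fun h : Perm α => FullOn h A ∧ FullOn h Aᶜ) =
      (#A - 1).factorial * (Fintype.card α - #A - 1).factorial := by
  have i1 : Nonempty {x // x ∈ A} := hne.to_subtype
  have i2 : Nonempty {x // ¬ x ∈ A} := by
    obtain ⟨x, hx⟩ := hne'
    exact ⟨⟨x, by simpa using hx⟩⟩
  have c1 : (#A - 1).factorial = #(univ.filter fun h : Perm {x // x ∈ A} => IsFull h) := by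
    rw [card_isFull]; simp
  have c2 : (Fintype.card α - #A - 1).factorial =
      #(univ.filter fun h : Perm {x // ¬ x ∈ A} => IsFull h) := by
    rw [card_isFull, Fintype.card_subtype_compl]; simp
  rw [c1, c2, ← Finset.card_product]
  symm
  apply Finset.card_bij' (fun σ _ => Perm.subtypeCongr σ.1 σ.2)
    (fun h _ => if hA : ∀ i, h i ∈ A ↔ i ∈ A then
      (h.subtypePerm hA, h.subtypePerm (p := fun x => ¬ x ∈ A) (fun i => not_congr (hA i))) else 1)
  · rintro ⟨σ, τ⟩ hστ
    simp only [mem_product, mem_filter, mem_univ, true_and] at hστ ⊢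
    have hA : ∀ i, (Perm.subtypeCongr σ τ) i ∈ A ↔ i ∈ A := by
      intro i
      by_cases hi : i ∈ A
      · rw [Perm.subtypeCongr.left_apply _ _ hi]; simp [hi]
      · rw [Perm.subtypeCongr.right_apply _ _ hi]; simp only [hi, iff_false]; exact (τ ⟨i, hi⟩).2
    rw [fullOn_iff hA, fullOn_iff_of_pred (p := fun x => ¬ x ∈ A) (by simp) (fun i => not_congr (hA i))]
    constructor
    · convert hστ.1
      ext ⟨i, hi⟩
      simp [Perm.subtypeCongr.left_apply _ _ hi]
    · convert hστ.2
      ext ⟨i, hi⟩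
      simp [Perm.subtypeCongr.right_apply _ _ hi]
  · intro h hh
    simp only [mem_filter, mem_univ, true_and] at hh
    have hA := mem_iff_of_perm_mem hh.1.1
    rw [dif_pos hA]
    simp only [mem_product, mem_filter, mem_univ, true_and]
    exact ⟨(fullOn_iff hA).1 hh.1, (fullOn_iff_of_pred (p := fun x => ¬ x ∈ A) (by simp)
      (fun i => not_congr (hA i))).1 hh.2⟩
  · rintro ⟨σ, τ⟩ hστ
    have hA : ∀ i, (Perm.subtypeCongr σ τ) i ∈ A ↔ i ∈ A := by
      intro i
      by_cases hi : i ∈ A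
      · rw [Perm.subtypeCongr.left_apply _ _ hi]; simp [hi]
      · rw [Perm.subtypeCongr.right_apply _ _ hi]; simp only [hi, iff_false]; exact (τ ⟨i, hi⟩).2
    simp only
    rw [dif_pos hA]
    ext ⟨i, hi⟩
    · simp [Perm.subtypeCongr.left_apply _ _ hi]
    · simp [Perm.subtypeCongr.right_apply _ _ hi]
  · intro h hh
    simp only [mem_filter, mem_univ, true_and] at hh
    have hA := mem_iff_of_perm_mem hh.1.1
    rw [dif_pos hA]
    ext i
    by_cases hi : i ∈ A
    · simp [Perm.subtypeCongr.left_apply _ _ hi]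
    · simp [Perm.subtypeCongr.right_apply _ _ hi]

end FullSum

section FullSum
variable {α : Type*} [Fintype α] [DecidableEq α]

theorem image_eq_of_W_ne_zero {f : α → α} {A : Finset α} (h : W f A ≠ 0) : A.image f = A := by
  apply Finset.eq_of_subset_of_card_le
  · intro j hj
    obtain ⟨i, hi, rfl⟩ := Finset.mem_image.1 hj
    by_contra hne
    exact h (W_eq_zero_of_not_mem hi hne)
  · rw [Finset.card_image_of_injOn]
    by_contra hne
    exact h (W_eq_zero_of_image hne)

theorem W_comp_perm_of_supported {s : Perm α} {f : α → α} {A : Finset α}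
    (hs : ∀ i, i ∉ A → s i = i) : W (s ∘ f) A = ((Perm.sign s : ℤ) : ℝ) * W f A := by
  have hsA : ∀ i, s i ∈ A ↔ i ∈ A := by
    have : ∀ i ∈ Aᶜ, s i ∈ Aᶜ := by
      intro i hi
      rw [hs i (by simpa using hi)]; exact hi
    intro i
    have := mem_iff_of_perm_mem this i
    simp only [mem_compl] at this
    exact not_iff_not.1 this
  have h1 : W s A = ((Perm.sign s : ℤ) : ℝ) := by
    rw [← fnDet_perm]
    unfold W
    congr 1
    ext i
    by_cases hi : i ∈ A
    · simp [hi]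
    · simp [hi, hs]
  by_cases hf : ∀ i ∈ A, f i ∈ A
  · rw [W_mul hf, h1]
  · push Not at hf
    obtain ⟨i, hi, hi'⟩ := hf
    rw [W_eq_zero_of_not_mem hi hi', W_eq_zero_of_not_mem hi (by simpa [hsA] using hi'), mul_zero]

theorem fullSum_univ [Nonempty α] (v : Perm α) :
    fullSum v univ = (Fintype.card α - 1).factorial * (-1) ^ (Fintype.card α - 1) *
      ((Perm.sign v : ℤ) : ℝ) := by
  unfold fullSum
  rw [← card_isFull (α := α), ← nsmul_eq_mul, smul_mul_assoc, ← Finset.sum_const]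
  apply Finset.sum_congr rfl
  intro h hh
  have hf : IsFull h := by simpa using hh
  rw [W_univ, Perm.sign_mul, hf.sign]
  push_cast
  rfl

theorem isFull_swap_conj {h : Perm α} (s : Perm α) : IsFull (s * h * s⁻¹) ↔ IsFull h := by
  rw [← IsFull.conj s (h := h)]
  rfl

/-- The weight of redirecting `v` at `p` to `q` on `insert p A`. -/
noncomputable def redirect (v : Perm α) (A : Finset α) : ℝ :=
  ∑ p ∈ Aᶜ, ∑ q ∈ univ.erase p, W (Function.update v p q) (insert p A)

theorem image_update_insert {v : Perm α} {A : Finset α} {p q : α} (hp : p ∉ A) :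
    (insert p A).image (Function.update v p q) = insert q (A.image v) := by
  rw [Finset.image_insert, Function.update_self]
  congr 1
  apply Finset.image_congr
  intro i hi
  rw [Function.update_of_ne]
  rintro rfl
  exact hp hi

theorem redirect_ne_zero {v : Perm α} {A : Finset α} {p q : α} (hp : p ∉ A) (hpq : q ≠ p)
    (h : W (Function.update v p q) (insert p A) ≠ 0) :
    p ∈ A.image v \ A ∧ ∀ x ∈ A \ A.image v, x = q := by
  have h1 := image_eq_of_W_ne_zero h
  rw [image_update_insert hp] at h1
  constructor
  · rw [Finset.mem_sdiff]
    refine ⟨?_, hp⟩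
    have : p ∈ insert q (A.image v) := by rw [h1]; simp
    rcases Finset.mem_insert.1 this with h2 | h2
    · exact absurd h2.symm hpq
    · exact h2
  · intro x hx
    rw [Finset.mem_sdiff] at hx
    have : x ∈ insert q (A.image v) := by rw [h1]; simp [hx.1]
    rcases Finset.mem_insert.1 this with h2 | h2
    · exact h2
    · exact absurd h2 hx.2

theorem redirect_univ (v : Perm α) : redirect v univ = 0 := by simp [redirect]

theorem redirect_empty (v : Perm α) : redirect v ∅ = 0 := by
  unfold redirect
  apply Finset.sum_eq_zero
  intro p _
  apply Finset.sum_eq_zero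
  intro q hq
  by_contra hne
  have := (redirect_ne_zero (by simp) (Finset.ne_of_mem_erase hq) hne).1
  simp at this

theorem fullSum_eq {v : Perm α} {A : Finset α} (hne : A.Nonempty) (hne' : Aᶜ.Nonempty) :
    fullSum v A = (-1) ^ #A * ((#A - 1).factorial * (Fintype.card α - #A - 1).factorial : ℕ) *
      redirect v A := by
  have hcard : #(A \ A.image v) = #(A.image v \ A) := by
    have h1 := Finset.card_sdiff_add_card_inter A (A.image v)
    have h2 := Finset.card_sdiff_add_card_inter (A.image v) A
    rw [Finset.card_image_of_injective _ v.injective, Finset.inter_comm] at h2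
    omega
  rcases Nat.lt_or_ge (#(A \ A.image v)) 1 with h0 | h0
  · -- `v` preserves `A`
    have e1 : A.image v \ A = ∅ := by
      rw [← Finset.card_eq_zero]; omega
    have e2 : A ⊆ A.image v := by
      rw [← Finset.sdiff_eq_empty_iff_subset, ← Finset.card_eq_zero]; omega
    have r0 : redirect v A = 0 := by
      unfold redirect
      apply Finset.sum_eq_zero
      intro p hp
      apply Finset.sum_eq_zero
      intro q hq
      by_contra hc
      have := (redirect_ne_zero (by simpa using hp) (Finset.ne_of_mem_erase hq) hc).1
      rw [e1] at this
      simp at this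
    rw [r0, mul_zero]
    unfold fullSum
    apply Finset.sum_eq_zero
    intro h hh
    have hf : IsFull h := by simpa using hh
    by_contra hc
    have hi := image_eq_of_W_ne_zero hc
    rcases hf A (by
      intro i hiA
      obtain ⟨j, hj, rfl⟩ := Finset.mem_image.1 (e2 hiA)
      have : (h * v) j ∈ A.image (h * v : Perm α) := Finset.mem_image_of_mem _ hj
      rw [hi] at this
      exact this) with h1 | h1
    · exact hne.ne_empty h1
    · rw [h1] at hne'; simp at hne'
  rcases Nat.lt_or_ge (#(A \ A.image v)) 2 with h1 | h1
  · obtain ⟨q, hq⟩ := Finset.card_eq_one.1 (show #(A \ A.image v) = 1 by omega)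
    obtain ⟨p, hp⟩ := Finset.card_eq_one.1 (show #(A.image v \ A) = 1 by omega)
    have hqm : q ∈ A \ A.image v := by rw [hq]; simp
    have hpm : p ∈ A.image v \ A := by rw [hp]; simp
    rw [Finset.mem_sdiff] at hqm hpm
    have hpq : q ≠ p := by rintro rfl; exact hpm.2 hqm.1
    have r1 : redirect v A = W (Function.update v p q) (insert p A) := by
      unfold redirect
      rw [Finset.sum_eq_single p, Finset.sum_eq_single q]
      · intro q' hq' hne
        by_contra hc
        exact hne ((redirect_ne_zero hpm.2 (Finset.ne_of_mem_erase hq') hc).2 q (by simp [hq])).symm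
      · intro hh; simp [hpq] at hh
      · intro p' hp' hne
        apply Finset.sum_eq_zero
        intro q' hq'
        by_contra hc
        have := (redirect_ne_zero (by simpa using hp') (Finset.ne_of_mem_erase hq') hc).1
        rw [hp] at this
        exact hne (by simpa using this)
      · intro hh; simp [hpm.2] at hh
    have hvA : ∀ i ∈ A, v i = p ∨ (v i ∈ A ∧ v i ≠ q ∧ v i ≠ p) := by
      intro i hi
      by_cases hvi : v i ∈ A
      · right
        refine ⟨hvi, ?_, ?_⟩
        · rintro h; exact hqm.2 (h ▸ Finset.mem_image_of_mem _ hi)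
        · rintro h; exact hpm.2 (h ▸ hvi)
      · left
        have : v i ∈ A.image v \ A := by simp [hi, hvi]
        rw [hp] at this
        simpa using this
    have hpres : ∀ i ∈ A, (swap p q * v) i ∈ A := by
      intro i hi
      rw [Perm.mul_apply]
      rcases hvA i hi with h | ⟨h, h2, h3⟩
      · rw [h, swap_apply_left]; exact hqm.1
      · rw [swap_apply_of_ne_of_ne h3 h2]; exact h
    have r2 : redirect v A = - W (swap p q * v : Perm α) A := by
      rw [r1]
      have : (insert p A).piecewise (Function.update v p q) id =
          (swap p q : Perm α) ∘ A.piecewise (swap p q * v : Perm α) id := by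
        ext i
        by_cases hip : i = p
        · subst hip; simp [hpm.2]
        · by_cases hi : i ∈ A
          · simp [hip, hi]
          · have hiq : i ≠ q := by rintro rfl; exact hi hqm.1
            simp [hip, hi, swap_apply_of_ne_of_ne hip hiq]
      unfold W
      rw [this, fnDet_comp, fnDet_perm, Perm.sign_swap hpq.symm]
      simp
    have g1 : fullSum v A = (∑ h ∈ univ.filter (fun h : Perm α => IsFull h),
        W (h * swap p q : Perm α) A) * W (swap p q * v : Perm α) A := by
      unfold fullSum
      rw [Finset.sum_mul]
      apply Finset.sum_congr rfl
      intro h _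
      rw [← W_mul hpres]
      congr 1
      ext i
      simp
    have g2 : ∑ h ∈ univ.filter (fun h : Perm α => IsFull h), W (h * swap p q : Perm α) A =
        ∑ h ∈ univ.filter (fun h : Perm α => FullOn h A ∧ FullOn h Aᶜ), (-1 : ℝ) ^ (#A - 1) := by
      rw [Finset.sum_filter, Finset.sum_filter]
      rw [← Equiv.sum_comp (Equiv.mulRight (swap p q))]
      apply Finset.sum_congr rfl
      intro h _
      simp only [Equiv.coe_mulRight, mul_assoc, swap_mul_self, mul_one]
      by_cases hA : ∀ i ∈ A, h i ∈ A
      · have := isFull_mul_swap_iff hpm.2 hqm.1 hA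
        by_cases hf : IsFull (h * swap p q)
        · rw [if_pos hf, if_pos (this.1 hf), (this.1 hf).1.W_eq hne]
        · rw [if_neg hf, if_neg (fun h => hf (this.2 h))]
      · rw [if_neg (c := FullOn h A ∧ FullOn h Aᶜ) (fun h => hA h.1.1)]
        push Not at hA
        obtain ⟨i, hi, hi'⟩ := hA
        rw [W_eq_zero_of_not_mem hi hi']
        simp
    rw [g1, g2, Finset.sum_const, card_fullOn_fullOn_compl hne hne', r2, nsmul_eq_mul]
    have : (-1 : ℝ) ^ #A = - (-1) ^ (#A - 1) := by
      obtain ⟨k, hk⟩ := Nat.exists_eq_add_of_lt (Finset.card_pos.2 hne)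
      rw [hk]
      simp [pow_succ]
    rw [this]
    ring
  · have r0 : redirect v A = 0 := by
      unfold redirect
      apply Finset.sum_eq_zero
      intro p hp
      apply Finset.sum_eq_zero
      intro q hq
      by_contra hc
      have h3 := (redirect_ne_zero (by simpa using hp) (Finset.ne_of_mem_erase hq) hc).2
      have : #(A \ A.image v) ≤ #{q} := Finset.card_le_card (fun x hx => by simp [h3 x hx])
      simp at this
      omega
    rw [r0, mul_zero]
    obtain ⟨a, ha, b, hb, hab⟩ := Finset.one_lt_card.1 (show 1 < #(A \ A.image v) by omega)
    rw [Finset.mem_sdiff] at ha hb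
    have : fullSum v A = - fullSum v A := by
      conv_lhs => unfold fullSum
      rw [Finset.sum_filter, ← Equiv.sum_comp (MulAut.conj (swap a b)).toEquiv]
      simp only [MulEquiv.toEquiv_eq_coe, MulEquiv.coe_toEquiv, MulAut.conj_apply, isFull_swap_conj]
      rw [← Finset.sum_filter]
      unfold fullSum
      rw [← Finset.sum_neg_distrib]
      apply Finset.sum_congr rfl
      intro h _
      have e1 : W (swap a b * h * (swap a b)⁻¹ * v : Perm α) A =
          W ((swap a b : Perm α) ∘ (h * v : Perm α)) A := by
        apply W_congr
        intro i hi
        simp only [swap_inv, Perm.coe_mul, Function.comp_apply]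
        rw [swap_apply_of_ne_of_ne (x := v i)]
        · rintro h; exact ha.2 (h ▸ Finset.mem_image_of_mem _ hi)
        · rintro h; exact hb.2 (h ▸ Finset.mem_image_of_mem _ hi)
      rw [e1, W_comp_perm_of_supported, Perm.sign_swap hab]
      · simp
      · intro i hi
        apply swap_apply_of_ne_of_ne
        · rintro rfl; exact hi ha.1
        · rintro rfl; exact hi hb.1
    linarith

theorem card_mul_fullPairs_eq [Nonempty α] (v : Perm α) :
    (Fintype.card α : ℝ) * fullPairs v = (Fintype.card α).factorial * ((Perm.sign v : ℤ) : ℝ) -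
      ∑ A : Finset α, ((#A).factorial * (Fintype.card α - 1 - #A).factorial : ℕ) * redirect v A := by
  rw [card_mul_fullPairs, ← Finset.sum_erase_add _ _ (mem_univ (univ : Finset α)),
    ← Finset.sum_erase_add (a := univ) (f := fun A : Finset α =>
      (((#A).factorial * (Fintype.card α - 1 - #A).factorial : ℕ) : ℝ) * redirect v A) _ (mem_univ _)]
  simp only [redirect_univ, mul_zero, add_zero, fullSum_univ, neg_add, Finset.card_univ]
  rw [add_comm, sub_eq_add_neg, ← Finset.sum_neg_distrib, ← Finset.sum_neg_distrib]
  have hpos := Fintype.card_pos (α := α)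
  congr 1
  · obtain ⟨k, hk⟩ := Nat.exists_eq_add_of_lt hpos
    rw [hk]
    simp only [zero_add, Nat.add_sub_cancel, Nat.factorial_succ]
    push_cast
    have : ((-1 : ℝ) ^ k) * (-1) ^ k = 1 := by rw [← mul_pow]; simp
    rw [pow_succ]
    linear_combination ((k : ℝ) + 1) * k.factorial * ((Perm.sign v : ℤ) : ℝ) * this
  · apply Finset.sum_congr rfl
    intro A hA
    have hAu : A ≠ univ := Finset.ne_of_mem_erase hA
    by_cases hA0 : A = ∅
    · subst hA0; simp [redirect_empty]
    · have hne := Finset.nonempty_iff_ne_empty.2 hA0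
      rw [fullSum_eq hne (by rw [Finset.nonempty_iff_ne_empty]; simpa using hAu)]
      obtain ⟨k, hk⟩ := Nat.exists_eq_add_of_lt (Finset.card_pos.2 hne)
      have e : Fintype.card α - #A - 1 = Fintype.card α - 1 - #A := by omega
      rw [e, hk]
      simp only [zero_add, Nat.add_sub_cancel, Nat.factorial_succ]
      push_cast
      have : ((-1 : ℝ) ^ (k + 1)) * (-1) ^ (k + 1) = 1 := by rw [← mul_pow]; simp
      linear_combination (-((k : ℝ) + 1) * k.factorial *
        (Fintype.card α - 1 - (k + 1)).factorial * redirect v A) * this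

end FullSum

theorem integral_pow_mul_one_sub_pow (a b : ℕ) :
    ∫ s in (0 : ℝ)..1, s ^ a * (1 - s) ^ b = (a.factorial * b.factorial : ℝ) / (a + b + 1).factorial := by
  induction b generalizing a with
  | zero =>
    simp only [pow_zero, mul_one, integral_pow, Nat.add_zero, Nat.factorial_succ]
    have : (a.factorial : ℝ) ≠ 0 := by positivity
    push_cast
    field_simp
    simp
  | succ b ih =>
    have hd : ∀ s ∈ Set.uIcc (0 : ℝ) 1, HasDerivAt (fun s : ℝ => s ^ (a + 1) * (1 - s) ^ (b + 1))
        ((a + 1) * (s ^ a * (1 - s) ^ (b + 1)) - (b + 1) * (s ^ (a + 1) * (1 - s) ^ b)) s := by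
      intro s _
      have h1 := hasDerivAt_pow (a + 1) s
      have h2 : HasDerivAt (fun s : ℝ => (1 - s) ^ (b + 1)) ((b + 1 : ℕ) * (1 - s) ^ b * (-1)) s := by
        have := ((hasDerivAt_id' s).const_sub 1).fun_pow (b + 1)
        simpa using this
      refine (h1.fun_mul h2).congr_deriv ?_
      push_cast
      ring
    have h1 := intervalIntegral.integral_eq_sub_of_hasDerivAt hd
      (Continuous.intervalIntegrable (by fun_prop) _ _)
    rw [intervalIntegral.integral_sub (Continuous.intervalIntegrable (by fun_prop) _ _)
      (Continuous.intervalIntegrable (by fun_prop) _ _), intervalIntegral.integral_const_mul,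
      intervalIntegral.integral_const_mul, ih] at h1
    simp only [one_pow, sub_self, ne_eq, Nat.add_eq_zero_iff, one_ne_zero, and_false,
      not_false_eq_true, zero_pow, mul_zero, zero_mul] at h1
    have e : (a + 1 + b + 1) = a + (b + 1) + 1 := by ring
    rw [e] at h1
    have h2 : ((a : ℝ) + 1) * ∫ s in (0 : ℝ)..1, s ^ a * (1 - s) ^ (b + 1) =
      (b + 1) * (((a + 1).factorial : ℝ) * b.factorial / (a + (b + 1) + 1).factorial) := by linarith
    have ha : (a : ℝ) + 1 ≠ 0 := by positivity
    rw [eq_comm, ← mul_right_inj' ha, h2, Nat.factorial_succ a, Nat.factorial_succ b]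
    push_cast
    ring

section Integral
variable {α : Type*} [Fintype α] [DecidableEq α]

/-- The determinant of `(1 - s) I + s P_v`. -/
noncomputable def interpDet (v : Perm α) (s : ℝ) : ℝ :=
  Matrix.det (Matrix.of fun i => (1 - s) • (Pi.single i (1 : ℝ) : α → ℝ) + s • Pi.single (v i) 1)

theorem interpDet_eq (v : Perm α) (s : ℝ) :
    interpDet v s = ∑ A : Finset α, s ^ #A * (1 - s) ^ (Fintype.card α - #A) * W v A := by
  rw [interpDet, det_expand]
  simp [Finset.card_compl]

theorem sum_adjugate (v : Perm α) (s : ℝ) (q : α) :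
    ∑ p, Matrix.det (Matrix.updateRow (Matrix.of fun i => (1 - s) • (Pi.single i (1 : ℝ) : α → ℝ) +
      s • Pi.single (v i) 1) p (Pi.single q 1)) = interpDet v s := by
  simp_rw [← Matrix.adjugate_apply]
  set M := (Matrix.of fun i => (1 - s) • (Pi.single i (1 : ℝ) : α → ℝ) + s • Pi.single (v i) 1) with hM
  have h1 : Matrix.mulVec M (fun _ => 1) = fun _ => 1 := by
    ext i
    simp [hM, Matrix.mulVec, dotProduct, Pi.single_apply, Finset.sum_add_distrib]
  have h2 : Matrix.mulVec (M.adjugate) (fun _ => 1) = fun _ => M.det := by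
    conv_lhs => rw [← h1]
    rw [Matrix.mulVec_mulVec, Matrix.adjugate_mul, Matrix.smul_mulVec, Matrix.one_mulVec]
    ext; simp
  have := congrFun h2 q
  rw [interpDet, ← hM]
  simpa [Matrix.mulVec, dotProduct] using this

theorem det_updateRow_expand (v : Perm α) (s : ℝ) (p q : α) :
    Matrix.det (Matrix.updateRow (Matrix.of fun i => (1 - s) • (Pi.single i (1 : ℝ) : α → ℝ) +
      s • Pi.single (v i) 1) p (Pi.single q 1)) =
    ∑ A ∈ univ.filter (fun A : Finset α => p ∉ A), s ^ #A * (1 - s) ^ (Fintype.card α - 1 - #A) *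
      W (Function.update v p q) (insert p A) := by
  have h0 : Matrix.updateRow (Matrix.of fun i => (1 - s) • (Pi.single i (1 : ℝ) : α → ℝ) +
      s • Pi.single (v i) 1) p (Pi.single q 1) = Matrix.of fun i =>
        (if i = p then 0 else 1 - s) • (Pi.single i (1 : ℝ) : α → ℝ) +
        (if i = p then 1 else s) • Pi.single (Function.update v p q i) 1 := by
    ext i j
    by_cases hip : i = p
    · subst hip; simp
    · simp [hip]
  rw [h0, det_expand]
  have h1 : ∑ B : Finset α, (∏ i ∈ B, if i = p then 1 else s) * (∏ i ∈ Bᶜ, if i = p then 0 else 1 - s) *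
      W (Function.update v p q) B =
      ∑ B ∈ univ.filter (fun B : Finset α => p ∈ B), (∏ i ∈ B, if i = p then 1 else s) *
        (∏ i ∈ Bᶜ, if i = p then 0 else 1 - s) * W (Function.update v p q) B := by
    symm
    apply Finset.sum_filter_of_ne
    intro B _ hB
    by_contra hpB
    apply hB
    rw [Finset.prod_eq_zero (s := Bᶜ) (i := p) (by simpa using hpB) (by simp)]
    simp
  rw [h1]
  symm
  refine Finset.sum_bij' (fun A _ => insert p A) (fun B _ => B.erase p) ?_ ?_ ?_ ?_ ?_
  · intro A _; simp
  · intro B _; simp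
  · intro A hA
    simp only [mem_filter, mem_univ, true_and] at hA
    exact Finset.erase_insert hA
  · intro B hB
    simp only [mem_filter, mem_univ, true_and] at hB
    exact Finset.insert_erase hB
  · intro A hA
    simp only [mem_filter, mem_univ, true_and] at hA
    congr 2
    · rw [Finset.prod_insert hA, if_pos rfl, one_mul, ← Finset.prod_const]
      apply Finset.prod_congr rfl
      intro i hi
      rw [if_neg]
      rintro rfl; exact hA hi
    · have : ∏ i ∈ (insert p A)ᶜ, (if i = p then 0 else 1 - s) = ∏ i ∈ (insert p A)ᶜ, (1 - s) := by
        apply Finset.prod_congr rfl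
        intro i hi
        rw [if_neg]
        rintro rfl; simp at hi
      rw [this, Finset.prod_const, Finset.card_compl, Finset.card_insert_of_notMem hA]
      congr 1
      omega

theorem card_mul_interpDet (v : Perm α) (s : ℝ) :
    (Fintype.card α : ℝ) * interpDet v s =
      ∑ A : Finset α, (((Fintype.card α : ℝ) - #A) * W v A + redirect v A) *
        (s ^ #A * (1 - s) ^ (Fintype.card α - 1 - #A)) := by
  have h1 : (Fintype.card α : ℝ) * interpDet v s = ∑ q : α, ∑ p : α,
      Matrix.det (Matrix.updateRow (Matrix.of fun i => (1 - s) • (Pi.single i (1 : ℝ) : α → ℝ) +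
      s • Pi.single (v i) 1) p (Pi.single q 1)) := by
    simp_rw [sum_adjugate]
    simp
  rw [h1, Finset.sum_comm]
  simp_rw [det_updateRow_expand, Finset.sum_filter]
  have h2 : ∀ p : α, ∑ q : α, ∑ A : Finset α, (if p ∉ A then s ^ #A * (1 - s) ^ (Fintype.card α - 1 - #A) *
      W (Function.update v p q) (insert p A) else 0) = ∑ A : Finset α, if p ∉ A then
      ∑ q : α, s ^ #A * (1 - s) ^ (Fintype.card α - 1 - #A) *
      W (Function.update v p q) (insert p A) else 0 := by
    intro p
    rw [Finset.sum_comm]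
    apply Finset.sum_congr rfl
    intro A _
    split_ifs <;> simp
  simp_rw [h2]
  rw [Finset.sum_comm]
  apply Finset.sum_congr rfl
  intro A _
  rw [← Finset.sum_filter]
  have h3 : (univ.filter fun p => p ∉ A) = Aᶜ := by ext; simp
  rw [h3]
  simp_rw [← Finset.mul_sum]
  rw [mul_comm]
  congr 1
  have h4 : ∀ p ∈ Aᶜ, ∑ q, W (Function.update v p q) (insert p A) =
      W v A + ∑ q ∈ univ.erase p, W (Function.update v p q) (insert p A) := by
    intro p hp
    rw [← Finset.add_sum_erase _ _ (mem_univ p)]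
    congr 1
    unfold W
    congr 1
    ext i
    by_cases hip : i = p
    · subst hip
      have : i ∉ A := by simpa using hp
      simp [this]
    · by_cases hi : i ∈ A <;> simp [hip, hi]
  rw [Finset.sum_congr rfl h4, Finset.sum_add_distrib, Finset.sum_const, Finset.card_compl,
    nsmul_eq_mul, Nat.cast_sub (Finset.card_le_univ A)]
  rfl

theorem fullPairs_eq_integral [Nonempty α] (v : Perm α) :
    (fullPairs v : ℝ) = (Fintype.card α - 1).factorial * ∫ s in (0 : ℝ)..1, interpDet v s := by
  set n := Fintype.card α with hn
  have hpos : 0 < n := Fintype.card_pos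
  have hle : ∀ A : Finset α, #A ≤ n := fun A => Finset.card_le_univ A
  have h1 : ∫ s in (0 : ℝ)..1, interpDet v s = ∑ A : Finset α,
      ((#A).factorial * (n - #A).factorial : ℝ) / (n + 1).factorial * W v A := by
    simp_rw [interpDet_eq]
    rw [intervalIntegral.integral_finsetSum
      (fun A _ => Continuous.intervalIntegrable (by fun_prop) _ _)]
    apply Finset.sum_congr rfl
    intro A _
    rw [intervalIntegral.integral_mul_const, integral_pow_mul_one_sub_pow]
    congr 4
    have := hle A; omega
  have h2 : (n : ℝ) * ∫ s in (0 : ℝ)..1, interpDet v s = ∑ A : Finset α,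
      ((n - #A : ℝ) * W v A + redirect v A) * (((#A).factorial * (n - 1 - #A).factorial : ℝ) / n.factorial) := by
    rw [← intervalIntegral.integral_const_mul]
    simp_rw [hn, card_mul_interpDet]
    rw [intervalIntegral.integral_finsetSum
      (fun A _ => Continuous.intervalIntegrable (by fun_prop) _ _)]
    apply Finset.sum_congr rfl
    intro A _
    rw [intervalIntegral.integral_const_mul]
    by_cases hA : A = univ
    · subst hA
      simp [redirect_univ]
    · rw [integral_pow_mul_one_sub_pow]
      have h3 : #A < n := by
        rw [hn, Finset.card_lt_iff_ne_univ]; exact hA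
      congr 4
      omega
  have h3 := card_mul_fullPairs_eq v
  have h4 : ∑ A : Finset α, (n - #A : ℝ) * W v A * (((#A).factorial * (n - 1 - #A).factorial : ℝ) / n.factorial)
      = (n + 1) * (∫ s in (0 : ℝ)..1, interpDet v s) - ((Perm.sign v : ℤ) : ℝ) := by
    rw [h1, Finset.mul_sum, ← Finset.sum_erase_add _ _ (mem_univ (univ : Finset α)),
      ← Finset.sum_erase_add (a := univ) (f := fun A : Finset α => ((n : ℝ) + 1) *
        (((#A).factorial * (n - #A).factorial : ℝ) / (n + 1).factorial * W v A)) _ (mem_univ _)]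
    have e1 : ((n : ℝ) + 1) * (((#(univ : Finset α)).factorial * (n - #(univ : Finset α)).factorial : ℝ) /
      (n + 1).factorial * W v univ) = ((Perm.sign v : ℤ) : ℝ) := by
      rw [Finset.card_univ, ← hn, Nat.sub_self, W_univ, Nat.factorial_succ]
      push_cast
      have : (n.factorial : ℝ) ≠ 0 := by positivity
      have : (n : ℝ) + 1 ≠ 0 := by positivity
      simp
      field_simp
    rw [e1, Finset.card_univ, ← hn]
    simp only [sub_self, zero_mul, add_zero, add_sub_cancel_right]
    apply Finset.sum_congr rfl
    intro A hA
    have h3 : #A < n := by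
      rw [hn, Finset.card_lt_iff_ne_univ]; exact Finset.ne_of_mem_erase hA
    obtain ⟨k, hk⟩ := Nat.exists_eq_add_of_lt h3
    have e2 : n - #A = k + 1 := by omega
    have e3 : n - 1 - #A = k := by omega
    have e4 : (n : ℝ) - #A = k + 1 := by rw [hk]; push_cast; ring
    rw [e2, e3, e4, Nat.factorial_succ k, Nat.factorial_succ n]
    push_cast
    have : (n.factorial : ℝ) ≠ 0 := by positivity
    have : (n : ℝ) + 1 ≠ 0 := by positivity
    field_simp
  simp_rw [add_mul] at h2
  rw [Finset.sum_add_distrib, h4] at h2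
  have h5 : ∑ A : Finset α, redirect v A * (((#A).factorial * (n - 1 - #A).factorial : ℝ) / n.factorial) =
      (∑ A : Finset α, ((#A).factorial * (n - 1 - #A).factorial : ℕ) * redirect v A) / n.factorial := by
    rw [Finset.sum_div]
    apply Finset.sum_congr rfl
    intro A _
    push_cast
    ring
  rw [h5] at h2
  have h6 : (n.factorial : ℝ) = n * (n - 1).factorial := by
    exact_mod_cast (Nat.mul_factorial_pred hpos.ne').symm
  have hf : (n.factorial : ℝ) ≠ 0 := by positivity
  have hn0 : (n : ℝ) ≠ 0 := by positivity
  rw [← mul_right_inj' hn0, h3, ← mul_assoc, ← h6]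
  field_simp at h2 ⊢
  linarith

end Integral

section Hadamard
variable {α : Type*} [Fintype α] [DecidableEq α]

theorem abs_det_le_prod_fin {n : ℕ} (M : Matrix (Fin n) (Fin n) ℝ) :
    |M.det| ≤ ∏ i, √(∑ j, M i j ^ 2) := by
  have : Fact (Module.finrank ℝ (EuclideanSpace ℝ (Fin n)) = n) := ⟨by simp⟩
  let b := EuclideanSpace.basisFun (Fin n) ℝ
  have h1 := b.toBasis.orientation.abs_volumeForm_apply_le (fun i => WithLp.toLp 2 (M i))
  rw [Orientation.volumeForm_robust' _ b] at h1
  have h2 : b.toBasis.det (fun i => WithLp.toLp 2 (M i)) = M.det := by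
    rw [Module.Basis.det_apply, ← Matrix.det_transpose]
    congr 1
  rw [h2] at h1
  simpa [EuclideanSpace.norm_eq] using h1

/-- Hadamard's inequality. -/
theorem abs_det_le_prod (M : Matrix α α ℝ) : |M.det| ≤ ∏ i, √(∑ j, M i j ^ 2) := by
  let e := Fintype.equivFin α
  have h := abs_det_le_prod_fin (Matrix.reindex e e M)
  rw [Matrix.det_reindex_self] at h
  refine h.trans (le_of_eq ?_)
  rw [← Equiv.prod_comp e]
  apply Finset.prod_congr rfl
  intro i _
  rw [← Equiv.sum_comp e]
  simp

theorem abs_interpDet_le (v : Perm α) {s : ℝ} :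
    |interpDet v s| ≤ Real.exp (-(#v.support * (s * (1 - s)))) := by
  refine (abs_det_le_prod _).trans ?_
  have h1 : Real.exp (-(#v.support * (s * (1 - s)))) =
      ∏ i : α, if v i = i then 1 else Real.exp (-(s * (1 - s))) := by
    rw [Finset.prod_ite, Finset.prod_const_one, one_mul, Finset.prod_const, ← Real.exp_nat_mul]
    congr 1
    have : (univ.filter fun i => ¬ v i = i) = v.support := by ext; simp
    rw [this]
    ring
  rw [h1]
  apply Finset.prod_le_prod
  · intros; positivity
  · intro i _
    split_ifs with hi
    · simp [Pi.single_apply, hi]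
      rw [Finset.sum_eq_single i] <;> simp +contextual
    · rw [Real.sqrt_le_left (by positivity), ← Real.exp_nat_mul]
      have h2 : ∑ j, (Matrix.of (fun i => (1 - s) • (Pi.single i (1 : ℝ) : α → ℝ) +
          s • Pi.single (v i) 1) i j) ^ 2 = (1 - s) ^ 2 + s ^ 2 := by
        have : ∀ j, (Matrix.of (fun i => (1 - s) • (Pi.single i (1 : ℝ) : α → ℝ) +
          s • Pi.single (v i) 1) i j) ^ 2 = (if j = i then (1 - s) ^ 2 else 0) +
            (if j = v i then s ^ 2 else 0) := by
          intro j
          by_cases h3 : j = i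
          · subst h3
            simp [Ne.symm hi]
          · by_cases h4 : j = v i <;> simp [h3, h4, hi]
        simp_rw [this, Finset.sum_add_distrib]
        simp
      rw [h2]
      have := Real.add_one_le_exp ((2 : ℕ) * -(s * (1 - s)))
      push_cast at this ⊢
      nlinarith

theorem integral_exp_neg_le {c : ℝ} (hc : 0 < c) : ∫ s in (0 : ℝ)..1, Real.exp (-(c * s)) ≤ 1 / c := by
  have h1 : ∀ s ∈ Set.uIcc (0 : ℝ) 1, HasDerivAt (fun s => -(1 / c) * Real.exp (-(c * s)))
      (Real.exp (-(c * s))) s := by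
    intro s _
    have := (((hasDerivAt_id' s).const_mul c).fun_neg.exp).const_mul (-(1 / c))
    refine this.congr_deriv ?_
    field_simp
  rw [intervalIntegral.integral_eq_sub_of_hasDerivAt h1
    (Continuous.intervalIntegrable (by fun_prop) _ _)]
  have : 0 ≤ 1 / c * Real.exp (-(c * 1)) := by positivity
  simp only [mul_zero, neg_zero, Real.exp_zero]
  linarith

theorem fullPairs_le [Nonempty α] (v : Perm α) {δ : ℝ} (h0 : 0 < δ) (h1 : δ ≤ 1 / 2)
    (hN : 0 < #v.support) :
    (fullPairs v : ℝ) ≤ (Fintype.card α - 1).factorial *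
      (2 / (#v.support * (1 - δ)) + Real.exp (-(#v.support * δ / 2))) := by
  rw [fullPairs_eq_integral]
  gcongr
  set N : ℝ := (#v.support : ℝ) with hNdef
  have hN' : 0 < N := by positivity
  have hc : 0 < N * (1 - δ) := by have : 0 < 1 - δ := by linarith
                                  positivity
  have hcont : Continuous (interpDet v) := by
    have : interpDet v = fun s => ∑ A : Finset α, s ^ #A * (1 - s) ^ (Fintype.card α - #A) * W v A := by
      ext s; exact interpDet_eq v s
    rw [this]
    fun_prop
  have hle : ∫ s in (0 : ℝ)..1, interpDet v s ≤ ∫ s in (0 : ℝ)..1,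
      (Real.exp (-(N * (1 - δ) * s)) + Real.exp (-(N * (1 - δ) * (1 - s))) + Real.exp (-(N * δ / 2))) := by
    apply intervalIntegral.integral_mono_on (by norm_num) (hcont.intervalIntegrable _ _)
      (Continuous.intervalIntegrable (by fun_prop) _ _)
    intro s hs
    refine ((le_abs_self _).trans (abs_interpDet_le v)).trans ?_
    have p1 := Real.exp_pos (-(N * (1 - δ) * s))
    have p2 := Real.exp_pos (-(N * (1 - δ) * (1 - s)))
    have p3 := Real.exp_pos (-(N * δ / 2))
    obtain ⟨hs0, hs1⟩ := hs
    rcases le_total s δ with hsδ | hsδ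
    · have : Real.exp (-(N * (s * (1 - s)))) ≤ Real.exp (-(N * (1 - δ) * s)) := by
        apply Real.exp_le_exp.2
        have : (1 - δ) * s ≤ s * (1 - s) := by nlinarith
        nlinarith
      linarith
    · rcases le_total (1 - δ) s with hsδ' | hsδ'
      · have : Real.exp (-(N * (s * (1 - s)))) ≤ Real.exp (-(N * (1 - δ) * (1 - s))) := by
          apply Real.exp_le_exp.2
          have : (1 - δ) * (1 - s) ≤ s * (1 - s) := by nlinarith
          nlinarith
        linarith
      · have : Real.exp (-(N * (s * (1 - s)))) ≤ Real.exp (-(N * δ / 2)) := by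
          apply Real.exp_le_exp.2
          have : δ / 2 ≤ s * (1 - s) := by nlinarith
          nlinarith
        linarith
  refine hle.trans ?_
  rw [intervalIntegral.integral_add (Continuous.intervalIntegrable (by fun_prop) _ _)
    (Continuous.intervalIntegrable (by fun_prop) _ _),
    intervalIntegral.integral_add (Continuous.intervalIntegrable (by fun_prop) _ _)
    (Continuous.intervalIntegrable (by fun_prop) _ _)]
  have e1 := integral_exp_neg_le hc
  have e2 : ∫ s in (0 : ℝ)..1, Real.exp (-(N * (1 - δ) * (1 - s))) =
      ∫ s in (0 : ℝ)..1, Real.exp (-(N * (1 - δ) * s)) := by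
    have := intervalIntegral.integral_comp_sub_left (fun s => Real.exp (-(N * (1 - δ) * s))) (a := 0) (b := 1) (1 : ℝ)
    simpa using this
  rw [e2]
  simp only [intervalIntegral.integral_const, sub_zero, smul_eq_mul, one_mul]
  have : 2 / (N * (1 - δ)) = 1 / (N * (1 - δ)) + 1 / (N * (1 - δ)) := by ring
  rw [this]
  linarith

end Hadamard

section Exposure
variable {α ι : Type*} [Fintype α] [DecidableEq α] [Fintype ι] [LinearOrder ι]

/-- The answer to a query about a pair of permutations. -/
def answer (e : Bool → Perm α) (q : Bool × α) : α := e q.1 q.2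

/-- The event that each query in `J` is new and is answered inside its target set. -/
noncomputable def hitEvent (q : ι → (Bool → Perm α) → Bool × α)
    (T : ι → (Bool → Perm α) → Finset α) (J : Finset ι) : Finset (Bool → Perm α) :=
  univ.filter fun e => ∀ j ∈ J, (∀ j' < j, q j' e ≠ q j e) ∧ answer e (q j e) ∈ T j e

theorem card_hitEvent_le (q : ι → (Bool → Perm α) → Bool × α)
    (T : ι → (Bool → Perm α) → Finset α) (M : ℕ)
    (hq : ∀ j e e', (∀ j' < j, answer e (q j' e) = answer e' (q j' e')) →
      q j e = q j e' ∧ T j e = T j e')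
    (hM : ∀ j e, #(T j e) ≤ M) (J : Finset ι) :
    #(hitEvent q T J) * (Fintype.card α - Fintype.card ι) ^ #J ≤
      M ^ #J * Fintype.card (Bool → Perm α) := by
  induction J using Finset.induction_on_max with
  | empty => simp [hitEvent]
  | insert j J hmax ih =>
    have hj : j ∉ J := fun h => lt_irrefl _ (hmax j h)
    rw [Finset.card_insert_of_notMem hj, pow_succ, pow_succ]
    have key : #(hitEvent q T (insert j J)) * (Fintype.card α - Fintype.card ι) ≤
        #(hitEvent q T J) * M := by
      let used : (Bool → Perm α) → Finset α := fun e =>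
        (univ.filter fun j' => j' < j).image fun j' => e (q j e).1 (q j' e).2
      have hused : ∀ e, Fintype.card α - Fintype.card ι ≤ #(used e)ᶜ := by
        intro e
        rw [Finset.card_compl]
        apply Nat.sub_le_sub_left
        exact (Finset.card_image_le).trans (Finset.card_le_univ _)
      let modify : (Σ _ : (Bool → Perm α), α) → (Bool → Perm α) := fun x =>
        Function.update x.1 (q j x.1).1
          (swap (answer x.1 (q j x.1)) x.2 * x.1 (q j x.1).1)
      have hmod : ∀ e b, (∀ j' < j, q j' e ≠ q j e) → b ∉ used e → ∀ j' < j,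
          answer e (q j' e) = answer (modify ⟨e, b⟩) (q j' (modify ⟨e, b⟩)) := by
        intro e b hnew hb j'
        have hwf : WellFounded ((· < ·) : ι → ι → Prop) := wellFounded_lt
        induction j' using hwf.induction with
        | _ j' ihj =>
          intro hj'
          have h1 := (hq j' e (modify ⟨e, b⟩) (fun j'' hj'' => ihj j'' hj'' (hj''.trans hj'))).1
          rw [← h1]
          by_cases hc : (q j' e).1 = (q j e).1
          · have hne : (q j' e).2 ≠ (q j e).2 := fun h => hnew j' hj' (Prod.ext hc h)
            simp only [answer, modify]
            rw [hc, Function.update_self, Perm.mul_apply, swap_apply_of_ne_of_ne]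
            · exact fun h => hne ((e (q j e).1).injective h)
            · rintro rfl
              apply hb
              simp only [used, mem_image, mem_filter, mem_univ, true_and]
              exact ⟨j', hj', rfl⟩
          · simp only [answer, modify]
            rw [Function.update_of_ne hc]
      calc #(hitEvent q T (insert j J)) * (Fintype.card α - Fintype.card ι)
          ≤ ∑ e ∈ hitEvent q T (insert j J), #(used e)ᶜ := by
            rw [← smul_eq_mul]
            exact Finset.card_nsmul_le_sum _ _ _ fun e _ => hused e
        _ = #((hitEvent q T (insert j J)).sigma fun e => (used e)ᶜ) := (Finset.card_sigma _ _).symm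
        _ ≤ #((hitEvent q T J).sigma fun e => T j e) := by
            apply Finset.card_le_card_of_injOn
              (fun x => (⟨modify x, answer x.1 (q j x.1)⟩ : Σ _ : (Bool → Perm α), α))
            · rintro ⟨e, b⟩ hx
              simp only [coe_sigma, Set.mem_sigma_iff, mem_coe, mem_compl] at hx ⊢
              obtain ⟨he, hb⟩ := hx
              simp only [hitEvent, mem_filter, mem_univ, true_and, mem_insert, forall_eq_or_imp] at he ⊢
              obtain ⟨⟨hnew, hT⟩, hJ⟩ := he
              have hm := hmod e b hnew hb
              have hqm : ∀ j' ≤ j, q j' e = q j' (modify ⟨e, b⟩) ∧ T j' e = T j' (modify ⟨e, b⟩) :=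
                fun j' hj' => hq j' _ _ (fun j'' hj'' => hm j'' (hj''.trans_le hj'))
              constructor
              · intro j' hj'
                have hlt := hmax j' hj'
                obtain ⟨h1, h2⟩ := hJ j' hj'
                constructor
                · intro j'' hj''
                  rw [← (hqm j' hlt.le).1, ← (hqm j'' (hj''.trans hlt).le).1]
                  exact h1 j'' hj''
                · rw [← hm j' hlt, ← (hqm j' hlt.le).2]
                  exact h2
              · rw [← (hqm j le_rfl).2]
                exact hT
            · rintro ⟨e, b⟩ hx ⟨e', b'⟩ hx' heq
              simp only [coe_sigma, Set.mem_sigma_iff, mem_coe, mem_compl] at hx hx'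
              obtain ⟨he, hb⟩ := hx
              obtain ⟨he', hb'⟩ := hx'
              simp only [hitEvent, mem_filter, mem_univ, true_and, mem_insert, forall_eq_or_imp] at he he'
              simp only [Sigma.mk.injEq, heq_eq_eq] at heq
              obtain ⟨h1, h2⟩ := heq
              have q1 : q j e = q j (modify ⟨e, b⟩) := (hq j _ _ (hmod e b he.1.1 hb)).1
              have q2 : q j e' = q j (modify ⟨e', b'⟩) := (hq j _ _ (hmod e' b' he'.1.1 hb')).1
              have q3 : q j e = q j e' := by rw [q1, q2, h1]
              have hb1 : ∀ e b, answer (modify ⟨e, b⟩) (q j e) = b := by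
                intro e b
                simp [answer, modify]
              have hbb : b = b' := by
                rw [← hb1 e b, ← hb1 e' b', h1, q3]
              subst hbb
              have : e = e' := by
                funext c
                have hc := congrFun h1 c
                simp only [modify] at hc
                rw [h2, q3] at hc
                by_cases hcq : c = (q j e').1
                · subst hcq
                  simpa using hc
                · rwa [Function.update_of_ne hcq, Function.update_of_ne hcq] at hc
              subst this
              rfl
        _ = ∑ e ∈ hitEvent q T J, #(T j e) := Finset.card_sigma _ _
        _ ≤ #(hitEvent q T J) * M := by
            rw [← smul_eq_mul]
            exact Finset.sum_le_card_nsmul _ _ _ fun e _ => hM j e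
    calc #(hitEvent q T (insert j J)) * ((Fintype.card α - Fintype.card ι) ^ #J *
          (Fintype.card α - Fintype.card ι))
        = (#(hitEvent q T (insert j J)) * (Fintype.card α - Fintype.card ι)) *
          (Fintype.card α - Fintype.card ι) ^ #J := by ring
      _ ≤ (#(hitEvent q T J) * M) * (Fintype.card α - Fintype.card ι) ^ #J :=
          Nat.mul_le_mul_right _ key
      _ = (#(hitEvent q T J) * (Fintype.card α - Fintype.card ι) ^ #J) * M := by ring
      _ ≤ (M ^ #J * Fintype.card (Bool → Perm α)) * M := Nat.mul_le_mul_right _ ih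
      _ = _ := by ring

end Exposure

section Paths
variable {α : Type*} [Fintype α] [DecidableEq α]

theorem card_lt_card_or_injective {k r : ℕ} (e : Bool → Perm α) (t : Fin k → α)
    (ht : Function.Injective t) (w : Bool → ℕ → Bool) (P : Fin k → Bool → ℕ → α)
    (hP0 : ∀ i c, P i c 0 = t i) (hPs : ∀ i c s, s < r → P i c (s + 1) = e (w c s) (P i c s))
    (hr : 0 < r) (hfirst : w false 0 ≠ w true 0) (hlast : w false (r - 1) ≠ w true (r - 1))
    (hclosed : ∀ i, P i false r = P i true r) :
    #(univ.image fun x : Fin k × Bool × Fin (r + 1) => P x.1 x.2.1 x.2.2) <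
      #(univ.image fun x : Fin k × Bool × Fin r => (w x.2.1 x.2.2, P x.1 x.2.1 x.2.2)) ∨
    Function.Injective fun x : Fin k × Bool × Fin r => (w x.2.1 x.2.2, P x.1 x.2.1 x.2.2) := by
  set V := univ.image fun x : Fin k × Bool × Fin (r + 1) => P x.1 x.2.1 x.2.2 with hV
  set Q := univ.image fun x : Fin k × Bool × Fin r => (w x.2.1 x.2.2, P x.1 x.2.1 x.2.2) with hQ
  rw [or_iff_not_imp_left, not_lt]
  intro hle
  have memQ : ∀ i c s, s < r → (w c s, P i c s) ∈ Q := by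
    intro i c s hs
    rw [hQ, Finset.mem_image]
    exact ⟨(i, c, ⟨s, hs⟩), mem_univ _, rfl⟩
  have memV : ∀ i c s, s ≤ r → P i c s ∈ V := by
    intro i c s hs
    rw [hV, Finset.mem_image]
    exact ⟨(i, c, ⟨s, by omega⟩), mem_univ _, rfl⟩
  let out : α → Finset (Bool × α) := fun v => Q.filter fun x => x.2 = v
  let inn : α → Finset (Bool × α) := fun v => Q.filter fun x => e x.1 x.2 = v
  have hout : #Q = ∑ v ∈ V, #(out v) := by
    apply Finset.card_eq_sum_card_fiberwise
    intro x hx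
    rw [hQ] at hx
    simp only [coe_image, coe_univ, Set.image_univ, Set.mem_range] at hx
    obtain ⟨⟨i, c, s⟩, rfl⟩ := hx
    exact memV i c s s.2.le
  have hinn : #Q = ∑ v ∈ V, #(inn v) := by
    apply Finset.card_eq_sum_card_fiberwise
    intro x hx
    rw [hQ] at hx
    simp only [coe_image, coe_univ, Set.image_univ, Set.mem_range] at hx
    obtain ⟨⟨i, c, s⟩, rfl⟩ := hx
    have := memV i c (s + 1) s.2
    rw [hPs i c s s.2] at this
    exact this
  have out_mem : ∀ i c s, s < r → (w c s, P i c s) ∈ out (P i c s) := by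
    intro i c s hs
    simp only [out, mem_filter]
    exact ⟨memQ i c s hs, trivial⟩
  have inn_mem : ∀ i c s, s < r → (w c s, P i c s) ∈ inn (P i c (s + 1)) := by
    intro i c s hs
    simp only [inn, mem_filter]
    exact ⟨memQ i c s hs, (hPs i c s hs).symm⟩
  have out_start : ∀ i, 2 ≤ #(out (t i)) := by
    intro i
    have h1 := out_mem i false 0 hr
    have h2 := out_mem i true 0 hr
    rw [hP0] at h1 h2
    exact Finset.one_lt_card.2 ⟨_, h1, _, h2, fun h => hfirst (congrArg Prod.fst h)⟩
  have inn_end : ∀ i c, 2 ≤ #(inn (P i c r)) := by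
    intro i c
    have hPc : P i c r = P i true r := by cases c; exacts [hclosed i, rfl]
    have h1 := inn_mem i false (r - 1) (by omega)
    have h2 := inn_mem i true (r - 1) (by omega)
    rw [Nat.sub_add_cancel hr] at h1 h2
    rw [hclosed] at h1
    rw [hPc]
    exact Finset.one_lt_card.2 ⟨_, h1, _, h2, fun h => hlast (congrArg Prod.fst h)⟩
  have hdeg : ∀ v ∈ V, 2 ≤ #(out v) + #(inn v) := by
    intro v hv
    rw [hV] at hv
    simp only [mem_image, mem_univ, true_and] at hv
    obtain ⟨⟨i, c, s, hs⟩, rfl⟩ := hv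
    simp only
    rcases Nat.eq_zero_or_pos s with rfl | hs0
    · rw [hP0]; have := out_start i; omega
    · rcases Nat.lt_or_ge s r with hsr | hsr
      · have h1 := Finset.card_pos.2 ⟨_, out_mem i c s hsr⟩
        have h2 := Finset.card_pos.2 ⟨_, inn_mem i c (s - 1) (by omega)⟩
        rw [Nat.sub_add_cancel hs0] at h2
        omega
      · obtain rfl : s = r := by omega
        have := inn_end i c
        omega
  have hdeg2 : ∀ v ∈ V, 2 = #(out v) + #(inn v) := by
    apply (Finset.sum_eq_sum_iff_of_le hdeg).1
    apply le_antisymm (Finset.sum_le_sum hdeg)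
    rw [Finset.sum_add_distrib, ← hout, ← hinn, Finset.sum_const, smul_eq_mul]
    omega
  have start_contra : ∀ i i' c' s', s' < r → t i = P i' c' (s' + 1) → False := by
    intro i i' c' s' hs' h
    have h1 := out_start i
    have h2 := Finset.card_pos.2 ⟨_, inn_mem i' c' s' hs'⟩
    rw [← h] at h2
    have h3 := hdeg2 (t i) (by rw [← hP0 i true]; exact memV i true 0 (by omega))
    omega
  have main : ∀ s, s < r → ∀ i c s' i' c', s' < r → (w c s, P i c s) = (w c' s', P i' c' s') →
      i = i' ∧ c = c' ∧ s = s' := by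
    intro s
    induction s with
    | zero =>
      intro _ i c s' i' c' hs' h
      rw [hP0] at h
      obtain ⟨h1, h2⟩ := Prod.ext_iff.1 h
      simp only at h1 h2
      cases s' with
      | zero =>
        rw [hP0] at h2
        refine ⟨ht h2, ?_, rfl⟩
        cases c <;> cases c' <;> simp_all
      | succ s' => exact (start_contra i i' c' s' (by omega) h2).elim
    | succ s ih =>
      intro hs i c s' i' c' hs' h
      obtain ⟨h1, h2⟩ := Prod.ext_iff.1 h
      simp only at h1 h2
      cases s' with
      | zero =>
        rw [hP0] at h2
        exact (start_contra i' i c s (by omega) h2.symm).elim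
      | succ s' =>
        have a1 := inn_mem i c s (by omega)
        have a2 := inn_mem i' c' s' (by omega)
        rw [← h2] at a2
        have h3 := hdeg2 _ (memV i c (s + 1) hs.le)
        have h4 := Finset.card_pos.2 ⟨_, out_mem i c (s + 1) hs⟩
        have h5 : #(inn (P i c (s + 1))) ≤ 1 := by omega
        have h6 := Finset.card_le_one.1 h5 _ a1 _ a2
        obtain ⟨r1, r2, r3⟩ := ih (by omega) i c s' i' c' (by omega) h6
        exact ⟨r1, r2, by omega⟩
  rintro ⟨i, c, s, hs⟩ ⟨i', c', s', hs'⟩ h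
  obtain ⟨rfl, rfl, rfl⟩ := main s hs i c s' i' c' hs' h
  rfl

theorem card_coincidences {ι : Type*} [Fintype ι] [LinearOrder ι] {β : Type*} [DecidableEq β]
    (q : ι → β) (ans : ι → α) (S V : Finset α) (hS : S ⊆ V) (hans : ∀ j, ans j ∈ V) :
    #(univ.image q) + #S ≤ #V + #(univ.filter fun j : ι => (∀ j' < j, q j' ≠ q j) ∧
      ans j ∈ S ∪ (univ.filter fun j' => j' < j).image ans) := by
  set New := univ.filter fun j : ι => ∀ j' < j, q j' ≠ q j with hNew
  have h1 : #(univ.image q) ≤ #New := by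
    have : univ.image q ⊆ New.image q := by
      intro x hx
      obtain ⟨j, _, rfl⟩ := Finset.mem_image.1 hx
      have hne : (univ.filter fun j' => q j' = q j).Nonempty := ⟨j, by simp⟩
      let m := (univ.filter fun j' => q j' = q j).min' hne
      have hm := Finset.min'_mem _ hne
      simp only [mem_filter, mem_univ, true_and] at hm
      rw [Finset.mem_image]
      refine ⟨m, ?_, hm⟩
      simp only [hNew, mem_filter, mem_univ, true_and]
      intro j' hj' he
      have : m ≤ j' := Finset.min'_le _ _ (by simp only [mem_filter, mem_univ, true_and]; rw [he]; exact hm)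
      exact absurd hj' (not_lt.2 this)
    exact (Finset.card_le_card this).trans Finset.card_image_le
  have h2 := Finset.card_filter_add_card_filter_not (s := New) (fun j =>
    ans j ∈ S ∪ (univ.filter fun j' => j' < j).image ans)
  have h3 : #(New.filter fun j => ¬ ans j ∈ S ∪ (univ.filter fun j' => j' < j).image ans) ≤ #(V \ S) := by
    apply Finset.card_le_card_of_injOn ans
    · intro j hj
      simp only [coe_filter, Set.mem_ofPred_eq, mem_union, not_or] at hj
      simp only [coe_sdiff, Set.mem_sdiff, mem_coe]
      exact ⟨hans j, hj.2.1⟩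
    · intro j hj j' hj' he
      simp only [coe_filter, Set.mem_ofPred_eq, mem_union, not_or, mem_image, mem_filter, mem_univ,
        true_and, not_exists, not_and] at hj hj'
      rcases lt_trichotomy j j' with h | h | h
      · exact absurd he (hj'.2.2 j h)
      · exact h
      · exact absurd he.symm (hj.2.2 j' h)
  rw [Finset.card_sdiff_of_subset hS] at h3
  have h4 := Finset.card_le_card hS
  have h5 : (univ.filter fun j : ι => (∀ j' < j, q j' ≠ q j) ∧
      ans j ∈ S ∪ (univ.filter fun j' => j' < j).image ans) =
      New.filter fun j => ans j ∈ S ∪ (univ.filter fun j' => j' < j).image ans := by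
    rw [hNew, Finset.filter_filter]
  rw [h5]
  omega

end Paths

section Words
variable {α : Type*} [Fintype α] [DecidableEq α]

/-- The value of a positive word in two permutations; the first letter is applied first. -/
def evalW (e : Bool → Perm α) : List Bool → Perm α
  | [] => 1
  | b :: l => evalW e l * e b

theorem evalW_append (e : Bool → Perm α) (l l' : List Bool) :
    evalW e (l ++ l') = evalW e l' * evalW e l := by
  induction l with
  | nil => simp [evalW]
  | cons b l ih => simp [evalW, ih, mul_assoc]

theorem evalW_take_succ (e : Bool → Perm α) (l : List Bool) {s : ℕ} (hs : s < l.length) (a : α) :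
    evalW e (l.take (s + 1)) a = e (l.getD s false) (evalW e (l.take s) a) := by
  rw [List.take_succ_eq_append_getElem hs, evalW_append]
  simp [evalW, hs]

theorem card_closed_mul_le {k r : ℕ} {ι : Type*} [Fintype ι] [LinearOrder ι]
    (idx : Fin k × Bool × Fin r ≃ ι)
    (hidx1 : ∀ i c s s', s < s' → idx (i, c, s) < idx (i, c, s'))
    (hidx2 : ∀ i s s', idx (i, false, s) < idx (i, true, s'))
    (L : Bool → List Bool) (hL : ∀ c, (L c).length = r) (hr : 0 < r)
    (hfirst : (L false).getD 0 false ≠ (L true).getD 0 false)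
    (hlast : (L false).getD (r - 1) false ≠ (L true).getD (r - 1) false)
    (t : Fin k → α) (ht : Function.Injective t) :
    #(univ.filter fun e : Bool → Perm α => ∀ i, evalW e (L false) (t i) = evalW e (L true) (t i)) *
        (Fintype.card α - Fintype.card ι) ^ (k + 1) ≤
      (Fintype.card ι ^ (k + 1) * (k + Fintype.card ι) ^ (k + 1) +
        (Fintype.card α - Fintype.card ι)) * Fintype.card (Bool → Perm α) := by
  set N := Fintype.card α - Fintype.card ι with hN
  let w : Bool → ℕ → Bool := fun c s => (L c).getD s false
  let P : (Bool → Perm α) → Fin k → Bool → ℕ → α := fun e i c s => evalW e ((L c).take s) (t i)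
  have hP0 : ∀ e i c, P e i c 0 = t i := by intro e i c; simp [P, evalW]
  have hPs : ∀ e i c s, s < r → P e i c (s + 1) = e (w c s) (P e i c s) := by
    intro e i c s hs
    exact evalW_take_succ e (L c) (by rw [hL]; exact hs) (t i)
  have hPr : ∀ e i c, P e i c r = evalW e (L c) (t i) := by
    intro e i c
    simp only [P]
    rw [List.take_of_length_le (hL c).le]
  let qq : (Bool → Perm α) → Fin k × Bool × Fin r → Bool × α := fun e x =>
    (w x.2.1 x.2.2, P e x.1 x.2.1 x.2.2)
  let q : ι → (Bool → Perm α) → Bool × α := fun j e => qq e (idx.symm j)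
  have hans : ∀ e i c s (hs : s < r), answer e (q (idx (i, c, ⟨s, hs⟩)) e) = P e i c (s + 1) := by
    intro e i c s hs
    simp only [q, qq, Equiv.symm_apply_apply, answer]
    rw [hPs e i c s hs]
  let ans : (Bool → Perm α) → ι → α := fun e j => answer e (q j e)
  let S : Finset α := univ.image t
  have hScard : #S = k := by
    rw [Finset.card_image_of_injective _ ht]; simp
  let T1 : ι → (Bool → Perm α) → Finset α := fun j e =>
    S ∪ (univ.filter fun j' => j' < j).image (ans e)
  let T2 : ι → (Bool → Perm α) → Finset α := fun j e =>
    if (idx.symm j).2.1 = true then {P e (idx.symm j).1 false r} else ∅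
  have hq : ∀ j e e', (∀ j' < j, answer e (q j' e) = answer e' (q j' e')) → q j e = q j e' := by
    intro j e e' h
    obtain ⟨⟨i, c, s, hs⟩, rfl⟩ := idx.surjective j
    simp only [q, qq, Equiv.symm_apply_apply]
    congr 1
    cases s with
    | zero => rw [hP0, hP0]
    | succ s =>
      have := h (idx (i, c, ⟨s, by omega⟩)) (hidx1 _ _ _ _ (by simp))
      rwa [hans, hans] at this
  have hq1 : ∀ j e e', (∀ j' < j, answer e (q j' e) = answer e' (q j' e')) →
      q j e = q j e' ∧ T1 j e = T1 j e' := by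
    intro j e e' h
    refine ⟨hq j e e' h, ?_⟩
    simp only [T1]
    congr 1
    apply Finset.image_congr
    intro j' hj'
    simp only [coe_filter, mem_univ, true_and, Set.mem_ofPred_eq] at hj'
    exact h j' hj'
  have hq2 : ∀ j e e', (∀ j' < j, answer e (q j' e) = answer e' (q j' e')) →
      q j e = q j e' ∧ T2 j e = T2 j e' := by
    intro j e e' h
    refine ⟨hq j e e' h, ?_⟩
    obtain ⟨⟨i, c, s⟩, rfl⟩ := idx.surjective j
    simp only [T2, Equiv.symm_apply_apply]
    split_ifs with hc
    · subst hc
      have := h (idx (i, false, ⟨r - 1, by omega⟩)) (hidx2 _ _ _)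
      rw [hans, hans, Nat.sub_add_cancel hr] at this
      rw [this]
    · rfl
  have hM1 : ∀ j e, #(T1 j e) ≤ k + Fintype.card ι := by
    intro j e
    refine (Finset.card_union_le _ _).trans ?_
    rw [hScard]
    gcongr
    exact Finset.card_image_le.trans (Finset.card_le_univ _)
  have hM2 : ∀ j e, #(T2 j e) ≤ 1 := by
    intro j e
    simp only [T2]
    split_ifs <;> simp
  let J2 : Finset ι := univ.image fun i : Fin k => idx (i, true, ⟨r - 1, by omega⟩)
  have hJ2 : #J2 = k := by
    rw [Finset.card_image_of_injective]
    · simp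
    · intro i i' h
      have := idx.injective h
      simpa using this
  have hcover : (univ.filter fun e : Bool → Perm α =>
      ∀ i, evalW e (L false) (t i) = evalW e (L true) (t i)) ⊆
      ((powersetCard (k + 1) (univ : Finset ι)).biUnion fun J => hitEvent q T1 J) ∪
        hitEvent q T2 J2 := by
    intro e he
    simp only [mem_filter, mem_univ, true_and] at he
    have hcl : ∀ i, P e i false r = P e i true r := by
      intro i; rw [hPr, hPr]; exact he i
    rw [Finset.mem_union]
    rcases card_lt_card_or_injective e t ht w (P e) (hP0 e) (hPs e) hr hfirst hlast hcl with h | h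
    · left
      set V := univ.image fun x : Fin k × Bool × Fin (r + 1) => P e x.1 x.2.1 x.2.2 with hV
      have memV : ∀ i c s, s ≤ r → P e i c s ∈ V := by
        intro i c s hs
        rw [hV, Finset.mem_image]
        exact ⟨(i, c, ⟨s, by omega⟩), mem_univ _, rfl⟩
      have hc := card_coincidences (fun j => q j e) (ans e) S V (by
        intro x hx
        obtain ⟨i, _, rfl⟩ := Finset.mem_image.1 hx
        rw [← hP0 e i true]
        exact memV i true 0 (by omega)) (by
        intro j
        obtain ⟨⟨i, c, s, hs⟩, rfl⟩ := idx.surjective j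
        simp only [ans]
        rw [hans]
        exact memV _ _ _ hs)
      have himg : (univ.image fun j => q j e) = univ.image (qq e) := by
        ext x
        simp only [mem_image, mem_univ, true_and, q]
        constructor
        · rintro ⟨j, hj⟩; exact ⟨_, hj⟩
        · rintro ⟨y, hy⟩; exact ⟨idx y, by simpa using hy⟩
      rw [himg, hScard] at hc
      have h' : #V < #(univ.image (qq e)) := h
      obtain ⟨J, hJ, hJc⟩ := Finset.exists_subset_card_eq (n := k + 1) (s := (univ.filter fun j : ι =>
        (∀ j' < j, q j' e ≠ q j e) ∧ ans e j ∈ S ∪ (univ.filter fun j' => j' < j).image (ans e)))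
        (by omega)
      rw [Finset.mem_biUnion]
      refine ⟨J, by simp [Finset.mem_powersetCard, hJc], ?_⟩
      simp only [hitEvent, mem_filter, mem_univ, true_and]
      intro j hj
      have := hJ hj
      rw [Finset.mem_filter] at this
      exact this.2
    · right
      simp only [hitEvent, mem_filter, mem_univ, true_and]
      intro j hj
      obtain ⟨i, _, rfl⟩ := Finset.mem_image.1 hj
      constructor
      · intro j' hj' hne
        have h1 := h hne
        rw [Equiv.symm_apply_apply] at h1
        rw [← h1, Equiv.apply_symm_apply] at hj'
        exact lt_irrefl _ hj'
      · rw [hans, Nat.sub_add_cancel hr]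
        simp [T2, hcl]
  have hcard := Finset.card_le_card hcover
  have hb : #((powersetCard (k + 1) (univ : Finset ι)).biUnion fun J => hitEvent q T1 J) * N ^ (k + 1) ≤
      Fintype.card ι ^ (k + 1) * (k + Fintype.card ι) ^ (k + 1) * Fintype.card (Bool → Perm α) := by
    calc _ ≤ (∑ J ∈ powersetCard (k + 1) (univ : Finset ι), #(hitEvent q T1 J)) * N ^ (k + 1) :=
          Nat.mul_le_mul_right _ Finset.card_biUnion_le
      _ = ∑ J ∈ powersetCard (k + 1) (univ : Finset ι), #(hitEvent q T1 J) * N ^ (k + 1) :=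
          Finset.sum_mul _ _ _
      _ ≤ ∑ J ∈ powersetCard (k + 1) (univ : Finset ι),
          (k + Fintype.card ι) ^ (k + 1) * Fintype.card (Bool → Perm α) := by
          apply Finset.sum_le_sum
          intro J hJ
          rw [Finset.mem_powersetCard] at hJ
          have := card_hitEvent_le q T1 _ hq1 hM1 J
          rwa [hJ.2] at this
      _ ≤ _ := by
          rw [Finset.sum_const, Finset.card_powersetCard, smul_eq_mul, mul_assoc, Finset.card_univ]
          exact Nat.mul_le_mul_right _ (Nat.choose_le_pow _ _)
  have hb2 : #(hitEvent q T2 J2) * N ^ (k + 1) ≤ N * Fintype.card (Bool → Perm α) := by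
    have := card_hitEvent_le q T2 _ hq2 hM2 J2
    rw [hJ2, one_pow, one_mul] at this
    rw [pow_succ, ← mul_assoc, mul_comm N]
    exact Nat.mul_le_mul_right _ this
  calc _ ≤ (#((powersetCard (k + 1) (univ : Finset ι)).biUnion fun J => hitEvent q T1 J) +
        #(hitEvent q T2 J2)) * N ^ (k + 1) :=
        Nat.mul_le_mul_right _ (hcard.trans (Finset.card_union_le _ _))
    _ ≤ _ := by
        rw [add_mul, add_mul]
        exact Nat.add_le_add hb hb2

end Words

section Lists

theorem exists_prefix_of_ne {w w' : List Bool} (hl : w.length = w'.length) (hne : w ≠ w') :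
    ∃ p a x b y, w = p ++ a :: x ∧ w' = p ++ b :: y ∧ a ≠ b ∧ x.length = y.length := by
  induction w generalizing w' with
  | nil => exact absurd (List.length_eq_zero_iff.1 hl.symm).symm hne
  | cons a x ih =>
    cases w' with
    | nil => simp at hl
    | cons b y =>
      have hl' : x.length = y.length := by simpa using hl
      by_cases hab : a = b
      · subst hab
        obtain ⟨p, a', x', b', y', rfl, rfl, h, h'⟩ := ih hl' (fun h => hne (by rw [h]))
        exact ⟨a :: p, a', x', b', y', rfl, rfl, h, h'⟩
      · exact ⟨[], a, x, b, y, rfl, rfl, hab, hl'⟩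

theorem exists_core_of_ne {w w' : List Bool} (hl : w.length = w'.length) (hne : w ≠ w') :
    ∃ p s : List Bool, ∃ c : Bool → List Bool, ∃ r, w = p ++ c false ++ s ∧ w' = p ++ c true ++ s ∧
      (∀ b, (c b).length = r) ∧ 0 < r ∧ (c false).getD 0 false ≠ (c true).getD 0 false ∧
      (c false).getD (r - 1) false ≠ (c true).getD (r - 1) false := by
  obtain ⟨p, a, x, b, y, rfl, rfl, hab, hxy⟩ := exists_prefix_of_ne hl hne
  have hne' : (a :: x).reverse ≠ (b :: y).reverse := by
    intro h
    have := List.reverse_injective h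
    simp only [List.cons.injEq] at this
    exact hab this.1
  obtain ⟨q, a', x', b', y', hx, hy, hab', hxy'⟩ := exists_prefix_of_ne (by simpa using hxy) hne'
  have hx2 : a :: x = x'.reverse ++ [a'] ++ q.reverse := by
    rw [← List.reverse_reverse (a :: x), hx]; simp
  have hy2 : b :: y = y'.reverse ++ [b'] ++ q.reverse := by
    rw [← List.reverse_reverse (b :: y), hy]; simp
  refine ⟨p, q.reverse, fun c => if c then y'.reverse ++ [b'] else x'.reverse ++ [a'],
    x'.length + 1, ?_, ?_, ?_, by omega, ?_, ?_⟩
  · rw [hx2]; simp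
  · rw [hy2]; simp
  · intro c; cases c <;> simp [hxy']
  · have h1 : (x'.reverse ++ [a']).getD 0 false = a := by
      have : (x'.reverse ++ [a'] ++ q.reverse).getD 0 false = a := by rw [← hx2]; simp
      rwa [List.getD_append _ _ _ _ (by simp)] at this
    have h2 : (y'.reverse ++ [b']).getD 0 false = b := by
      have : (y'.reverse ++ [b'] ++ q.reverse).getD 0 false = b := by rw [← hy2]; simp
      rwa [List.getD_append _ _ _ _ (by simp)] at this
    simp only [if_true, Bool.false_eq_true, if_false]
    rwa [h1, h2]
  · simp only [if_true, Bool.false_eq_true, if_false, Nat.add_sub_cancel]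
    rw [List.getD_append_right _ _ _ _ (by simp), List.getD_append_right _ _ _ _ (by simp [hxy'])]
    simpa [hxy'] using hab'

end Lists

section Agree
variable {α : Type*} [Fintype α] [DecidableEq α]

/-- The number of points at which two permutations agree. -/
def agree (u u' : Perm α) : ℕ := #(univ.filter fun a => u a = u' a)

theorem agree_mul_left (g u u' : Perm α) : agree (g * u) (g * u') = agree u u' := by
  simp [agree]

theorem agree_mul_right (g u u' : Perm α) : agree (u * g) (u' * g) = agree u u' := by
  refine Finset.card_bij (fun a _ => g a) ?_ (by simp) ?_
  · intro a ha
    simpa [Finset.mem_filter] using (Finset.mem_filter.1 ha).2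
  · intro b hb
    exact ⟨g⁻¹ b, Finset.mem_filter.2 ⟨mem_univ _, by simpa using (Finset.mem_filter.1 hb).2⟩,
      by simp⟩

theorem card_embedding_agree (u u' : Perm α) (k : ℕ) :
    #(univ.filter fun t : Fin k ↪ α => ∀ i, u (t i) = u' (t i)) = (agree u u').descFactorial k := by
  have h1 : Fintype.card (Fin k ↪ {a // u a = u' a}) = (agree u u').descFactorial k := by
    rw [Fintype.card_embedding_eq, Fintype.card_fin, Fintype.card_subtype]; rfl
  rw [← h1, ← Fintype.card_subtype]
  refine Fintype.card_congr
    { toFun := fun t => ⟨fun i => ⟨t.1 i, t.2 i⟩, fun i j h => t.1.injective (by simpa using h)⟩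
      invFun := fun t => ⟨⟨fun i => (t i).1, fun i j h => t.injective (Subtype.ext h)⟩,
        fun i => (t i).2⟩
      left_inv := fun t => by ext; rfl
      right_inv := fun t => by ext; rfl }

theorem card_closed_mul_le_of_le {k r R : ℕ} (hkr : 2 * k * r ≤ R) (hkR : k ≤ R)
    (L : Bool → List Bool) (hL : ∀ c, (L c).length = r) (hr : 0 < r)
    (hfirst : (L false).getD 0 false ≠ (L true).getD 0 false)
    (hlast : (L false).getD (r - 1) false ≠ (L true).getD (r - 1) false)
    (t : Fin k → α) (ht : Function.Injective t) :
    #(univ.filter fun e : Bool → Perm α => ∀ i, evalW e (L false) (t i) = evalW e (L true) (t i)) *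
        (Fintype.card α - R) ^ (k + 1) ≤
      (R ^ (k + 1) * (2 * R) ^ (k + 1) + (Fintype.card α - R)) * Fintype.card (Bool → Perm α) := by
  have hmain := card_closed_mul_le (ι := Fin k ×ₗ (Bool ×ₗ Fin r))
    (((Equiv.refl (Fin k)).prodCongr (toLex : Bool × Fin r ≃ Bool ×ₗ Fin r)).trans toLex)
    (by intro i c s s' h; simp [Prod.Lex.toLex_lt_toLex, h])
    (by intro i s s'; simp [Prod.Lex.toLex_lt_toLex]) L hL hr hfirst hlast t ht
  have hcard : Fintype.card (Fin k ×ₗ (Bool ×ₗ Fin r)) = 2 * k * r := by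
    simp [Fintype.card_lex, Fintype.card_prod]; ring
  rw [hcard] at hmain
  set M := #(univ.filter fun e : Bool → Perm α =>
    ∀ i, evalW e (L false) (t i) = evalW e (L true) (t i))
  set E := Fintype.card (Bool → Perm α)
  rcases Nat.eq_zero_or_pos (Fintype.card α - R) with h0 | hpos
  · rw [h0]; simp
  set N' := Fintype.card α - R with hN'
  set N := Fintype.card α - 2 * k * r with hN
  have hNN : N' ≤ N := by omega
  have hNpos : 0 < N ^ (k + 1) := pow_pos (by omega) _
  refine Nat.le_of_mul_le_mul_right ?_ hNpos
  calc M * N' ^ (k + 1) * N ^ (k + 1) = (M * N ^ (k + 1)) * N' ^ (k + 1) := by ring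
    _ ≤ (((2 * k * r) ^ (k + 1) * (k + 2 * k * r) ^ (k + 1) + N) * E) * N' ^ (k + 1) := by gcongr
    _ ≤ ((R ^ (k + 1) * (2 * R) ^ (k + 1) + N) * E) * N' ^ (k + 1) := by
        gcongr; omega
    _ = R ^ (k + 1) * (2 * R) ^ (k + 1) * E * N' ^ (k + 1) + N * N' * E * N' ^ k := by ring
    _ ≤ R ^ (k + 1) * (2 * R) ^ (k + 1) * E * N ^ (k + 1) + N * N' * E * N ^ k := by gcongr
    _ = _ := by ring

theorem sum_agree_le {k ℓ R : ℕ} (hkr : 2 * k * ℓ ≤ R) (hkR : k ≤ R) {w w' : List Bool}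
    (hw : w.length = ℓ) (hw' : w'.length = ℓ) (hne : w ≠ w') :
    (∑ e : Bool → Perm α, (agree (evalW e w) (evalW e w')).descFactorial k) *
        (Fintype.card α - R) ^ (k + 1) ≤
      Fintype.card α ^ k * (R ^ (k + 1) * (2 * R) ^ (k + 1) + (Fintype.card α - R)) *
        Fintype.card (Bool → Perm α) := by
  obtain ⟨p, s, c, r, rfl, rfl, hc, hr, hfirst, hlast⟩ := exists_core_of_ne (hw.trans hw'.symm) hne
  have hrl : r ≤ ℓ := by
    have := hc false
    simp only [List.length_append] at hw
    omega
  have hagree : ∀ e : Bool → Perm α, agree (evalW e (p ++ c false ++ s)) (evalW e (p ++ c true ++ s))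
      = agree (evalW e (c false)) (evalW e (c true)) := by
    intro e
    simp only [evalW_append]
    rw [agree_mul_left, agree_mul_right]
  simp only [hagree, ← card_embedding_agree]
  have hswap : ∑ e : Bool → Perm α, #(univ.filter fun t : Fin k ↪ α =>
      ∀ i, evalW e (c false) (t i) = evalW e (c true) (t i)) =
      ∑ t : Fin k ↪ α, #(univ.filter fun e : Bool → Perm α =>
        ∀ i, evalW e (c false) (t i) = evalW e (c true) (t i)) := by
    simp only [Finset.card_filter]
    exact Finset.sum_comm
  rw [hswap, Finset.sum_mul]
  calc _ ≤ ∑ t : Fin k ↪ α, (R ^ (k + 1) * (2 * R) ^ (k + 1) + (Fintype.card α - R)) *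
        Fintype.card (Bool → Perm α) := by
        apply Finset.sum_le_sum
        intro t _
        refine card_closed_mul_le_of_le (le_trans ?_ hkr) hkR c hc hr hfirst hlast t t.injective
        gcongr
    _ ≤ _ := by
        rw [Finset.sum_const, smul_eq_mul, Finset.card_univ, Fintype.card_embedding_eq,
          Fintype.card_fin, mul_assoc]
        gcongr
        exact Nat.descFactorial_le_pow _ _

end Agree

section Glue
variable {α : Type*} [Fintype α] [DecidableEq α] {k : ℕ}

/-- The permutation acting as `σ` on the points `t i` and as `h` on the other points. -/
noncomputable def glue (t : Fin k ↪ α) (σ : Perm (Fin k)) (h : Perm {a // ¬ a ∈ Set.range t}) : Perm α :=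
  Perm.subtypeCongr (p := fun a => a ∈ Set.range t)
    ((Equiv.ofInjective t t.injective).permCongr σ) h

theorem glue_apply (t : Fin k ↪ α) (σ : Perm (Fin k)) (h : Perm {a // ¬ a ∈ Set.range t}) (i : Fin k) :
    glue t σ h (t i) = t (σ i) := by
  rw [glue, Perm.subtypeCongr.left_apply _ _ (Set.mem_range_self i), Equiv.permCongr_apply]
  simp

theorem glue_apply_of_notMem (t : Fin k ↪ α) (σ : Perm (Fin k)) (h : Perm {a // ¬ a ∈ Set.range t})
    (a : {a // ¬ a ∈ Set.range t}) : glue t σ h a = h a := by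
  rw [glue, Perm.subtypeCongr.right_apply_subtype]

theorem perm_ext_of_embedding (t : Fin k ↪ α) {g g' : Perm α} (h1 : ∀ i, g (t i) = g' (t i))
    (h2 : ∀ a : {a // ¬ a ∈ Set.range t}, g a = g' a) : g = g' := by
  ext a
  by_cases ha : a ∈ Set.range t
  · obtain ⟨i, rfl⟩ := ha; exact h1 i
  · exact h2 ⟨a, ha⟩

theorem glue_mul (t : Fin k ↪ α) (σ σ' : Perm (Fin k)) (h h' : Perm {a // ¬ a ∈ Set.range t}) :
    glue t (σ * σ') (h * h') = glue t σ h * glue t σ' h' := by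
  apply perm_ext_of_embedding t
  · intro i; simp [glue_apply]
  · intro a; simp [glue_apply_of_notMem]

theorem glue_one (t : Fin k ↪ α) : glue t 1 1 = 1 := by
  apply perm_ext_of_embedding t
  · intro i; simp [glue_apply]
  · intro a; simp [glue_apply_of_notMem]

theorem glue_pow (t : Fin k ↪ α) (σ : Perm (Fin k)) (h : Perm {a // ¬ a ∈ Set.range t}) (j : ℕ) :
    glue t σ h ^ j = glue t (σ ^ j) (h ^ j) := by
  induction j with
  | zero => simp [glue_one]
  | succ j ih => rw [pow_succ, ih, ← glue_mul, ← pow_succ, ← pow_succ]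

theorem glue_injective (t : Fin k ↪ α) (σ : Perm (Fin k)) : Function.Injective (glue t σ) := by
  intro h h' heq
  ext a
  rw [← glue_apply_of_notMem t σ h, ← glue_apply_of_notMem t σ h', heq]

theorem sign_glue (t : Fin k ↪ α) (σ : Perm (Fin k)) (h : Perm {a // ¬ a ∈ Set.range t}) :
    Perm.sign (glue t σ h) = Perm.sign σ * Perm.sign h := by
  rw [glue, Perm.sign_subtypeCongr]
  congr 1
  convert Perm.sign_permCongr (Equiv.ofInjective t t.injective) σ

theorem card_notMem_range (t : Fin k ↪ α) :
    Fintype.card {a // ¬ a ∈ Set.range t} = Fintype.card α - k := by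
  rw [Fintype.card_subtype_compl]
  congr 1
  convert (Fintype.card_congr (Equiv.ofInjective t t.injective)).symm
  rw [Fintype.card_fin]

/-- The permutations that act as `σ` on the points `t i` and as a single cycle on the rest. -/
noncomputable def glueClass (t : Fin k ↪ α) (σ : Perm (Fin k)) : Finset (Perm α) :=
  (univ.filter fun h : Perm {a // ¬ a ∈ Set.range t} => IsFull h).image (glue t σ)

theorem mem_glueClass {t : Fin k ↪ α} {σ : Perm (Fin k)} {g : Perm α} :
    g ∈ glueClass t σ ↔ ∃ h, IsFull h ∧ glue t σ h = g := by
  simp [glueClass]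

theorem nonempty_notMem_range (hk : k < Fintype.card α) (t : Fin k ↪ α) :
    Nonempty {a // ¬ a ∈ Set.range t} := by
  rw [← Fintype.card_pos_iff, card_notMem_range]
  omega

theorem card_glueClass (hk : k < Fintype.card α) (t : Fin k ↪ α) (σ : Perm (Fin k)) :
    #(glueClass t σ) = (Fintype.card α - k - 1).factorial := by
  have := nonempty_notMem_range hk t
  rw [glueClass, Finset.card_image_of_injective _ (glue_injective t σ), card_isFull,
    card_notMem_range]

theorem sign_of_mem_glueClass (hk : k < Fintype.card α) {t : Fin k ↪ α} {σ : Perm (Fin k)}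
    {g : Perm α} (hg : g ∈ glueClass t σ) :
    Perm.sign g = Perm.sign σ * (-1) ^ (Fintype.card α - k - 1) := by
  have := nonempty_notMem_range hk t
  obtain ⟨h, hf, rfl⟩ := mem_glueClass.1 hg
  rw [sign_glue, hf.sign, card_notMem_range]

theorem pow_of_mem_glueClass {t : Fin k ↪ α} {σ : Perm (Fin k)} {g : Perm α} {j r : ℕ}
    (hg : g ∈ glueClass t σ) (hj : Fintype.card α - k ∣ j) (hσ : σ ^ r = 1) (hr : j % r = 1 % r) :
    g ^ j = glue t σ 1 := by
  obtain ⟨h, hf, rfl⟩ := mem_glueClass.1 hg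
  rw [glue_pow]
  have h1 : h ^ j = 1 := by
    obtain ⟨c, rfl⟩ := hj
    rw [← card_notMem_range t, pow_mul, hf.pow_card, one_pow]
  have h2 : σ ^ j = σ := by
    rw [pow_eq_pow_mod j hσ, hr, ← pow_eq_pow_mod 1 hσ, pow_one]
  rw [h1, h2]

/-- Pairs of elements of the class differing by `v` on the right. -/
theorem card_glueClass_mul (t : Fin k ↪ α) (σ : Perm (Fin k)) (v : Perm α) :
    (∃ g ∈ glueClass t σ, g * v ∈ glueClass t σ) →
    ∃ v' : Perm {a // ¬ a ∈ Set.range t}, glue t 1 v' = v ∧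
      #(univ.filter fun g => g ∈ glueClass t σ ∧ g * v ∈ glueClass t σ) ≤ fullPairs v' := by
  have key : ∀ h h' : Perm {a // ¬ a ∈ Set.range t}, glue t σ h * v = glue t σ h' →
      glue t 1 (h⁻¹ * h') = v := by
    intro h h' hh
    apply mul_left_cancel (a := glue t σ h)
    rw [hh, ← glue_mul]; simp
  rintro ⟨g, hg, hgv⟩
  obtain ⟨h0, hf0, rfl⟩ := mem_glueClass.1 hg
  obtain ⟨h0', hf0', heq0⟩ := mem_glueClass.1 hgv
  refine ⟨h0⁻¹ * h0', key _ _ heq0.symm, ?_⟩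
  rw [fullPairs]
  set v' := h0⁻¹ * h0' with hv'
  refine (Finset.card_le_card (t := (univ.filter fun h => IsFull h ∧ IsFull (h * v')).image
    (glue t σ)) ?_).trans Finset.card_image_le
  intro g hg
  obtain ⟨-, hg1, hg2⟩ := Finset.mem_filter.1 hg
  obtain ⟨h, hf, rfl⟩ := mem_glueClass.1 hg1
  obtain ⟨h', hf', heq⟩ := mem_glueClass.1 hg2
  refine Finset.mem_image_of_mem _ (Finset.mem_filter.2 ⟨mem_univ _, hf, ?_⟩)
  have h3 : h⁻¹ * h' = v' := by
    apply glue_injective t 1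
    rw [key _ _ heq.symm, key _ _ heq0.symm]
  rw [← h3]
  simpa using hf'

theorem card_support_glue_one (t : Fin k ↪ α) (v : Perm {a // ¬ a ∈ Set.range t}) :
    #(glue t 1 v).support = #v.support := by
  symm
  refine Finset.card_bij (fun a _ => a.1) ?_ ?_ ?_
  · intro a ha
    rw [Perm.mem_support] at ha ⊢
    rw [glue_apply_of_notMem]
    exact fun h => ha (Subtype.ext h)
  · intro a _ b _ h; exact Subtype.ext h
  · intro a ha
    rw [Perm.mem_support] at ha
    have hat : ¬ a ∈ Set.range t := by
      rintro ⟨i, rfl⟩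
      exact ha (by rw [glue_apply]; simp)
    refine ⟨⟨a, hat⟩, ?_, rfl⟩
    rw [Perm.mem_support]
    intro h
    apply ha
    have := glue_apply_of_notMem t 1 v ⟨a, hat⟩
    rw [h] at this
    exact this

theorem fullPairs_le_factorial [Nonempty α] (v : Perm α) :
    fullPairs v ≤ (Fintype.card α - 1).factorial := by
  rw [← card_isFull, fullPairs]
  exact Finset.card_le_card (Finset.monotone_filter_right _ fun h _ hh => hh.1)

end Glue

section SecondMoment
variable {α : Type*} [Fintype α] [DecidableEq α] {k : ℕ}

theorem two_mul_card_sign [Nontrivial α] (s : ℤˣ) :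
    2 * #(univ.filter fun z : Perm α => Perm.sign z = s) = (Fintype.card α).factorial := by
  obtain ⟨a, b, hab⟩ := exists_pair_ne α
  have h1 : #(univ.filter fun z : Perm α => Perm.sign z = s) =
      #(univ.filter fun z : Perm α => ¬ Perm.sign z = s) := by
    refine Finset.card_bij (fun z _ => swap a b * z) ?_ (by simp) ?_
    · intro z hz
      have hz' : Perm.sign z = s := by simpa using hz
      simp only [mem_filter, mem_univ, true_and, Perm.sign_mul, Perm.sign_swap hab, hz']
      rcases Int.units_eq_one_or s with rfl | rfl <;> decide
    · intro z hz
      have hz' : ¬ Perm.sign z = s := by simpa using hz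
      refine ⟨swap a b * z, ?_, by simp⟩
      simp only [mem_filter, mem_univ, true_and, Perm.sign_mul, Perm.sign_swap hab]
      rcases Int.units_eq_one_or s with rfl | rfl <;>
        rcases Int.units_eq_one_or (Perm.sign z) with h | h <;> simp_all
  have h2 := Finset.card_filter_add_card_filter_not (s := (univ : Finset (Perm α)))
    (fun z => Perm.sign z = s)
  rw [Finset.card_univ, Fintype.card_perm] at h2
  omega

theorem card_zero_le {ι : Type*} (Z : Finset ι) (N : ι → ℝ) (hS : 0 < ∑ z ∈ Z, N z) :
    (#(Z.filter fun z => N z = 0) : ℝ) ≤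
      (#Z : ℝ) ^ 2 * (∑ z ∈ Z, N z ^ 2) / (∑ z ∈ Z, N z) ^ 2 - #Z := by
  set S := ∑ z ∈ Z, N z with hSd
  have hZ : (0 : ℝ) < #Z := by
    rw [Nat.cast_pos, Finset.card_pos]
    by_contra h
    rw [Finset.not_nonempty_iff_eq_empty] at h
    rw [hSd, h] at hS
    simp at hS
  have h1 : (#(Z.filter fun z => N z = 0) : ℝ) * S ^ 2 ≤ ∑ z ∈ Z, (#Z * N z - S) ^ 2 := by
    calc (#(Z.filter fun z => N z = 0) : ℝ) * S ^ 2
        = ∑ z ∈ Z.filter (fun z => N z = 0), (#Z * N z - S) ^ 2 := by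
          rw [← nsmul_eq_mul, ← Finset.sum_const]
          apply Finset.sum_congr rfl
          intro z hz
          rw [(Finset.mem_filter.1 hz).2]; ring
      _ ≤ _ := Finset.sum_le_sum_of_subset_of_nonneg (Finset.filter_subset _ _)
          fun _ _ _ => sq_nonneg _
  have h2 : ∑ z ∈ Z, (#Z * N z - S) ^ 2 = (#Z : ℝ) ^ 2 * (∑ z ∈ Z, N z ^ 2) - #Z * S ^ 2 := by
    have : ∀ z, ((#Z : ℝ) * N z - S) ^ 2 = (#Z : ℝ) ^ 2 * N z ^ 2 - 2 * #Z * S * N z + S ^ 2 := by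
      intro z; ring
    simp only [this]
    rw [Finset.sum_add_distrib, Finset.sum_sub_distrib, ← Finset.mul_sum, ← Finset.mul_sum, ← hSd]
    simp; ring
  rw [le_sub_iff_add_le, le_div_iff₀ (by positivity)]
  nlinarith

theorem card_support_inv_mul (u u' : Perm α) :
    Fintype.card α - #(u⁻¹ * u').support = agree u u' := by
  rw [← Finset.card_compl]
  rw [agree]
  congr 1
  ext a
  simp only [mem_compl, Perm.mem_support, not_not, mem_filter, mem_univ, true_and, Perm.mul_apply]
  rw [Perm.inv_eq_iff_eq]
  exact eq_comm

/-- The `z` of the appropriate sign such that no `z * u i` lies in the class of `t`. -/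
noncomputable def missed {I : Type*} [Fintype I] (u : I → Perm α) (σ : Perm (Fin k)) (t : Fin k ↪ α) :
    Finset (Perm α) :=
  univ.filter fun z => Perm.sign z = (-1) ^ (Fintype.card α - k - 1) ∧ ∀ i, z * u i ∉ glueClass t σ

theorem sum_missed_le [Nontrivial α] {I : Type*} [Fintype I] [Nonempty I] (u : I → Perm α)
    (hu : ∀ i, Perm.sign (u i) = 1) (σ : Perm (Fin k)) (hσ : Perm.sign σ = 1)
    (hk : k < Fintype.card α) (ψ : ℕ → ℝ)
    (hψ : ∀ (t : Fin k ↪ α) (v : Perm {a // ¬ a ∈ Set.range t}),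
      ((Fintype.card α - k : ℕ) : ℝ) / 2 * fullPairs v ≤
        ((Fintype.card α - k - 1).factorial : ℝ) * ψ (Fintype.card α - #v.support))
    (hψ0 : ∀ f, 0 ≤ ψ f) :
    ∑ t : Fin k ↪ α, (#(missed u σ t) : ℝ) ≤
      ((Fintype.card α).factorial : ℝ) / 2 * (Fintype.card α).descFactorial k *
        ((∑ i, ∑ j, ((agree (u i) (u j)).descFactorial k : ℝ) * ψ (agree (u i) (u j))) /
          (Fintype.card I : ℝ) ^ 2 - 1) := by
  set n := Fintype.card α with hn
  set F : ℝ := ((n - k - 1).factorial : ℝ) with hF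
  set M : ℝ := (Fintype.card I : ℝ) with hM
  set s : ℤˣ := (-1) ^ (n - k - 1) with hs
  have hMpos : 0 < M := by rw [hM, Nat.cast_pos]; exact Fintype.card_pos
  have hFpos : 0 < F := by rw [hF, Nat.cast_pos]; exact Nat.factorial_pos _
  set Z := univ.filter fun z : Perm α => Perm.sign z = s with hZdef
  have hZ : (#Z : ℝ) = (n.factorial : ℝ) / 2 := by
    have := two_mul_card_sign (α := α) s
    rw [eq_div_iff two_ne_zero, mul_comm]
    exact_mod_cast this
  let N : (Fin k ↪ α) → Perm α → ℝ := fun t z => ∑ i, if z * u i ∈ glueClass t σ then (1 : ℝ) else 0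
  have hsum : ∀ t, ∑ z ∈ Z, N t z = M * F := by
    intro t
    simp only [N]
    rw [Finset.sum_comm]
    have : ∀ i, ∑ z ∈ Z, (if z * u i ∈ glueClass t σ then (1 : ℝ) else 0) = F := by
      intro i
      rw [Finset.sum_boole, hF, ← card_glueClass hk t σ]
      congr 1
      refine Finset.card_bij (fun z _ => z * u i) ?_ (by simp) ?_
      · intro z hz; exact (Finset.mem_filter.1 hz).2
      · intro g hg
        refine ⟨g * (u i)⁻¹, ?_, by simp⟩
        rw [Finset.mem_filter, hZdef, Finset.mem_filter]
        refine ⟨⟨mem_univ _, ?_⟩, by simpa using hg⟩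
        rw [Perm.sign_mul, Perm.sign_inv, hu, sign_of_mem_glueClass hk hg, hσ, hs]
        simp [hn]
    simp only [this]
    simp [hM]
  have hmissed : ∀ t, missed u σ t = Z.filter fun z => N t z = 0 := by
    intro t
    ext z
    simp only [missed, hZdef, Finset.filter_filter, mem_filter, mem_univ, true_and, N]
    rw [Finset.sum_eq_zero_iff_of_nonneg (by intro i _; split_ifs <;> norm_num)]
    simp [hs, hn]
  have hsq : ∀ t, ∑ z ∈ Z, N t z ^ 2 ≤ ∑ i, ∑ j,
      (#(univ.filter fun g => g ∈ glueClass t σ ∧ g * ((u i)⁻¹ * u j) ∈ glueClass t σ) : ℝ) := by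
    intro t
    calc ∑ z ∈ Z, N t z ^ 2 ≤ ∑ z, N t z ^ 2 :=
          Finset.sum_le_sum_of_subset_of_nonneg (Finset.subset_univ _) fun _ _ _ => sq_nonneg _
      _ = ∑ z, ∑ i, ∑ j, (if z * u i ∈ glueClass t σ ∧ z * u j ∈ glueClass t σ then (1 : ℝ) else 0) := by
          apply Finset.sum_congr rfl
          intro z _
          simp only [N]
          rw [sq, Finset.sum_mul_sum]
          apply Finset.sum_congr rfl
          intro i _
          apply Finset.sum_congr rfl
          intro j _
          by_cases h1 : z * u i ∈ glueClass t σ <;> by_cases h2 : z * u j ∈ glueClass t σ <;>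
            simp [h1, h2]
      _ = ∑ i, ∑ j, ∑ z, (if z * u i ∈ glueClass t σ ∧ z * u j ∈ glueClass t σ then (1 : ℝ) else 0) := by
          rw [Finset.sum_comm]
          apply Finset.sum_congr rfl
          intro i _
          rw [Finset.sum_comm]
      _ = _ := by
          apply Finset.sum_congr rfl
          intro i _
          apply Finset.sum_congr rfl
          intro j _
          rw [Finset.sum_boole]
          congr 1
          refine Finset.card_bij (fun z _ => z * u i) ?_ (by simp) ?_
          · intro z hz
            simp only [mem_filter, mem_univ, true_and] at hz ⊢
            refine ⟨hz.1, ?_⟩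
            simpa [mul_assoc] using hz.2
          · intro g hg
            refine ⟨g * (u i)⁻¹, ?_, by simp⟩
            simp only [mem_filter, mem_univ, true_and] at hg ⊢
            exact ⟨by simpa using hg.1, by simpa [mul_assoc] using hg.2⟩
  have hm : (0 : ℝ) < ((n - k : ℕ) : ℝ) := by rw [Nat.cast_pos]; omega
  have hpair : ∀ t i j,
      (#(univ.filter fun g => g ∈ glueClass t σ ∧ g * ((u i)⁻¹ * u j) ∈ glueClass t σ) : ℝ) ≤
        if ∀ a, u i (t a) = u j (t a) then 2 / ((n - k : ℕ) : ℝ) * (F * ψ (agree (u i) (u j))) else 0 := by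
    intro t i j
    by_cases hex : ∃ g ∈ glueClass t σ, g * ((u i)⁻¹ * u j) ∈ glueClass t σ
    · obtain ⟨v, hv, hle⟩ := card_glueClass_mul t σ _ hex
      rw [if_pos]
      · have h1 := hψ t v
        rw [← card_support_glue_one t v, hv, card_support_inv_mul] at h1
        have h2 : (fullPairs v : ℝ) ≤ 2 / ((n - k : ℕ) : ℝ) * (F * ψ (agree (u i) (u j))) := by
          rw [div_mul_eq_mul_div, le_div_iff₀ hm]
          linarith
        exact le_trans (by exact_mod_cast hle) h2
      · intro a
        have : ((u i)⁻¹ * u j) (t a) = t a := by rw [← hv, glue_apply]; simp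
        rw [Perm.mul_apply, Perm.inv_eq_iff_eq] at this
        exact this.symm
    · rw [Finset.filter_eq_empty_iff.2]
      · simp only [card_empty, Nat.cast_zero]
        split_ifs
        · have := hψ0 (agree (u i) (u j)); positivity
        · exact le_rfl
      · rintro g - ⟨h1, h2⟩
        exact hex ⟨g, h1, h2⟩
  set Q : ℝ := ∑ i, ∑ j, ((agree (u i) (u j)).descFactorial k : ℝ) * ψ (agree (u i) (u j)) with hQ
  have htot : ∑ t, ∑ z ∈ Z, N t z ^ 2 ≤ 2 / ((n - k : ℕ) : ℝ) * F * Q := by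
    calc _ ≤ ∑ t : Fin k ↪ α, ∑ i, ∑ j, (if ∀ a, u i (t a) = u j (t a) then
          2 / ((n - k : ℕ) : ℝ) * (F * ψ (agree (u i) (u j))) else 0) := by
          apply Finset.sum_le_sum
          intro t _
          refine (hsq t).trans ?_
          apply Finset.sum_le_sum
          intro i _
          apply Finset.sum_le_sum
          intro j _
          exact hpair t i j
      _ = ∑ i, ∑ j, ∑ t : Fin k ↪ α, (if ∀ a, u i (t a) = u j (t a) then
          2 / ((n - k : ℕ) : ℝ) * (F * ψ (agree (u i) (u j))) else 0) := by
          rw [Finset.sum_comm]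
          apply Finset.sum_congr rfl
          intro i _
          rw [Finset.sum_comm]
      _ = _ := by
          rw [hQ, Finset.mul_sum]
          apply Finset.sum_congr rfl
          intro i _
          rw [Finset.mul_sum]
          apply Finset.sum_congr rfl
          intro j _
          rw [← Finset.sum_filter, Finset.sum_const, card_embedding_agree, nsmul_eq_mul]
          ring
  have hT : (Fintype.card (Fin k ↪ α) : ℝ) = n.descFactorial k := by
    rw [Fintype.card_embedding_eq, Fintype.card_fin]
  have hfac : (n.factorial : ℝ) = n.descFactorial k * (((n - k : ℕ) : ℝ) * F) := by
    rw [hF, ← Nat.factorial_mul_descFactorial hk.le]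
    obtain ⟨m, hm'⟩ : ∃ m, n - k = m + 1 := ⟨n - k - 1, by omega⟩
    rw [hm', Nat.factorial_succ]
    push_cast
    ring
  calc ∑ t : Fin k ↪ α, (#(missed u σ t) : ℝ)
      ≤ ∑ t : Fin k ↪ α, ((#Z : ℝ) ^ 2 * (∑ z ∈ Z, N t z ^ 2) / (M * F) ^ 2 - #Z) := by
        apply Finset.sum_le_sum
        intro t _
        rw [hmissed t, ← hsum t]
        exact card_zero_le Z (N t) (by rw [hsum t]; positivity)
    _ = (#Z : ℝ) ^ 2 * (∑ t, ∑ z ∈ Z, N t z ^ 2) / (M * F) ^ 2 - n.descFactorial k * #Z := by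
        rw [Finset.sum_sub_distrib, ← Finset.sum_div, ← Finset.mul_sum, Finset.sum_const,
          nsmul_eq_mul, Finset.card_univ, hT]
    _ ≤ (#Z : ℝ) ^ 2 * (2 / ((n - k : ℕ) : ℝ) * F * Q) / (M * F) ^ 2 - n.descFactorial k * #Z := by
        gcongr
    _ = _ := by
        rw [hZ, hfac]
        field_simp

theorem one_le_avg_agree {I : Type*} [Fintype I] [Nonempty I] (u : I → Perm α)
    (hk : k ≤ Fintype.card α) :
    (Fintype.card I : ℝ) ^ 2 ≤ ∑ i, ∑ j, ((agree (u i) (u j)).descFactorial k : ℝ) := by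
  let T := Fin k ↪ α
  have hT0 : 0 < Fintype.card T := by
    rw [Fintype.card_embedding_eq, Fintype.card_fin]
    exact Nat.pos_of_ne_zero (by rw [Ne, Nat.descFactorial_eq_zero_iff_lt]; omega)
  let c : T × T → ℝ := fun p => ∑ i, if p.1.trans (u i).toEmbedding = p.2 then (1 : ℝ) else 0
  have h1 : ∑ p, c p = Fintype.card I * Fintype.card T := by
    simp only [c]
    rw [Finset.sum_comm]
    have : ∀ i, ∑ p : T × T, (if p.1.trans (u i).toEmbedding = p.2 then (1 : ℝ) else 0) =
        Fintype.card T := by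
      intro i
      rw [Fintype.sum_prod_type]
      simp
    simp [this]
  have h2 : ∑ p, c p ^ 2 = ∑ i, ∑ j, ((agree (u i) (u j)).descFactorial k : ℝ) := by
    have : ∀ p : T × T, c p ^ 2 = ∑ i, ∑ j, if p.1.trans (u i).toEmbedding = p.2 ∧
        p.1.trans (u j).toEmbedding = p.2 then (1 : ℝ) else 0 := by
      intro p
      simp only [c]
      rw [sq, Finset.sum_mul_sum]
      apply Finset.sum_congr rfl
      intro i _
      apply Finset.sum_congr rfl
      intro j _
      by_cases h1 : p.1.trans (u i).toEmbedding = p.2 <;>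
        by_cases h2 : p.1.trans (u j).toEmbedding = p.2 <;> simp [h1, h2]
    simp only [this]
    rw [Finset.sum_comm]
    apply Finset.sum_congr rfl
    intro i _
    rw [Finset.sum_comm]
    apply Finset.sum_congr rfl
    intro j _
    rw [Fintype.sum_prod_type, ← card_embedding_agree, ← Finset.sum_boole]
    apply Finset.sum_congr rfl
    intro t _
    have : ∀ t' : T, (if t.trans (u i).toEmbedding = t' ∧ t.trans (u j).toEmbedding = t' then (1 : ℝ)
        else 0) = if t.trans (u i).toEmbedding = t' then
          (if t.trans (u j).toEmbedding = t.trans (u i).toEmbedding then 1 else 0) else 0 := by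
      intro t'
      by_cases h : t.trans (u i).toEmbedding = t'
      · subst h; simp
      · simp [h]
    simp only [this]
    rw [Finset.sum_ite_eq]
    simp only [mem_univ, if_true]
    congr 1
    rw [Function.Embedding.ext_iff]
    simp [eq_comm]
  have h3 := Finset.sum_mul_sq_le_sq_mul_sq (univ : Finset (T × T)) (fun _ => (1 : ℝ)) c
  simp only [one_mul, one_pow, h1, h2, sum_const, nsmul_eq_mul, mul_one, card_univ,
    Fintype.card_prod] at h3
  have hT1 : (0 : ℝ) < (Fintype.card T : ℝ) ^ 2 := by positivity
  refine le_of_mul_le_mul_left ?_ hT1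
  calc _ = ((Fintype.card I : ℝ) * Fintype.card T) ^ 2 := by ring
    _ ≤ _ := h3
    _ = _ := by push_cast; ring

end SecondMoment

open Filter Topology

section Asymptotics

/-- The cut-off weight bounding the number of pairs of full cycles. -/
noncomputable def weight (ε : ℝ) (q n f : ℕ) : ℝ := if q * f ≤ n then 1 + ε else n

theorem one_le_weight {ε : ℝ} (hε : 0 ≤ ε) (q : ℕ) {n : ℕ} (hn : 1 ≤ n) (f : ℕ) :
    1 ≤ weight ε q n f := by
  rw [weight]
  split_ifs
  · linarith
  · exact_mod_cast hn

theorem exp_neg_le_of_pos {x : ℝ} (hx : 0 < x) : Real.exp (-x) ≤ 2 / x ^ 2 := by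
  rw [Real.exp_neg, inv_le_comm₀ (Real.exp_pos _) (by positivity), inv_div]
  have := Real.quadratic_le_exp_of_nonneg hx.le
  linarith

theorem exists_fullPairs_le_weight (k : ℕ) {ε : ℝ} (hε : 0 < ε) (hε1 : ε ≤ 1) :
    ∃ q : ℕ, 2 ≤ q ∧ ∀ᶠ n : ℕ in atTop, ∀ (t : Fin k ↪ Fin n) (v : Perm {a // ¬ a ∈ Set.range t}),
      ((n - k : ℕ) : ℝ) / 2 * fullPairs v ≤
        ((n - k - 1).factorial : ℝ) * weight ε q n (n - #v.support) := by
  obtain ⟨q, hq⟩ := exists_nat_ge (8 / ε)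
  have hq8 : (8 : ℝ) ≤ q := by
    refine le_trans ?_ hq
    rw [le_div_iff₀ hε]; linarith
  have hq0 : (0 : ℝ) < q := by linarith
  refine ⟨q, by exact_mod_cast (by linarith : (2 : ℝ) ≤ q), ?_⟩
  obtain ⟨n₀, hn₀⟩ := exists_nat_ge (2 * 64 * 16 / ε ^ 3)
  filter_upwards [eventually_ge_atTop (n₀ + 1), eventually_gt_atTop k] with n hn hk t v
  have hkn : k < Fintype.card (Fin n) := by simpa using hk
  have := nonempty_notMem_range hkn t
  have hcard : Fintype.card {a // ¬ a ∈ Set.range t} = n - k := by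
    rw [card_notMem_range, Fintype.card_fin]
  have hn0 : (0 : ℝ) < n := by exact_mod_cast (by omega : 0 < n)
  have hmn : ((n - k : ℕ) : ℝ) ≤ n := by exact_mod_cast Nat.sub_le _ _
  rw [weight]
  split_ifs with hf
  · set N := #v.support with hN
    have hNn : N ≤ n := (Finset.card_le_univ _).trans (by rw [hcard]; omega)
    have hf' : (q : ℝ) * (n - N) ≤ n := by
      have : ((q * (n - N) : ℕ) : ℝ) ≤ n := by exact_mod_cast hf
      rwa [Nat.cast_mul, Nat.cast_sub hNn] at this
    have hqe : 1 / (q : ℝ) ≤ ε / 8 := by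
      rw [div_le_iff₀ hq0]
      rw [div_le_iff₀ hε] at hq
      linarith
    have hNge : (1 - ε / 8) * (n : ℝ) ≤ N := by
      have h1 : (n : ℝ) - N ≤ n * (1 / q) := by
        rw [mul_one_div, le_div_iff₀ hq0]; linarith
      nlinarith
    have hNpos : (0 : ℝ) < N := by nlinarith
    have hNhalf : (n : ℝ) / 2 ≤ N := by nlinarith
    have hmain := fullPairs_le v (δ := ε / 8) (by linarith) (by linarith)
      (by exact_mod_cast hNpos)
    rw [hcard] at hmain
    set F : ℝ := ((n - k - 1).factorial : ℝ)
    have hF0 : 0 < F := by simp only [F]; exact_mod_cast Nat.factorial_pos _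
    have hA : (n : ℝ) / 2 * (2 / (N * (1 - ε / 8))) ≤ 1 + ε / 2 := by
      have h8 : 0 < 1 - ε / 8 := by linarith
      rw [div_mul_div_comm, mul_comm 2 ((N : ℝ) * _), mul_div_mul_right _ _ two_ne_zero,
        div_le_iff₀ (by positivity)]
      have h9 : (n : ℝ) ≤ (1 + ε / 2) * ((1 - ε / 8) * n * (1 - ε / 8)) := by
        have : 1 ≤ (1 + ε / 2) * ((1 - ε / 8) * (1 - ε / 8)) := by nlinarith [sq_nonneg ε]
        nlinarith
      refine h9.trans ?_
      gcongr
    have hB : (n : ℝ) / 2 * Real.exp (-(N * (ε / 8) / 2)) ≤ ε / 2 := by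
      have h1 : Real.exp (-(N * (ε / 8) / 2)) ≤ 2 / (n * ε / 32) ^ 2 := by
        refine le_trans (Real.exp_le_exp.2 ?_) (exp_neg_le_of_pos (x := n * ε / 32) (by positivity))
        nlinarith
      calc _ ≤ (n : ℝ) / 2 * (2 / (n * ε / 32) ^ 2) := by gcongr
        _ = 1024 / (ε ^ 2 * n) := by field_simp; norm_num
        _ ≤ ε / 2 := by
            rw [div_le_div_iff₀ (by positivity) two_pos]
            have : (2 * 64 * 16 / ε ^ 3 : ℝ) ≤ n := hn₀.trans (by exact_mod_cast (by omega))
            rw [div_le_iff₀ (by positivity)] at this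
            nlinarith
    calc ((n - k : ℕ) : ℝ) / 2 * fullPairs v
        ≤ (n : ℝ) / 2 * (F * (2 / (N * (1 - ε / 8)) + Real.exp (-(N * (ε / 8) / 2)))) := by gcongr
      _ = F * ((n : ℝ) / 2 * (2 / (N * (1 - ε / 8))) +
          (n : ℝ) / 2 * Real.exp (-(N * (ε / 8) / 2))) := by ring
      _ ≤ F * (1 + ε) := by
          apply mul_le_mul_of_nonneg_left _ hF0.le
          linarith
  · have h1 := fullPairs_le_factorial v
    rw [hcard] at h1
    have h2 : (fullPairs v : ℝ) ≤ (n - k - 1).factorial := by exact_mod_cast h1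
    calc ((n - k : ℕ) : ℝ) / 2 * fullPairs v ≤ (n : ℝ) * (n - k - 1).factorial := by
          gcongr
          have : (0 : ℝ) ≤ ((n - k : ℕ) : ℝ) := Nat.cast_nonneg _
          linarith
      _ = _ := mul_comm _ _

theorem descFactorial_mul_weight_le {ε : ℝ} (hε : 0 ≤ ε) {k q n f : ℕ} (hq : 2 ≤ q)
    (hn : 2 * q * (k + 1) ≤ n) :
    (f.descFactorial k : ℝ) * weight ε q n f ≤
      (1 + ε) * f.descFactorial k + 4 * q ^ 2 / n * f.descFactorial (k + 2) := by
  have hd : (0 : ℝ) ≤ f.descFactorial k := Nat.cast_nonneg _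
  have hn0 : (0 : ℝ) < n := by
    have : 0 < n := lt_of_lt_of_le (by positivity) hn
    exact_mod_cast this
  rw [weight]
  split_ifs with hf
  · have : 0 ≤ 4 * (q : ℝ) ^ 2 / n * f.descFactorial (k + 2) := by positivity
    linarith
  · push Not at hf
    have hfk : k + 1 < f := by
      by_contra h
      push Not at h
      have : q * f ≤ q * (k + 1) := Nat.mul_le_mul_left _ h
      nlinarith
    obtain ⟨r, rfl⟩ : ∃ r, f = r + (k + 1) := ⟨f - (k + 1), by omega⟩
    have h1 : (r + (k + 1)).descFactorial (k + 2) = r * ((r + 1) * (r + (k + 1)).descFactorial k) := by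
      rw [Nat.descFactorial_succ, Nat.descFactorial_succ]
      congr 1
      · omega
      · congr 1; omega
    have hr : n ≤ 2 * q * r := by nlinarith
    have hr' : (n : ℝ) ≤ 2 * q * r := by exact_mod_cast hr
    rw [h1]
    push_cast
    have h2 : (n : ℝ) * n ≤ 4 * q ^ 2 * (r * (r + 1)) := by
      have hr0 : (0 : ℝ) ≤ r := Nat.cast_nonneg _
      calc (n : ℝ) * n ≤ (2 * q * r) * (2 * q * r) := by gcongr
        _ = 4 * q ^ 2 * (r * r) := by ring
        _ ≤ _ := by gcongr; linarith
    have h3 : (n : ℝ) ≤ 4 * q ^ 2 / n * (r * (r + 1)) := by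
      rw [div_mul_eq_mul_div, le_div_iff₀ hn0]; exact h2
    nlinarith

/-- The word length. -/
def wordLen (n : ℕ) : ℕ := 10 * (Nat.log 2 n + 1)

theorem one_le_log_natCast {n : ℕ} (hn : 3 ≤ n) : 1 ≤ Real.log n := by
  have hn3 : (3 : ℝ) ≤ n := by exact_mod_cast hn
  rw [Real.le_log_iff_exp_le (by linarith)]
  have := Real.exp_one_lt_d9
  linarith

theorem wordLen_le {n : ℕ} (hn : 3 ≤ n) : (wordLen n : ℝ) ≤ 50 * Real.log n := by
  have hlog := one_le_log_natCast hn
  have h2 : (Nat.log 2 n : ℝ) ≤ 2 * Real.log n := by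
    have h := Real.natLog_le_logb n 2
    refine h.trans ?_
    rw [Real.logb, div_le_iff₀ (Real.log_pos (by norm_num))]
    have := Real.log_two_gt_d9
    push_cast
    nlinarith
  rw [wordLen]
  push_cast
  linarith

theorem tendsto_wordLen_pow_div (c j : ℕ) :
    Tendsto (fun n : ℕ => ((c * wordLen n : ℕ) : ℝ) ^ j / n) atTop (𝓝 0) := by
  have h1 : Tendsto (fun n : ℕ => (c * 50 : ℝ) ^ j * (Real.log n ^ j / n)) atTop (𝓝 0) := by
    have := (Real.isLittleO_pow_log_id_atTop (n := j)).tendsto_div_nhds_zero.comp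
      tendsto_natCast_atTop_atTop
    simpa using this.const_mul ((c * 50 : ℝ) ^ j)
  refine tendsto_of_tendsto_of_tendsto_of_le_of_le' tendsto_const_nhds h1
    (Eventually.of_forall fun n => by positivity) ?_
  filter_upwards [eventually_ge_atTop 3] with n hn
  rw [← mul_div_assoc, ← mul_pow]
  gcongr
  push_cast
  rw [mul_assoc]
  gcongr
  exact wordLen_le hn

theorem tendsto_kappa (k c : ℕ) :
    Tendsto (fun n : ℕ => (n : ℝ) ^ k * (((c * wordLen n : ℕ) : ℝ) ^ (k + 1) *
        (2 * ((c * wordLen n : ℕ) : ℝ)) ^ (k + 1) + ((n - c * wordLen n : ℕ) : ℝ)) /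
          ((n - c * wordLen n : ℕ) : ℝ) ^ (k + 1)) atTop (𝓝 1) := by
  have h0 := tendsto_wordLen_pow_div c 1
  have h1 : Tendsto (fun n : ℕ => ((n - c * wordLen n : ℕ) : ℝ) / n) atTop (𝓝 1) := by
    have h2 : Tendsto (fun n : ℕ => 1 - ((c * wordLen n : ℕ) : ℝ) ^ 1 / n) atTop (𝓝 1) := by
      simpa using h0.const_sub 1
    refine h2.congr' ?_
    filter_upwards [h0.eventually (gt_mem_nhds one_pos), eventually_gt_atTop 0] with n hn hn0
    have hn0' : (0 : ℝ) < n := by exact_mod_cast hn0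
    rw [div_lt_one hn0', pow_one] at hn
    rw [Nat.cast_sub (by exact_mod_cast hn.le)]
    field_simp
  have h3 : Tendsto (fun n : ℕ => (n : ℝ) / ((n - c * wordLen n : ℕ) : ℝ)) atTop (𝓝 1) := by
    simpa using h1.inv₀ one_ne_zero
  have h4 : Tendsto (fun n : ℕ => ((n : ℝ) / ((n - c * wordLen n : ℕ) : ℝ)) ^ k *
      (2 ^ (k + 1) * (((c * wordLen n : ℕ) : ℝ) ^ (2 * (k + 1)) / n) *
        ((n : ℝ) / ((n - c * wordLen n : ℕ) : ℝ)) + 1)) atTop (𝓝 1) := by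
    have := (h3.pow k).mul ((((tendsto_wordLen_pow_div c (2 * (k + 1))).const_mul
      (2 ^ (k + 1))).mul h3).add_const 1)
    simpa using this
  refine h4.congr' ?_
  filter_upwards [h1.eventually (lt_mem_nhds one_pos), eventually_gt_atTop 0] with n hn hn0
  have hn0' : (0 : ℝ) < n := by exact_mod_cast hn0
  have hN : (0 : ℝ) < ((n - c * wordLen n : ℕ) : ℝ) := by
    by_contra h
    have h' : ((n - c * wordLen n : ℕ) : ℝ) = 0 := le_antisymm (not_lt.1 h) (Nat.cast_nonneg _)
    rw [h', zero_div] at hn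
    exact lt_irrefl _ hn
  generalize ((n - c * wordLen n : ℕ) : ℝ) = N at hN
  rw [div_pow]
  field_simp
  ring

end Asymptotics

section Average
variable {α : Type*} [Fintype α] [DecidableEq α]

theorem sign_evalW {e : Bool → Perm α} (he : Perm.sign (e false) = Perm.sign (e true))
    (l : List Bool) : Perm.sign (evalW e l) = Perm.sign (e true) ^ l.length := by
  induction l with
  | nil => simp [evalW]
  | cons b l ih =>
    rw [evalW, Perm.sign_mul, ih, List.length_cons, pow_succ]
    cases b <;> simp [he]

/-- The words of a given length, evaluated. -/
def words {ℓ : ℕ} (e : Bool → Perm α) (w : Fin ℓ → Bool) : Perm α := evalW e (List.ofFn w)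

theorem sign_words {n : ℕ} {e : Bool → Perm α} (he : Perm.sign (e false) = Perm.sign (e true))
    (w : Fin (wordLen n) → Bool) : Perm.sign (words e w) = 1 := by
  rw [words, sign_evalW he, List.length_ofFn, wordLen, show 10 * (Nat.log 2 n + 1) =
    2 * (5 * (Nat.log 2 n + 1)) by ring, pow_mul, Int.units_sq, one_pow]

theorem agree_self (u : Perm α) : agree u u = Fintype.card α := by simp [agree]

theorem sum_agree_words_le {k n c : ℕ} (hc : 2 * k ≤ c) (hk : 1 ≤ k)
    (hR : c * wordLen n < Fintype.card α)
    {w w' : Fin (wordLen n) → Bool} (hne : w ≠ w') :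
    ∑ e : Bool → Perm α, ((agree (words e w) (words e w')).descFactorial k : ℝ) ≤
      (Fintype.card α : ℝ) ^ k * (((c * wordLen n : ℕ) : ℝ) ^ (k + 1) *
        (2 * ((c * wordLen n : ℕ) : ℝ)) ^ (k + 1) + ((Fintype.card α - c * wordLen n : ℕ) : ℝ)) /
          ((Fintype.card α - c * wordLen n : ℕ) : ℝ) ^ (k + 1) * Fintype.card (Bool → Perm α) := by
  have hl : 1 ≤ wordLen n := by rw [wordLen]; omega
  have h := sum_agree_le (α := α) (k := k) (ℓ := wordLen n) (R := c * wordLen n)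
    (Nat.mul_le_mul_right _ hc) (by nlinarith) (w := List.ofFn w) (w' := List.ofFn w')
    (by simp) (by simp) (fun h => hne (List.ofFn_injective h))
  have hN : (0 : ℝ) < ((Fintype.card α - c * wordLen n : ℕ) : ℝ) := by
    exact_mod_cast Nat.sub_pos_of_lt hR
  rw [div_mul_eq_mul_div, le_div_iff₀ (by positivity)]
  exact_mod_cast h

theorem pow_ten_le_two_pow_wordLen (n : ℕ) : n ^ 10 ≤ 2 ^ wordLen n := by
  rw [wordLen, mul_comm, pow_mul]
  exact Nat.pow_le_pow_left (Nat.lt_pow_succ_log_self (by norm_num) n).le _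

theorem eventually_sum_missed_le {k : ℕ} (hk1 : 1 ≤ k) (hk8 : k ≤ 8) (σ : Perm (Fin k))
    (hσ : Perm.sign σ = 1) {η : ℝ} (hη : 0 < η) :
    ∀ᶠ n : ℕ in atTop, ∑ e ∈ univ.filter (fun e : Bool → Perm (Fin n) =>
        Perm.sign (e false) = Perm.sign (e true)), ∑ t : Fin k ↪ Fin n,
          (#(missed (words (ℓ := wordLen n) e) σ t) : ℝ) ≤
      η * (n.factorial : ℝ) ^ 3 * n.descFactorial k := by
  set ε := min η 1 with hεd
  have hε : 0 < ε := lt_min hη one_pos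
  obtain ⟨q, hq2, hq⟩ := exists_fullPairs_le_weight k hε (min_le_right _ _)
  let c := 2 * (k + 2)
  let κ : ℕ → ℕ → ℝ := fun j n => (n : ℝ) ^ j * (((c * wordLen n : ℕ) : ℝ) ^ (j + 1) *
        (2 * ((c * wordLen n : ℕ) : ℝ)) ^ (j + 1) + ((n - c * wordLen n : ℕ) : ℝ)) /
          ((n - c * wordLen n : ℕ) : ℝ) ^ (j + 1)
  have hκ : ∀ j, Tendsto (κ j) atTop (𝓝 1) := fun j => tendsto_kappa j c
  have hlim : Tendsto (fun n : ℕ => 1 / (n : ℝ) + ((1 + ε) * κ k n +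
      4 * (q : ℝ) ^ 2 / n * κ (k + 2) n)) atTop (𝓝 (1 + ε)) := by
    have h1 : Tendsto (fun n : ℕ => 1 / (n : ℝ)) atTop (𝓝 0) := tendsto_one_div_atTop_nhds_zero_nat
    have h2 : Tendsto (fun n : ℕ => 4 * (q : ℝ) ^ 2 / (n : ℝ)) atTop (𝓝 0) :=
      tendsto_const_div_atTop_nhds_zero_nat _
    have := h1.add (((hκ k).const_mul (1 + ε)).add (h2.mul (hκ (k + 2))))
    simpa using this
  have hR := (tendsto_wordLen_pow_div c 1).eventually (gt_mem_nhds one_pos)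
  filter_upwards [hq, hlim.eventually (gt_mem_nhds (by linarith : 1 + ε < 1 + 2 * ε)), hR,
    eventually_ge_atTop 2, eventually_gt_atTop k, eventually_ge_atTop (2 * q * (k + 1))]
    with n hqn hlimn hRn hn2 hkn hqk
  have hn0 : (0 : ℝ) < n := by exact_mod_cast (by omega : 0 < n)
  rw [div_lt_one hn0, pow_one] at hRn
  have hRn' : c * wordLen n < n := by exact_mod_cast hRn
  have : Nontrivial (Fin n) := Fin.nontrivial_iff_two_le.2 hn2
  have hM : (n : ℝ) ^ 10 ≤ (Fintype.card (Fin (wordLen n) → Bool) : ℝ) := by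
    have := pow_ten_le_two_pow_wordLen n
    simp only [Fintype.card_fun, Fintype.card_bool, Fintype.card_fin]
    exact_mod_cast this
  set M : ℝ := (Fintype.card (Fin (wordLen n) → Bool) : ℝ) with hMd
  have hM0 : 0 < M := lt_of_lt_of_le (by positivity) hM
  let A : (Bool → Perm (Fin n)) → ℝ := fun e =>
    (∑ i : Fin (wordLen n) → Bool, ∑ j : Fin (wordLen n) → Bool,
      ((agree (words e i) (words e j)).descFactorial k : ℝ) *
        weight ε q n (agree (words e i) (words e j))) / M ^ 2
  have hA1 : ∀ e, 1 ≤ A e := by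
    intro e
    simp only [A]
    rw [le_div_iff₀ (by positivity), one_mul]
    refine (one_le_avg_agree (k := k) (words e) (by simpa using hkn.le)).trans ?_
    apply Finset.sum_le_sum
    intro i _
    apply Finset.sum_le_sum
    intro j _
    exact le_mul_of_one_le_right (Nat.cast_nonneg _) (one_le_weight hε.le q (by omega) _)
  set E : ℝ := (Fintype.card (Bool → Perm (Fin n)) : ℝ) with hE
  have hEfac : E = (n.factorial : ℝ) ^ 2 := by
    rw [hE]; simp [Fintype.card_perm]
  have hEpos : 0 < E := by rw [hEfac]; positivity
  have hpair : ∀ i j : Fin (wordLen n) → Bool, ∑ e : Bool → Perm (Fin n),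
      ((agree (words e i) (words e j)).descFactorial k : ℝ) *
        weight ε q n (agree (words e i) (words e j)) ≤
      (if i = j then (n : ℝ) ^ 9 * E else 0) +
        ((1 + ε) * κ k n + 4 * (q : ℝ) ^ 2 / n * κ (k + 2) n) * E := by
    intro i j
    have hκ0 : ∀ j, 0 ≤ κ j n := fun j => by simp only [κ]; positivity
    by_cases hij : i = j
    · subst hij
      rw [if_pos rfl]
      have h1 : ∑ e : Bool → Perm (Fin n), ((agree (words e i) (words e i)).descFactorial k : ℝ) *
        weight ε q n (agree (words e i) (words e i)) ≤ ∑ e : Bool → Perm (Fin n), (n : ℝ) ^ 9 := by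
        apply Finset.sum_le_sum
        intro e _
        rw [agree_self, Fintype.card_fin, weight, if_neg (by nlinarith)]
        calc (n.descFactorial k : ℝ) * n ≤ (n : ℝ) ^ k * n := by
              gcongr; exact_mod_cast Nat.descFactorial_le_pow _ _
          _ = (n : ℝ) ^ (k + 1) := (pow_succ _ _).symm
          _ ≤ (n : ℝ) ^ 9 := by
              apply pow_le_pow_right₀
              · exact_mod_cast (by omega : 1 ≤ n)
              · omega
      rw [Finset.sum_const, nsmul_eq_mul, Finset.card_univ, mul_comm] at h1
      have h2 : 0 ≤ ((1 + ε) * κ k n + 4 * (q : ℝ) ^ 2 / n * κ (k + 2) n) * E := by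
        have := hκ0 k; have := hκ0 (k + 2); positivity
      linarith
    · rw [if_neg hij, zero_add]
      calc _ ≤ ∑ e : Bool → Perm (Fin n), ((1 + ε) *
            ((agree (words e i) (words e j)).descFactorial k : ℝ) +
            4 * (q : ℝ) ^ 2 / n * ((agree (words e i) (words e j)).descFactorial (k + 2) : ℝ)) := by
            apply Finset.sum_le_sum
            intro e _
            exact descFactorial_mul_weight_le hε.le hq2 hqk
        _ = (1 + ε) * (∑ e : Bool → Perm (Fin n),
              ((agree (words e i) (words e j)).descFactorial k : ℝ)) +
            4 * (q : ℝ) ^ 2 / n * ∑ e : Bool → Perm (Fin n),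
              ((agree (words e i) (words e j)).descFactorial (k + 2) : ℝ) := by
            rw [Finset.sum_add_distrib, Finset.mul_sum, Finset.mul_sum]
        _ ≤ (1 + ε) * (κ k n * E) + 4 * (q : ℝ) ^ 2 / n * (κ (k + 2) n * E) := by
            have h1 := sum_agree_words_le (α := Fin n) (k := k) (n := n) (c := c)
              (by simp only [c]; omega) hk1 (by simpa using hRn') hij
            have h2 := sum_agree_words_le (α := Fin n) (k := k + 2) (n := n) (c := c)
              (by simp only [c]; omega) (by omega) (by simpa using hRn') hij
            rw [Fintype.card_fin] at h1 h2
            gcongr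
        _ = _ := by ring
  have hAsum : ∑ e, A e ≤ (1 + 2 * ε) * E := by
    have h1 : ∑ e, A e = (∑ i : Fin (wordLen n) → Bool, ∑ j : Fin (wordLen n) → Bool,
        ∑ e : Bool → Perm (Fin n), ((agree (words e i) (words e j)).descFactorial k : ℝ) *
        weight ε q n (agree (words e i) (words e j))) / M ^ 2 := by
      simp only [A]
      rw [← Finset.sum_div, Finset.sum_comm]
      congr 1
      apply Finset.sum_congr rfl
      intro i _
      rw [Finset.sum_comm]
    rw [h1, div_le_iff₀ (by positivity)]
    calc _ ≤ ∑ i : Fin (wordLen n) → Bool, ∑ j : Fin (wordLen n) → Bool,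
          ((if i = j then (n : ℝ) ^ 9 * E else 0) +
          ((1 + ε) * κ k n + 4 * (q : ℝ) ^ 2 / n * κ (k + 2) n) * E) := by
          apply Finset.sum_le_sum
          intro i _
          apply Finset.sum_le_sum
          intro j _
          exact hpair i j
      _ = M * ((n : ℝ) ^ 9 * E) +
          M ^ 2 * (((1 + ε) * κ k n + 4 * (q : ℝ) ^ 2 / n * κ (k + 2) n) * E) := by
          simp only [Finset.sum_add_distrib, Finset.sum_ite_eq, mem_univ, if_true, Finset.sum_const,
            nsmul_eq_mul, Finset.card_univ]
          rw [← hMd]; ring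
      _ ≤ (1 / (n : ℝ) + ((1 + ε) * κ k n + 4 * (q : ℝ) ^ 2 / n * κ (k + 2) n)) * E * M ^ 2 := by
          have : (n : ℝ) ^ 9 ≤ 1 / n * M := by
            rw [one_div_mul_eq_div, le_div_iff₀ hn0, ← pow_succ]; exact hM
          have h3 : M * ((n : ℝ) ^ 9 * E) ≤ M * (1 / n * M * E) := by gcongr
          linarith
      _ ≤ _ := by gcongr
  calc _ ≤ ∑ e ∈ univ.filter (fun e : Bool → Perm (Fin n) =>
        Perm.sign (e false) = Perm.sign (e true)),
          (n.factorial : ℝ) / 2 * n.descFactorial k * (A e - 1) := by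
        apply Finset.sum_le_sum
        intro e he
        have he' := (Finset.mem_filter.1 he).2
        have := sum_missed_le (α := Fin n) (k := k) (words (ℓ := wordLen n) e)
          (fun w => sign_words he' w) σ hσ (by simpa using hkn) (weight ε q n)
          (by simpa only [Fintype.card_fin] using hqn)
          (fun f => zero_le_one.trans (one_le_weight hε.le q (by omega) f))
        rwa [Fintype.card_fin] at this
    _ ≤ ∑ e, (n.factorial : ℝ) / 2 * n.descFactorial k * (A e - 1) := by
        apply Finset.sum_le_sum_of_subset_of_nonneg (Finset.subset_univ _)
        intro e _ _
        have := hA1 e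
        have : 0 ≤ A e - 1 := by linarith
        positivity
    _ = (n.factorial : ℝ) / 2 * n.descFactorial k * (∑ e, A e - E) := by
        rw [← Finset.mul_sum, Finset.sum_sub_distrib]
        simp [hE]
    _ ≤ (n.factorial : ℝ) / 2 * n.descFactorial k * (2 * ε * E) := by
        gcongr; linarith
    _ = ε * (n.factorial : ℝ) ^ 3 * n.descFactorial k := by rw [hEfac]; ring
    _ ≤ _ := by
        gcongr
        exact min_le_left _ _

end Average

section Reach

/-- `g` is a product of at most `L` elements of `S`. -/
def Reach {G : Type*} [Group G] (S : Set G) (L : ℕ) (g : G) : Prop :=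
  ∃ l : List G, (∀ a ∈ l, a ∈ S) ∧ l.prod = g ∧ l.length ≤ L

variable {G : Type*} [Group G] {S : Set G}

theorem Reach.one (L : ℕ) : Reach S L (1 : G) := ⟨[], by simp, rfl, by simp⟩

theorem Reach.of_mem {g : G} (hg : g ∈ S) : Reach S 1 g := ⟨[g], by simpa using hg, by simp, by simp⟩

theorem Reach.mono {L L' : ℕ} {g : G} (h : Reach S L g) (hL : L ≤ L') : Reach S L' g := by
  obtain ⟨l, h1, h2, h3⟩ := h
  exact ⟨l, h1, h2, h3.trans hL⟩

theorem Reach.mul {L L' : ℕ} {g g' : G} (h : Reach S L g) (h' : Reach S L' g') :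
    Reach S (L + L') (g * g') := by
  obtain ⟨l, h1, rfl, h3⟩ := h
  obtain ⟨l', h1', rfl, h3'⟩ := h'
  refine ⟨l ++ l', ?_, by simp, by simp; omega⟩
  intro a ha
  rcases List.mem_append.1 ha with h | h
  · exact h1 a h
  · exact h1' a h

theorem Reach.inv (hS : ∀ s ∈ S, s⁻¹ ∈ S) {L : ℕ} {g : G} (h : Reach S L g) : Reach S L g⁻¹ := by
  obtain ⟨l, h1, rfl, h3⟩ := h
  refine ⟨(l.map fun x => x⁻¹).reverse, ?_, (List.prod_inv_reverse l).symm, by simpa using h3⟩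
  intro a ha
  rw [List.mem_reverse, List.mem_map] at ha
  obtain ⟨b, hb, rfl⟩ := ha
  exact hS b (h1 b hb)

theorem Reach.pow {L : ℕ} {g : G} (h : Reach S L g) (j : ℕ) : Reach S (j * L) (g ^ j) := by
  induction j with
  | zero => simpa using Reach.one 0
  | succ j ih => rw [pow_succ, Nat.succ_mul]; exact ih.mul h

theorem Reach.conj (hS : ∀ s ∈ S, s⁻¹ ∈ S) {L L' : ℕ} {g h : G} (hh : Reach S L' h)
    (hg : Reach S L g) : Reach S (L + 2 * L') (h * g * h⁻¹) :=
  ((hh.mul hg).mul (hh.inv hS)).mono (by omega)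

theorem Reach.mem_closure {L : ℕ} {g : G} (h : Reach S L g) : g ∈ Subgroup.closure S := by
  obtain ⟨l, h1, rfl, -⟩ := h
  exact Subgroup.list_prod_mem _ fun a ha => Subgroup.subset_closure (h1 a ha)

end Reach

section ThreeCycles
variable {α : Type*} [Fintype α] [DecidableEq α]

theorem reach_evalW {S : Set (Perm α)} {e : Bool → Perm α} (he : ∀ b, e b ∈ S) (l : List Bool) :
    Reach S l.length (evalW e l) := by
  induction l with
  | nil => exact Reach.one _
  | cons b l ih =>
    rw [evalW, List.length_cons]
    exact ih.mul (Reach.of_mem (he b))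

/-- The cycle `a → b → c → a`. -/
def cyc (a b c : α) : Perm α := swap a b * swap b c

theorem conj_cyc (g : Perm α) (a b c : α) : g * cyc a b c * g⁻¹ = cyc (g a) (g b) (g c) := by
  rw [cyc, cyc, Equiv.swap_apply_apply, Equiv.swap_apply_apply]
  group

theorem cyc_apply_left {a b c : α} (hab : a ≠ b) (hac : a ≠ c) : cyc a b c a = b := by
  rw [cyc, Perm.mul_apply, swap_apply_of_ne_of_ne hab hac, swap_apply_left]

theorem cyc_apply_right (a b c : α) : cyc a b c c = a := by
  rw [cyc, Perm.mul_apply, swap_apply_right, swap_apply_right]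

theorem cyc_apply_of_ne {a b c x : α} (ha : x ≠ a) (hb : x ≠ b) (hc : x ≠ c) : cyc a b c x = x := by
  rw [cyc, Perm.mul_apply, swap_apply_of_ne_of_ne hb hc, swap_apply_of_ne_of_ne ha hb]

theorem sign_cyc {a b c : α} (hab : a ≠ b) (hbc : b ≠ c) : Perm.sign (cyc a b c) = 1 := by
  rw [cyc, Perm.sign_mul, Perm.sign_swap hab, Perm.sign_swap hbc]; simp

theorem reach_of_even {S : Set (Perm α)} {L : ℕ}
    (h : ∀ a b c : α, a ≠ b → a ≠ c → b ≠ c → Reach S L (cyc a b c)) {g : Perm α}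
    (hg : Perm.sign g = 1) : Reach S (#g.support * L) g := by
  induction hs : #g.support using Nat.strong_induction_on generalizing g with
  | _ s ih =>
    by_cases h1 : g = 1
    · subst h1; exact Reach.one _
    have h3 : 3 ≤ #g.support := by
      have h2 : #g.support ≠ 0 := by rwa [Ne, Perm.card_support_eq_zero]
      have h2' : #g.support ≠ 1 := Perm.card_support_ne_one g
      have h2'' : #g.support ≠ 2 := by
        intro h2
        have := (Perm.card_support_eq_two.1 h2).sign_eq
        rw [hg] at this
        exact absurd this (by decide)
      omega
    obtain ⟨a, ha⟩ : g.support.Nonempty := Finset.card_pos.1 (by omega)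
    have hb : g a ∈ g.support := Perm.apply_mem_support.2 ha
    obtain ⟨c, hc, hc'⟩ : ∃ c ∈ g.support, c ∉ ({a, g a} : Finset α) := by
      by_contra hcon
      push Not at hcon
      have := Finset.card_le_card (s := g.support) (t := {a, g a}) hcon
      have := Finset.card_le_two (a := a) (b := g a)
      omega
    have hab : a ≠ g a := (Perm.mem_support.1 ha).symm
    simp only [mem_insert, mem_singleton, not_or] at hc'
    have hcyc := h a (g a) c hab (Ne.symm hc'.1) (Ne.symm hc'.2)
    set k := cyc a (g a) c with hk
    have hlt : #(k⁻¹ * g).support < s := by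
      rw [← hs]
      apply Finset.card_lt_card
      rw [Finset.ssubset_iff_of_subset]
      · refine ⟨a, ha, ?_⟩
        rw [Perm.notMem_support, Perm.mul_apply, Perm.inv_eq_iff_eq, hk,
          cyc_apply_left hab (Ne.symm hc'.1)]
      · intro x hx
        by_contra hx'
        have hxg : g x = x := Perm.notMem_support.1 hx'
        rw [Perm.mem_support, Perm.mul_apply, hxg, Ne, Perm.inv_eq_iff_eq, hk, cyc_apply_of_ne] at hx
        · exact hx rfl
        · rintro rfl; exact hx' ha
        · rintro rfl; exact hx' hb
        · rintro rfl; exact hx' hc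
    have hsg : Perm.sign (k⁻¹ * g) = 1 := by
      rw [Perm.sign_mul, Perm.sign_inv, hk, sign_cyc hab (Ne.symm hc'.2), hg]; rfl
    have := hcyc.mul (ih _ hlt hsg rfl)
    rw [mul_inv_cancel_left] at this
    refine this.mono ?_
    nlinarith

theorem reach_of_mem_closure {S : Set (Perm α)} {L : ℕ}
    (h : ∀ a b c : α, a ≠ b → a ≠ c → b ≠ c → Reach S L (cyc a b c)) {g : Perm α}
    (hg : g ∈ Subgroup.closure S) : Reach S (Fintype.card α * L + 1) g := by
  have heven : ∀ g : Perm α, Perm.sign g = 1 → Reach S (Fintype.card α * L) g := fun g hg =>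
    (reach_of_even h hg).mono (Nat.mul_le_mul_right _ (Finset.card_le_univ _))
  rcases Int.units_eq_one_or (Perm.sign g) with h1 | h1
  · exact (heven g h1).mono (by omega)
  · obtain ⟨s, hs, hs1⟩ : ∃ s ∈ S, Perm.sign s = -1 := by
      by_contra hcon
      push Not at hcon
      have : Subgroup.closure S ≤ alternatingGroup α := by
        rw [Subgroup.closure_le]
        intro s hs
        exact Perm.mem_alternatingGroup.2
          ((Int.units_eq_one_or (Perm.sign s)).resolve_right (hcon s hs))
      have h2 := Perm.mem_alternatingGroup.1 (this hg)
      rw [h1] at h2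
      exact absurd h2 (by decide)
    have h3 : Perm.sign (s⁻¹ * g) = 1 := by rw [Perm.sign_mul, Perm.sign_inv, hs1, h1]; rfl
    have := (Reach.of_mem hs).mul (heven _ h3)
    rw [mul_inv_cancel_left] at this
    exact this.mono (by omega)

theorem exists_reach_of_transitive {S : Set (Perm α)}
    (htr : ∀ A : Finset α, (∀ s ∈ S, ∀ a ∈ A, s a ∈ A) → A = ∅ ∨ A = univ) (p q : α) :
    ∃ g, Reach S (Fintype.card α) g ∧ g q = p := by
  classical
  let A : ℕ → Finset α := fun i => univ.filter fun p => ∃ g, Reach S i g ∧ g q = p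
  have hmono : ∀ i, A i ⊆ A (i + 1) := by
    intro i x hx
    simp only [A, mem_filter, mem_univ, true_and] at hx ⊢
    obtain ⟨g, hg, h⟩ := hx
    exact ⟨g, hg.mono (by omega), h⟩
  have hstep : ∀ i, ∀ s ∈ S, ∀ a ∈ A i, s a ∈ A (i + 1) := by
    intro i s hs a ha
    simp only [A, mem_filter, mem_univ, true_and] at ha ⊢
    obtain ⟨g, hg, rfl⟩ := ha
    exact ⟨s * g, ((Reach.of_mem hs).mul hg).mono (by omega), rfl⟩
  have hq : ∀ i, q ∈ A i := by
    intro i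
    simp only [A, mem_filter, mem_univ, true_and]
    exact ⟨1, Reach.one _, rfl⟩
  have key : ∀ i, i + 1 ≤ #(A i) ∨ A i = univ := by
    intro i
    induction i with
    | zero => left; exact Finset.card_pos.2 ⟨q, hq 0⟩
    | succ i ih =>
      rcases ih with h | h
      · by_cases heq : A i = A (i + 1)
        · right
          have := htr (A i) (fun s hs a ha => heq ▸ hstep i s hs a ha)
          rcases this with h0 | h0
          · exact absurd (hq i) (by rw [h0]; simp)
          · rw [← heq]; exact h0
        · left
          have := Finset.card_lt_card ((hmono i).ssubset_of_ne heq)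
          omega
      · right
        exact Finset.eq_univ_of_forall fun x => hmono i (h ▸ mem_univ x)
  have huniv : A (Fintype.card α) = univ := by
    rcases key (Fintype.card α) with h | h
    · have := Finset.card_le_univ (A (Fintype.card α)); omega
    · exact h
  have : p ∈ A (Fintype.card α) := huniv ▸ mem_univ p
  simpa [A] using this

/-- If for every `p` most cycles `cyc p b c` are short, then all three-cycles are short. -/
theorem reach_cyc {S : Set (Perm α)} {L : ℕ} (hS : ∀ s ∈ S, s⁻¹ ∈ S) (hn : 100 ≤ Fintype.card α)
    (H : α → Finset (α × α))
    (hH : ∀ p b c, (b, c) ∉ H p → b ≠ p ∧ c ≠ p ∧ b ≠ c ∧ Reach S L (cyc p b c))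
    (hcard : ∀ p, 50 * #(H p) ≤ Fintype.card α ^ 2)
    (p a b : α) (hpa : p ≠ a) (hpb : p ≠ b) (hab : a ≠ b) : Reach S (5 * L) (cyc p a b) := by
  set n := Fintype.card α with hnd
  let fib : α → α → Finset α := fun p e => univ.filter fun x => (e, x) ∈ H p
  let heavy : Finset α := univ.filter fun e => n ≤ 5 * #(fib p e)
  have hheavy : n * #heavy ≤ 5 * #(H p) := by
    have h1 : #(H p) = ∑ e, #(fib p e) := by
      rw [Finset.card_eq_sum_card_fiberwise (f := Prod.fst) (t := univ) (by simp)]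
      apply Finset.sum_congr rfl
      intro e _
      symm
      refine Finset.card_bij (fun x _ => (e, x)) ?_ ?_ ?_
      · intro x hx; simpa [fib] using hx
      · intro x _ y _ h; simpa using h
      · rintro ⟨e', x⟩ hx
        simp only [mem_filter] at hx
        obtain ⟨hx1, rfl⟩ := hx
        exact ⟨x, by simpa [fib] using hx1, rfl⟩
    rw [h1, Finset.mul_sum, mul_comm, ← smul_eq_mul, ← Finset.sum_const]
    refine (Finset.sum_le_sum (fun e he => (Finset.mem_filter.1 he).2)).trans
      (Finset.sum_le_sum_of_subset (Finset.subset_univ _))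
  have hheavy' : 10 * #heavy ≤ n := by
    have := hcard p
    have hn0 : 0 < n := by omega
    refine Nat.le_of_mul_le_mul_left ?_ hn0
    nlinarith
  obtain ⟨⟨e', e⟩, he⟩ : ∃ x : α × α, x ∉ H a ∪ ({p} ×ˢ univ) ∪ (univ ×ˢ (insert p heavy)) := by
    by_contra hcon
    push Not at hcon
    have h1 := Finset.card_le_card (s := univ) (fun x _ => hcon x)
    have h2 := (Finset.card_union_le (H a ∪ ({p} ×ˢ univ)) (univ ×ˢ (insert p heavy)))
    have h3 := Finset.card_union_le (H a) ({p} ×ˢ (univ : Finset α))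
    rw [Finset.card_univ, Fintype.card_prod] at h1
    rw [Finset.card_product, Finset.card_univ, Finset.card_singleton] at h3
    rw [Finset.card_product, Finset.card_univ] at h2
    have h4 := Finset.card_insert_le p heavy
    have h5 := hcard a
    rw [← hnd] at h1 h2 h3
    have h6 : n * #(insert p heavy) ≤ n * (#heavy + 1) := Nat.mul_le_mul_left _ h4
    nlinarith
  simp only [mem_union, mem_product, mem_singleton, mem_univ, and_true, true_and, mem_insert,
    not_or] at he
  obtain ⟨⟨heH, hep'⟩, hep, hel⟩ := he
  obtain ⟨he'a, hea, hee, hre⟩ := hH a e' e heH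
  have hel' : 5 * #(fib p e) < n := by
    by_contra h
    exact hel (by simp only [heavy, mem_filter, mem_univ, true_and]; omega)
  have hgood : ∀ x, x ∉ fib p e → x ≠ a → x ≠ e' → Reach S (3 * L) (cyc p a x) := by
    intro x hx hxa hxe'
    have hx' : (e, x) ∉ H p := by simpa [fib] using hx
    obtain ⟨-, hxp, hex, hr⟩ := hH p e x hx'
    have := Reach.conj hS hre hr
    rw [conj_cyc, cyc_apply_right, cyc_apply_of_ne hpa (Ne.symm hep') (Ne.symm hep),
      cyc_apply_of_ne hxa hxe' (Ne.symm hex)] at this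
    exact this.mono (by omega)
  obtain ⟨⟨y, x⟩, hyx⟩ : ∃ z : α × α, z ∉ H b ∪ ({p, a} ×ˢ univ) ∪
      (univ ×ˢ (insert p (insert a (insert e' (fib p e))))) := by
    by_contra hcon
    push Not at hcon
    have h1 := Finset.card_le_card (s := univ) (fun x _ => hcon x)
    have h2 := (Finset.card_union_le (H b ∪ ({p, a} ×ˢ univ))
      (univ ×ˢ (insert p (insert a (insert e' (fib p e))))))
    have h3 := Finset.card_union_le (H b) ({p, a} ×ˢ (univ : Finset α))
    rw [Finset.card_univ, Fintype.card_prod] at h1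
    rw [Finset.card_product, Finset.card_univ] at h3
    rw [Finset.card_product, Finset.card_univ] at h2
    have h4 : #(insert p (insert a (insert e' (fib p e)))) ≤ #(fib p e) + 3 := by
      have h41 := Finset.card_insert_le p (insert a (insert e' (fib p e)))
      have h42 := Finset.card_insert_le a (insert e' (fib p e))
      have h43 := Finset.card_insert_le e' (fib p e)
      omega
    have h7 : #({p, a} : Finset α) ≤ 2 := Finset.card_le_two
    have h5 := hcard b
    rw [← hnd] at h1 h2 h3
    have h6 : n * #(insert p (insert a (insert e' (fib p e)))) ≤ n * (#(fib p e) + 3) :=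
      Nat.mul_le_mul_left _ h4
    have h8 : #({p, a} : Finset α) * n ≤ 2 * n := Nat.mul_le_mul_right _ h7
    nlinarith
  simp only [mem_union, mem_product, mem_singleton, mem_univ, and_true, true_and, mem_insert,
    not_or] at hyx
  obtain ⟨⟨hyxH, hyp, hya⟩, hxp, hxa, hxe', hxf⟩ := hyx
  obtain ⟨hyb, hxb, hyx, hr⟩ := hH b y x hyxH
  have := Reach.conj hS hr (hgood x hxf hxa hxe')
  rw [conj_cyc, cyc_apply_right, cyc_apply_of_ne hpb (Ne.symm hyp) (Ne.symm hxp),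
    cyc_apply_of_ne hab (Ne.symm hya) (Ne.symm hxa)] at this
  exact this.mono (by omega)

end ThreeCycles

section Assembly
variable {α : Type*} [Fintype α] [DecidableEq α]

theorem exists_perm_comp_embedding (s s' : Fin 3 ↪ α) : ∃ g : Perm α, ∀ i, g (s i) = s' i := by
  obtain ⟨g, hg⟩ := (Perm.isMultiplyPretransitive α 3).exists_smul_eq s s'
  refine ⟨g, fun i => ?_⟩
  rw [← hg]; rfl

theorem card_mul_le_of_extension {k : ℕ} (hk : 3 ≤ k) (hkn : k ≤ Fintype.card α) (B : ℕ)
    (bad : Finset (Fin 3 ↪ α)) (bad' : Finset (Fin k ↪ α))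
    (hbad : ∀ t : Fin k ↪ α, (Fin.castLEEmb hk).trans t ∈ bad → t ∈ bad')
    (hB : B * #bad' ≤ Fintype.card (Fin k ↪ α)) : B * #bad ≤ Fintype.card (Fin 3 ↪ α) := by
  let f : (Fin k ↪ α) → (Fin 3 ↪ α) := fun t => (Fin.castLEEmb hk).trans t
  let c : (Fin 3 ↪ α) → ℕ := fun s => #(univ.filter fun t => f t = s)
  have hT : 0 < Fintype.card (Fin k ↪ α) := by
    rw [Fintype.card_embedding_eq, Fintype.card_fin]
    exact Nat.pos_of_ne_zero (by rw [Ne, Nat.descFactorial_eq_zero_iff_lt]; omega)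
  obtain ⟨t₀⟩ := Fintype.card_pos_iff.1 hT
  have hle : ∀ s s', c s ≤ c s' := by
    intro s s'
    obtain ⟨g, hg⟩ := exists_perm_comp_embedding s s'
    refine Finset.card_le_card_of_injOn (fun t => t.trans g.toEmbedding) ?_ ?_
    · intro t ht
      have ht' : f t = s := by simpa using ht
      have : f (t.trans g.toEmbedding) = s' := by
        ext i
        rw [← hg i, ← ht']; rfl
      simpa using this
    · intro t _ t' _ h
      ext i
      have := DFunLike.congr_fun h i
      simpa using this
  have hc : ∀ s, c s = c (f t₀) := fun s => le_antisymm (hle _ _) (hle _ _)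
  have hc0 : 0 < c (f t₀) := Finset.card_pos.2 ⟨t₀, by simp⟩
  have h1 : Fintype.card (Fin k ↪ α) = Fintype.card (Fin 3 ↪ α) * c (f t₀) := by
    rw [← Finset.card_univ, Finset.card_eq_sum_card_fiberwise (f := f) (t := univ) (by simp),
      Finset.sum_congr rfl (fun s _ => hc s), Finset.sum_const, smul_eq_mul, Finset.card_univ]
  have h2 : #bad * c (f t₀) ≤ #bad' := by
    calc #bad * c (f t₀) = ∑ s ∈ bad, c s := by
          rw [Finset.sum_congr rfl (fun s _ => hc s), Finset.sum_const, smul_eq_mul]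
      _ = #(univ.filter fun t => f t ∈ bad) := by
          rw [Finset.card_eq_sum_card_fiberwise (f := f) (t := bad) (by intro t ht; simpa using ht)]
          apply Finset.sum_congr rfl
          intro s hs
          simp only [c, Finset.filter_filter]
          congr 1
          ext t
          simp only [mem_filter, mem_univ, true_and]
          constructor
          · rintro rfl; exact ⟨hs, rfl⟩
          · exact fun h => h.2
      _ ≤ #bad' := Finset.card_le_card fun t ht => hbad t (by simpa [f] using ht)
  refine Nat.le_of_mul_le_mul_right ?_ hc0
  rw [← h1, mul_assoc]
  exact (Nat.mul_le_mul_left _ h2).trans hB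

/-- The three-cycle on the first three indices. -/
def idxCyc {k : ℕ} (hk : 3 ≤ k) : Perm (Fin k) :=
  cyc (Fin.castLE hk 0) (Fin.castLE hk 1) (Fin.castLE hk 2)

theorem sign_idxCyc {k : ℕ} (hk : 3 ≤ k) : Perm.sign (idxCyc hk) = 1 :=
  sign_cyc (by simp [Fin.ext_iff]) (by simp [Fin.ext_iff])

theorem cyc_pow_three {a b c : α} (hab : a ≠ b) (hac : a ≠ c) (hbc : b ≠ c) : cyc a b c ^ 3 = 1 := by
  have hb : cyc a b c b = c := by
    rw [cyc, Perm.mul_apply, swap_apply_left, swap_apply_of_ne_of_ne hac.symm hbc.symm]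
  ext x
  simp only [pow_succ, pow_zero, one_mul, Perm.mul_apply, Perm.one_apply]
  by_cases h1 : x = a
  · subst h1; rw [cyc_apply_left hab hac, hb, cyc_apply_right]
  by_cases h2 : x = b
  · subst h2; rw [hb, cyc_apply_right, cyc_apply_left hab hac]
  by_cases h3 : x = c
  · subst h3; rw [cyc_apply_right, cyc_apply_left hab hac, hb]
  · simp only [cyc_apply_of_ne h1 h2 h3]

theorem idxCyc_pow_three {k : ℕ} (hk : 3 ≤ k) : idxCyc hk ^ 3 = 1 :=
  cyc_pow_three (by simp [Fin.ext_iff]) (by simp [Fin.ext_iff]) (by simp [Fin.ext_iff])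

theorem glue_idxCyc {k : ℕ} (hk : 3 ≤ k) (t : Fin k ↪ α) :
    glue t (idxCyc hk) 1 =
      cyc (t (Fin.castLE hk 0)) (t (Fin.castLE hk 1)) (t (Fin.castLE hk 2)) := by
  apply perm_ext_of_embedding t
  · intro i
    rw [glue_apply, idxCyc, cyc, cyc, Perm.mul_apply, Perm.mul_apply, t.injective.swap_apply,
      t.injective.swap_apply]
  · rintro ⟨a, ha⟩
    rw [glue_apply_of_notMem]
    have : ∀ i, a ≠ t i := fun i h => ha ⟨i, h.symm⟩
    rw [cyc_apply_of_ne (this _) (this _) (this _)]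
    rfl

theorem reach_cyc_of_hit {S : Set (Perm α)} {k ℓ : ℕ} (hk : 3 ≤ k)
    (h3 : (Fintype.card α - k) % 3 ≠ 0) {e : Bool → Perm α} (he : ∀ b, e b ∈ S) {z : Perm α}
    (hz : z ∈ S) {t : Fin k ↪ α} {w : Fin ℓ → Bool} (hw : z * words e w ∈ glueClass t (idxCyc hk)) :
    Reach S (2 * Fintype.card α * (ℓ + 1))
      (cyc (t (Fin.castLE hk 0)) (t (Fin.castLE hk 1)) (t (Fin.castLE hk 2))) := by
  have hreach : Reach S (ℓ + 1) (z * words e w) := by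
    have h1 : Reach S ℓ (words e w) := by
      have := reach_evalW he (List.ofFn w)
      rwa [List.length_ofFn] at this
    exact ((Reach.of_mem hz).mul h1).mono (by omega)
  set m := Fintype.card α - k with hm
  obtain ⟨j, hj, hj3, hj2⟩ : ∃ j, m ∣ j ∧ j % 3 = 1 % 3 ∧ j ≤ 2 * m := by
    rcases (by omega : m % 3 = 1 ∨ m % 3 = 2) with h | h
    · exact ⟨m, dvd_rfl, by omega, by omega⟩
    · exact ⟨2 * m, ⟨2, by ring⟩, by omega, le_rfl⟩
  rw [← glue_idxCyc, ← pow_of_mem_glueClass hw hj (idxCyc_pow_three hk) hj3]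
  refine (hreach.pow j).mono (Nat.mul_le_mul_right _ ?_)
  omega

theorem reach_all_cyc {S : Set (Perm α)} (hS : ∀ s ∈ S, s⁻¹ ∈ S) (hn : 300 ≤ Fintype.card α)
    (htr : ∀ A : Finset α, (∀ s ∈ S, ∀ a ∈ A, s a ∈ A) → A = ∅ ∨ A = univ) {L : ℕ}
    (bad : Finset (Fin 3 ↪ α)) (hbad : ∀ s, s ∉ bad → Reach S L (cyc (s 0) (s 1) (s 2)))
    (hcard : 100 * #bad ≤ Fintype.card (Fin 3 ↪ α)) {p a b : α} (hpa : p ≠ a) (hpb : p ≠ b)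
    (hab : a ≠ b) : Reach S (5 * (L + 2 * Fintype.card α)) (cyc p a b) := by
  classical
  set n := Fintype.card α with hnd
  have hT : Fintype.card (Fin 3 ↪ α) ≤ n ^ 3 := by
    rw [Fintype.card_embedding_eq, Fintype.card_fin]; exact Nat.descFactorial_le_pow _ _
  obtain ⟨q, hq⟩ : ∃ q : α, 100 * #(bad.filter fun s => s 0 = q) ≤ n ^ 2 := by
    have hne : (univ : Finset α).Nonempty := ⟨p, mem_univ _⟩
    have h1 : ∑ q : α, 100 * #(bad.filter fun s => s 0 = q) ≤ ∑ q : α, n ^ 2 := by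
      rw [← Finset.mul_sum, ← Finset.card_eq_sum_card_fiberwise (by simp), Finset.sum_const,
        smul_eq_mul, Finset.card_univ, ← hnd]
      calc _ ≤ _ := hcard
        _ ≤ _ := hT
        _ = _ := by ring
    obtain ⟨q, -, hq⟩ := Finset.exists_le_of_sum_le hne h1
    exact ⟨q, hq⟩
  let D : α → Finset (α × α) := fun p => univ.filter fun x =>
    x.1 ≠ p ∧ x.2 ≠ p ∧ x.1 ≠ x.2 ∧ ¬ Reach S (L + 2 * n) (cyc p x.1 x.2)
  have hD : ∀ p, #(D p) ≤ #(bad.filter fun s => s 0 = q) := by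
    intro p
    obtain ⟨g, hg, hgq⟩ := exists_reach_of_transitive htr p q
    refine (Finset.card_le_card (t := (bad.filter fun s => s 0 = q).image
      fun s => (g (s 1), g (s 2))) ?_).trans Finset.card_image_le
    rintro ⟨b, c⟩ hbc
    simp only [D, mem_filter, mem_univ, true_and] at hbc
    obtain ⟨hb, hc, hbc, hr⟩ := hbc
    have hinj : Function.Injective ![q, g⁻¹ b, g⁻¹ c] := by
      have e1 : q ≠ g⁻¹ b := by
        rw [Ne, eq_comm, Perm.inv_eq_iff_eq, hgq]; exact hb
      have e2 : q ≠ g⁻¹ c := by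
        rw [Ne, eq_comm, Perm.inv_eq_iff_eq, hgq]; exact hc
      have e3 : g⁻¹ b ≠ g⁻¹ c := fun h => hbc (g⁻¹.injective h)
      intro i j hij
      fin_cases i <;> fin_cases j <;> first | rfl | (exfalso; revert hij; simp_all [eq_comm])
    refine Finset.mem_image.2 ⟨⟨_, hinj⟩, ?_, by simp⟩
    rw [Finset.mem_filter]
    refine ⟨?_, by simp⟩
    by_contra hs
    have hgi : ∀ x, g (g⁻¹ x) = x := fun x => by simp
    have := Reach.conj hS hg (hbad _ hs)
    rw [conj_cyc] at this
    simp only [Function.Embedding.coeFn_mk, Matrix.cons_val_zero, Matrix.cons_val_one,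
      Matrix.cons_val, hgq, hgi] at this
    exact hr this
  let H : α → Finset (α × α) := fun p =>
    D p ∪ ({p} ×ˢ univ) ∪ (univ ×ˢ {p}) ∪ univ.image fun x => (x, x)
  refine reach_cyc hS (by omega) H ?_ ?_ p a b hpa hpb hab
  · intro p b c hbc
    simp only [H, D, mem_union, mem_product, mem_singleton, mem_univ, and_true, true_and, mem_image,
      mem_filter, not_or, Prod.mk.injEq] at hbc
    obtain ⟨⟨⟨h1, h2⟩, h3⟩, h4⟩ := hbc
    have h5 : b ≠ c := by
      rintro rfl; exact h4 ⟨b, rfl, rfl⟩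
    refine ⟨h2, h3, h5, ?_⟩
    by_contra h6
    exact h1 ⟨h2, h3, h5, h6⟩
  · intro p
    have h1 : #(H p) ≤ #(D p) + n + n + n := by
      refine (Finset.card_union_le _ _).trans (Nat.add_le_add ?_ ?_)
      · refine (Finset.card_union_le _ _).trans (Nat.add_le_add ?_ ?_)
        · refine (Finset.card_union_le _ _).trans (Nat.add_le_add le_rfl ?_)
          simp [hnd]
        · simp [hnd]
      · exact Finset.card_image_le.trans (by simp [hnd])
    have := hD p
    rw [← hnd]
    nlinarith

theorem reach_of_missed {S : Set (Perm α)} (hS : ∀ s ∈ S, s⁻¹ ∈ S) (hn : 300 ≤ Fintype.card α)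
    (htr : ∀ A : Finset α, (∀ s ∈ S, ∀ a ∈ A, s a ∈ A) → A = ∅ ∨ A = univ)
    {k ℓ : ℕ} (hk : 3 ≤ k) (hkn : k ≤ Fintype.card α) (h3 : (Fintype.card α - k) % 3 ≠ 0)
    {e : Bool → Perm α} (he : ∀ b, e b ∈ S) {z : Perm α} (hz : z ∈ S)
    (hsz : Perm.sign z = (-1) ^ (Fintype.card α - k - 1))
    (hmiss : 100 * #(univ.filter fun t : Fin k ↪ α =>
      z ∈ missed (words (ℓ := ℓ) e) (idxCyc hk) t) ≤ Fintype.card (Fin k ↪ α))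
    {p a b : α} (hpa : p ≠ a) (hpb : p ≠ b) (hab : a ≠ b) :
    Reach S (5 * (2 * Fintype.card α * (ℓ + 1) + 2 * Fintype.card α)) (cyc p a b) := by
  classical
  let bad : Finset (Fin 3 ↪ α) := univ.filter fun s =>
    ¬ Reach S (2 * Fintype.card α * (ℓ + 1)) (cyc (s 0) (s 1) (s 2))
  refine reach_all_cyc hS hn htr bad ?_ ?_ hpa hpb hab
  · intro s hs
    simpa [bad] using hs
  · refine card_mul_le_of_extension hk hkn 100 bad _ ?_ hmiss
    intro t ht
    simp only [bad, mem_filter, mem_univ, true_and, missed] at ht ⊢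
    refine ⟨hsz, fun w hw => ht (reach_cyc_of_hit hk h3 he hz hw)⟩

end Assembly

section Transitivity
variable {α : Type*} [Fintype α] [DecidableEq α]

theorem card_preserving_le (A : Finset α) :
    #(univ.filter fun g : Perm α => ∀ a ∈ A, g a ∈ A) ≤
      (#A).factorial * (Fintype.card α - #A).factorial := by
  have hiff : ∀ g : Perm α, (∀ a ∈ A, g a ∈ A) → ∀ a, g a ∈ A ↔ a ∈ A := by
    intro g hg a
    refine ⟨fun h => ?_, hg a⟩
    have himg : A.image g = A := by
      refine Finset.eq_of_subset_of_card_le (Finset.image_subset_iff.2 hg) ?_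
      rw [Finset.card_image_of_injective _ g.injective]
    rw [← himg, Finset.mem_image] at h
    obtain ⟨b, hb, hab⟩ := h
    exact g.injective hab ▸ hb
  let F : {g : Perm α // ∀ a ∈ A, g a ∈ A} → Perm {x // x ∈ A} × Perm {x // x ∉ A} := fun g =>
    (g.1.subtypePerm (hiff g.1 g.2), g.1.subtypePerm fun a => not_congr (hiff g.1 g.2 a))
  have hF : Function.Injective F := by
    intro g h hgh
    ext a
    by_cases ha : a ∈ A
    · exact congrArg Subtype.val (Equiv.congr_fun (Prod.ext_iff.1 hgh).1 ⟨a, ha⟩)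
    · exact congrArg Subtype.val (Equiv.congr_fun (Prod.ext_iff.1 hgh).2 ⟨a, ha⟩)
  have := Fintype.card_le_of_injective F hF
  rwa [Fintype.card_subtype, Fintype.card_prod, Fintype.card_perm, Fintype.card_perm,
    Fintype.card_coe, Fintype.card_subtype_compl, Fintype.card_coe] at this

theorem le_choose_of_pos_of_lt {n a : ℕ} (ha : 0 < a) (han : a < n) : n ≤ n.choose a := by
  induction n generalizing a with
  | zero => omega
  | succ n ih =>
    obtain ⟨a, rfl⟩ := Nat.exists_eq_succ_of_ne_zero ha.ne'
    rw [Nat.succ_eq_add_one, Nat.choose_succ_succ]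
    rcases Nat.lt_or_ge (a + 1) n with h | h
    · have h1 := ih (Nat.succ_pos a) h
      have h2 : 0 < n.choose a := Nat.choose_pos (by omega)
      simp only [Nat.succ_eq_add_one] at *
      omega
    · obtain rfl : n = a + 1 := by omega
      simp

/-- The triples of permutations preserving a common nonempty proper subset. -/
noncomputable def intransitive (α : Type*) [Fintype α] [DecidableEq α] :
    Finset (Perm α × Perm α × Perm α) :=
  univ.filter fun t => ∃ A : Finset α, (A ≠ ∅ ∧ A ≠ univ) ∧
    ∀ a ∈ A, t.1 a ∈ A ∧ t.2.1 a ∈ A ∧ t.2.2 a ∈ A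

theorem card_mul_card_intransitive_le :
    Fintype.card α * #(intransitive α) ≤ (Fintype.card α).factorial ^ 3 := by
  set n := Fintype.card α with hn
  rcases Nat.eq_zero_or_pos n with h0 | hpos
  · simp [h0]
  let f : ℕ → ℕ := fun m => if 0 < m ∧ m < n then (m.factorial * (n - m).factorial) ^ 3 else 0
  have h1 : #(intransitive α) ≤ ∑ A : Finset α, f #A := by
    let Q : Finset (Finset α) := univ.filter fun A => A ≠ ∅ ∧ A ≠ univ
    let P : Finset α → Finset (Perm α) := fun A => univ.filter fun g => ∀ a ∈ A, g a ∈ A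
    have hsub : intransitive α ⊆ Q.biUnion fun A => P A ×ˢ P A ×ˢ P A := by
      intro t ht
      simp only [intransitive, mem_filter, mem_univ, true_and] at ht
      obtain ⟨A, hA, h⟩ := ht
      simp only [Q, P, mem_biUnion, mem_filter, mem_univ, true_and, mem_product]
      exact ⟨A, hA, fun a ha => (h a ha).1, fun a ha => (h a ha).2.1, fun a ha => (h a ha).2.2⟩
    refine (Finset.card_le_card hsub).trans (Finset.card_biUnion_le.trans ?_)
    refine (Finset.sum_le_sum (g := fun A => f #A) ?_).trans
      (Finset.sum_le_sum_of_subset (Finset.subset_univ Q))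
    intro A hA
    simp only [Q, mem_filter, mem_univ, true_and] at hA
    have hlt : 0 < #A ∧ #A < n :=
      ⟨Finset.card_pos.2 (Finset.nonempty_iff_ne_empty.2 hA.1),
        lt_of_le_of_ne (Finset.card_le_univ A) fun h => hA.2 ((Finset.card_eq_iff_eq_univ A).1 h)⟩
    simp only [f, if_pos hlt]
    have := card_preserving_le A
    rw [Finset.card_product, Finset.card_product]
    calc _ = #(P A) ^ 3 := by ring
      _ ≤ _ := Nat.pow_le_pow_left this 3
  have h2 : ∀ m ∈ range (n + 1), n ^ 2 * (n.choose m * f m) ≤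
      if m = 0 then 0 else n.factorial ^ 3 := by
    intro m _
    by_cases hm : 0 < m ∧ m < n
    · simp only [f, if_pos hm, if_neg hm.1.ne']
      have hc := le_choose_of_pos_of_lt hm.1 hm.2
      have hf := Nat.choose_mul_factorial_mul_factorial hm.2.le
      calc n ^ 2 * (n.choose m * (m.factorial * (n - m).factorial) ^ 3)
          ≤ n.choose m ^ 2 * (n.choose m * (m.factorial * (n - m).factorial) ^ 3) := by gcongr
        _ = (n.choose m * m.factorial * (n - m).factorial) ^ 3 := by ring
        _ = _ := by rw [hf]
    · simp [f, if_neg hm]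
  have h3 : n ^ 2 * #(intransitive α) ≤ n * n.factorial ^ 3 := by
    calc n ^ 2 * #(intransitive α) ≤ n ^ 2 * ∑ A : Finset α, f #A := by gcongr
      _ = ∑ m ∈ range (n + 1), n ^ 2 * (n.choose m * f m) := by
        rw [← Finset.powerset_univ, Finset.sum_powerset_apply_card, Finset.card_univ, ← hn,
          Finset.mul_sum]
        simp
      _ ≤ ∑ m ∈ range (n + 1), if m = 0 then 0 else n.factorial ^ 3 := Finset.sum_le_sum h2
      _ = n * n.factorial ^ 3 := by
        rw [Finset.sum_range_succ']
        simp
  exact Nat.le_of_mul_le_mul_left (by rw [← mul_assoc, ← sq]; exact h3) hpos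

end Transitivity

section Conclusion
variable {α : Type*} [Fintype α] [DecidableEq α]

/-- The symmetric generating set attached to three permutations. -/
def genSet (x y z : Perm α) : Set (Perm α) := {x, x⁻¹, y, y⁻¹, z, z⁻¹}

theorem inv_mem_genSet {x y z : Perm α} : ∀ s ∈ genSet x y z, s⁻¹ ∈ genSet x y z := by
  intro s hs
  simp only [genSet, Set.mem_insert_iff, Set.mem_singleton_iff] at hs ⊢
  rcases hs with rfl | rfl | rfl | rfl | rfl | rfl <;> simp

/-- The closure of `S` contains the alternating group and is covered by words of length `L`. -/
def Spans (S : Set (Perm α)) (L : ℕ) : Prop :=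
  (∀ g ∈ alternatingGroup α, g ∈ Subgroup.closure S) ∧ ∀ g ∈ Subgroup.closure S, Reach S L g

/-- The word length reached by the argument on `n` points. -/
def diamBound (n : ℕ) : ℕ := n * (5 * (2 * n * (wordLen n + 1) + 2 * n)) + 1

theorem exists_parity_and_mod_three (n : ℕ) (hn : 9 ≤ n) (s : ℤˣ) :
    ∃ j ∈ range 6, (n - (j + 3)) % 3 ≠ 0 ∧ s = (-1) ^ (n - (j + 3) - 1) := by
  have h : ∀ r < 2, ∃ j ∈ range 6, (n - (j + 3)) % 3 ≠ 0 ∧ (n - (j + 3) - 1) % 2 = r := by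
    intro r hr
    by_contra! hcon
    have h0 := hcon 0 (by simp)
    have h1 := hcon 1 (by simp)
    have h2 := hcon 2 (by simp)
    have h3 := hcon 3 (by simp)
    have h4 := hcon 4 (by simp)
    have h5 := hcon 5 (by simp)
    omega
  rcases Int.units_eq_one_or s with rfl | rfl
  · obtain ⟨j, hj, h3, h2⟩ := h 0 (by norm_num)
    exact ⟨j, hj, h3, (Even.neg_one_pow (Nat.even_iff.2 h2)).symm⟩
  · obtain ⟨j, hj, h3, h2⟩ := h 1 (by norm_num)
    exact ⟨j, hj, h3, (Odd.neg_one_pow (Nat.odd_iff.2 h2)).symm⟩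

/-- Pairs of generators of equal sign, with a third permutation missing many target classes. -/
noncomputable def failing (n j : ℕ) : Finset ((Bool → Perm (Fin n)) × Perm (Fin n)) :=
  univ.filter fun p => Perm.sign (p.1 false) = Perm.sign (p.1 true) ∧
    Fintype.card (Fin (j + 3) ↪ Fin n) < 100 * #(univ.filter fun t : Fin (j + 3) ↪ Fin n =>
      p.2 ∈ missed (words (ℓ := wordLen n) p.1) (idxCyc (Nat.le_add_left 3 j)) t)

theorem descFactorial_mul_card_failing_le (n j : ℕ) :
    n.descFactorial (j + 3) * #(failing n j) ≤
      100 * ∑ e ∈ univ.filter (fun e : Bool → Perm (Fin n) =>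
        Perm.sign (e false) = Perm.sign (e true)), ∑ t : Fin (j + 3) ↪ Fin n,
          #(missed (words (ℓ := wordLen n) e) (idxCyc (Nat.le_add_left 3 j)) t) := by
  have hcard : Fintype.card (Fin (j + 3) ↪ Fin n) = n.descFactorial (j + 3) := by
    rw [Fintype.card_embedding_eq, Fintype.card_fin, Fintype.card_fin]
  let c : (Bool → Perm (Fin n)) → Perm (Fin n) → ℕ := fun e z =>
    #(univ.filter fun t : Fin (j + 3) ↪ Fin n =>
      z ∈ missed (words (ℓ := wordLen n) e) (idxCyc (Nat.le_add_left 3 j)) t)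
  have hc : ∀ e, ∑ z, c e z = ∑ t : Fin (j + 3) ↪ Fin n,
      #(missed (words (ℓ := wordLen n) e) (idxCyc (Nat.le_add_left 3 j)) t) := by
    intro e
    simp only [c, Finset.card_filter]
    rw [Finset.sum_comm]
    refine Finset.sum_congr rfl fun t _ => ?_
    rw [← Finset.card_filter, Finset.filter_mem_eq_inter, Finset.univ_inter]
  calc n.descFactorial (j + 3) * #(failing n j)
      = ∑ _p ∈ failing n j, n.descFactorial (j + 3) := by
        rw [Finset.sum_const, smul_eq_mul, mul_comm]
    _ ≤ ∑ p ∈ failing n j, 100 * c p.1 p.2 := by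
        refine Finset.sum_le_sum fun p hp => ?_
        simp only [failing, mem_filter, hcard] at hp
        exact hp.2.2.le
    _ ≤ ∑ p ∈ (univ.filter fun e : Bool → Perm (Fin n) =>
          Perm.sign (e false) = Perm.sign (e true)) ×ˢ (univ : Finset (Perm (Fin n))),
            100 * c p.1 p.2 := by
        refine Finset.sum_le_sum_of_subset fun p hp => ?_
        simp only [failing, mem_filter, mem_univ, true_and] at hp
        simp [hp.1]
    _ = _ := by
        rw [Finset.sum_product, Finset.mul_sum]
        refine Finset.sum_congr rfl fun e _ => ?_
        rw [← hc, Finset.mul_sum]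

theorem eventually_card_failing_le (j : ℕ) (hj : j < 6) {η : ℝ} (hη : 0 < η) :
    ∀ᶠ n : ℕ in atTop, (#(failing n j) : ℝ) ≤ 100 * (η * (n.factorial : ℝ) ^ 3) := by
  filter_upwards [eventually_sum_missed_le (k := j + 3) (by omega) (by omega)
    (idxCyc (Nat.le_add_left 3 j)) (sign_idxCyc _) hη, eventually_ge_atTop 8] with n h hn
  have h1 := descFactorial_mul_card_failing_le n j
  have h2 : (0 : ℝ) < n.descFactorial (j + 3) := by
    exact_mod_cast Nat.descFactorial_pos.2 (by omega)
  have h3 : (n.descFactorial (j + 3) : ℝ) * #(failing n j) ≤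
      n.descFactorial (j + 3) * (100 * (η * (n.factorial : ℝ) ^ 3)) := by
    have h4 := Nat.cast_le (α := ℝ).2 h1
    push_cast at h4
    linarith
  exact le_of_mul_le_mul_left h3 h2

/-- Triples of permutations, the first two of equal sign, that do not span in bounded length. -/
noncomputable def exceptional (n : ℕ) : Finset ((Bool → Perm (Fin n)) × Perm (Fin n)) := by
  classical
  exact univ.filter fun p => Perm.sign (p.1 false) = Perm.sign (p.1 true) ∧
    ¬ Spans (genSet (p.1 false) (p.1 true) p.2) (diamBound n)

theorem spans_of_cyc {S : Set (Perm α)} {L : ℕ}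
    (h : ∀ a b c : α, a ≠ b → a ≠ c → b ≠ c → Reach S L (cyc a b c)) :
    Spans S (Fintype.card α * L + 1) :=
  ⟨fun _ hg => (reach_of_even h (Perm.mem_alternatingGroup.1 hg)).mem_closure,
    fun _ hg => reach_of_mem_closure h hg⟩

theorem card_exceptional_le {n : ℕ} (hn : 300 ≤ n) :
    #(exceptional n) ≤ #(intransitive (Fin n)) + ∑ j ∈ range 6, #(failing n j) := by
  classical
  have hsub : exceptional n ⊆
      ((intransitive (Fin n)).image fun t => ((fun b => cond b t.2.1 t.1), t.2.2)) ∪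
        (range 6).biUnion fun j => failing n j := by
    rintro ⟨e, z⟩ hp
    simp only [exceptional, mem_filter, mem_univ, true_and] at hp
    obtain ⟨hsign, hbad⟩ := hp
    rw [mem_union, mem_image]
    by_contra hcon
    rw [not_or] at hcon
    obtain ⟨hin, hfail⟩ := hcon
    refine hbad ?_
    obtain ⟨j, hj, hj3, hjs⟩ := exists_parity_and_mod_three n (by omega) (Perm.sign z)
    have hmiss : 100 * #(univ.filter fun t : Fin (j + 3) ↪ Fin n =>
        z ∈ missed (words (ℓ := wordLen n) e) (idxCyc (Nat.le_add_left 3 j)) t) ≤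
          Fintype.card (Fin (j + 3) ↪ Fin n) := by
      by_contra hlt
      refine hfail (mem_biUnion.2 ⟨j, hj, ?_⟩)
      simp only [failing, mem_filter, mem_univ, true_and]
      exact ⟨hsign, not_le.1 hlt⟩
    have htr : ∀ A : Finset (Fin n), (∀ s ∈ genSet (e false) (e true) z, ∀ a ∈ A, s a ∈ A) →
        A = ∅ ∨ A = univ := by
      intro A hA
      by_contra hne
      rw [not_or] at hne
      refine hin ⟨(e false, e true, z), ?_, ?_⟩
      · simp only [intransitive, mem_filter, mem_univ, true_and]
        refine ⟨A, hne, fun a ha => ⟨hA _ ?_ a ha, hA _ ?_ a ha, hA _ ?_ a ha⟩⟩ <;> simp [genSet]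
      · refine Prod.ext (funext fun b => ?_) rfl
        cases b <;> rfl
    have key : ∀ a b c : Fin n, a ≠ b → a ≠ c → b ≠ c →
        Reach (genSet (e false) (e true) z) (5 * (2 * n * (wordLen n + 1) + 2 * n)) (cyc a b c) := by
      intro a b c hab hac hbc
      have hj' := mem_range.1 hj
      have := reach_of_missed (α := Fin n) (S := genSet (e false) (e true) z) inv_mem_genSet
        (by simpa using hn) htr (k := j + 3) (ℓ := wordLen n) (Nat.le_add_left 3 j)
        (by simp only [Fintype.card_fin]; omega) (by simpa using hj3) (e := e)
        (by intro b; cases b <;> simp [genSet]) (z := z) (by simp [genSet])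
        (by simpa using hjs) hmiss hab hac hbc
      simpa using this
    have := spans_of_cyc key
    rwa [Fintype.card_fin] at this
  refine (Finset.card_le_card hsub).trans ((Finset.card_union_le _ _).trans ?_)
  exact Nat.add_le_add Finset.card_image_le Finset.card_biUnion_le

theorem eventually_card_exceptional_le {ε : ℝ} (hε : 0 < ε) :
    ∀ᶠ n : ℕ in atTop, (#(exceptional n) : ℝ) ≤ ε * (n.factorial : ℝ) ^ 3 := by
  have h1 : ∀ᶠ n : ℕ in atTop, ∀ j ∈ range 6,
      (#(failing n j) : ℝ) ≤ 100 * (ε / 1200 * (n.factorial : ℝ) ^ 3) := by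
    rw [Filter.eventually_all_finset]
    exact fun j hj => eventually_card_failing_le j (mem_range.1 hj) (by positivity)
  filter_upwards [h1, eventually_ge_atTop 300, eventually_ge_atTop ⌈2 / ε⌉₊] with n hf hn hne
  have hn0 : (0 : ℝ) < n := by exact_mod_cast (by omega : 0 < n)
  have h2 : (#(exceptional n) : ℝ) ≤ #(intransitive (Fin n)) + ∑ j ∈ range 6, (#(failing n j) : ℝ) :=
    by exact_mod_cast card_exceptional_le hn
  have h3 : (n : ℝ) * #(intransitive (Fin n)) ≤ (n.factorial : ℝ) ^ 3 := by
    have := card_mul_card_intransitive_le (α := Fin n)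
    rw [Fintype.card_fin] at this
    exact_mod_cast this
  have h4 : 2 / ε ≤ n := Nat.ceil_le.1 hne
  rw [div_le_iff₀ hε] at h4
  have h5 : (#(intransitive (Fin n)) : ℝ) ≤ ε / 2 * (n.factorial : ℝ) ^ 3 := by
    nlinarith [Nat.cast_nonneg (α := ℝ) #(intransitive (Fin n))]
  have h6 := Finset.sum_le_sum hf
  rw [Finset.sum_const, card_range, nsmul_eq_mul] at h6
  push_cast at h6
  linarith

theorem card_not_spans_le (n : ℕ) [DecidablePred fun t : Perm (Fin n) × Perm (Fin n) × Perm (Fin n) =>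
      ¬ Spans (genSet t.1 t.2.1 t.2.2) (diamBound n)] :
    #(univ.filter fun t : Perm (Fin n) × Perm (Fin n) × Perm (Fin n) =>
      ¬ Spans (genSet t.1 t.2.1 t.2.2) (diamBound n)) ≤ 3 * #(exceptional n) := by
  have hsub : (univ.filter fun t : Perm (Fin n) × Perm (Fin n) × Perm (Fin n) =>
      ¬ Spans (genSet t.1 t.2.1 t.2.2) (diamBound n)) ⊆
        ((exceptional n).image fun p => (p.1 false, p.1 true, p.2)) ∪
        ((exceptional n).image fun p => (p.1 false, p.2, p.1 true)) ∪
        ((exceptional n).image fun p => (p.2, p.1 false, p.1 true)) := by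
    rintro ⟨x, y, z⟩ ht
    simp only [mem_filter, mem_univ, true_and] at ht
    have hxzy : genSet x z y = genSet x y z := by
      ext; simp only [genSet, Set.mem_insert_iff, Set.mem_singleton_iff]; tauto
    have hyzx : genSet y z x = genSet x y z := by
      ext; simp only [genSet, Set.mem_insert_iff, Set.mem_singleton_iff]; tauto
    have hmem : ∀ u v w : Perm (Fin n), Perm.sign u = Perm.sign v → genSet u v w = genSet x y z →
        ((fun b => cond b v u), w) ∈ exceptional n := by
      intro u v w huv hset
      simp only [exceptional, mem_filter, mem_univ, true_and, cond_false, cond_true, hset]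
      exact ⟨huv, ht⟩
    simp only [mem_union, mem_image]
    by_cases hxy : Perm.sign x = Perm.sign y
    · exact Or.inl (Or.inl ⟨_, hmem x y z hxy rfl, rfl⟩)
    by_cases hxz : Perm.sign x = Perm.sign z
    · exact Or.inl (Or.inr ⟨_, hmem x z y hxz hxzy, rfl⟩)
    refine Or.inr ⟨_, hmem y z x ?_ hyzx, rfl⟩
    rcases Int.units_eq_one_or (Perm.sign x) with h1 | h1 <;>
    rcases Int.units_eq_one_or (Perm.sign y) with h2 | h2 <;>
    rcases Int.units_eq_one_or (Perm.sign z) with h3 | h3 <;> simp_all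
  refine (Finset.card_le_card hsub).trans ?_
  refine (Finset.card_union_le _ _).trans ((Nat.add_le_add ((Finset.card_union_le _ _).trans
    (Nat.add_le_add Finset.card_image_le Finset.card_image_le)) Finset.card_image_le).trans ?_)
  omega

theorem diamBound_le {n : ℕ} (hn : 3 ≤ n) :
    (diamBound n : ℝ) ≤ 600 * (n : ℝ) ^ 2 * Real.log n := by
  have h1 := wordLen_le hn
  have h2 := one_le_log_natCast hn
  have h3 : (1 : ℝ) ≤ n := by exact_mod_cast (by omega : 1 ≤ n)
  have h4 : (1 : ℝ) ≤ (n : ℝ) ^ 2 := one_le_pow₀ h3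
  calc (diamBound n : ℝ) = 10 * (n : ℝ) ^ 2 * (wordLen n + 2) + 1 := by
        rw [diamBound]; push_cast; ring
    _ ≤ 10 * (n : ℝ) ^ 2 * (50 * Real.log n + 2 * Real.log n) + (n : ℝ) ^ 2 * Real.log n := by
        gcongr
        · linarith
        · exact one_le_mul_of_one_le_of_one_le h4 h2
    _ ≤ 600 * (n : ℝ) ^ 2 * Real.log n := by nlinarith

end Conclusion

end ThreeGen

open ThreeGen in
/-- **Diameter of `Sym(n)` with respect to 3 random generators** (Appendix A.5).
There is a constant `C > 0` such that, for uniformly random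
`x, y, z ∈ Sym(n)` with `S = {x^{±1}, y^{±1}, z^{±1}}`, the probability that
`⟨S⟩` contains `Alt(n)` and every element of `⟨S⟩` is a product of at most
`C·n²·log n` elements of `S` tends to `1` as `n → ∞`. -/
theorem stmt19 :
    ∃ C : ℝ, 0 < C ∧
      Filter.Tendsto (fun n : ℕ =>
        (Nat.card {t : Equiv.Perm (Fin n) × Equiv.Perm (Fin n) × Equiv.Perm (Fin n) //
            ∀ S : Set (Equiv.Perm (Fin n)),
              S = {t.1, t.1⁻¹, t.2.1, t.2.1⁻¹, t.2.2, t.2.2⁻¹} →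
              (∀ g ∈ alternatingGroup (Fin n), g ∈ Subgroup.closure S) ∧
              ∀ g ∈ Subgroup.closure S,
                ∃ l : List (Equiv.Perm (Fin n)),
                  (∀ a ∈ l, a ∈ S) ∧ l.prod = g ∧
                    (l.length : ℝ) ≤ C * (n : ℝ) ^ 2 * Real.log n} : ℝ) /
          (Nat.card (Equiv.Perm (Fin n)) : ℝ) ^ 3)
        Filter.atTop (nhds 1) := by
  classical
  refine ⟨600, by norm_num, ?_⟩
  rw [Metric.tendsto_nhds]
  intro ε hε
  filter_upwards [eventually_card_exceptional_le (ε := ε / 6) (by positivity),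
    Filter.eventually_ge_atTop 3] with n hex hn
  rw [Nat.card_eq_fintype_card, Nat.card_eq_fintype_card, Fintype.card_subtype,
    Fintype.card_perm, Fintype.card_fin]
  set good := Finset.univ.filter fun t : Equiv.Perm (Fin n) × Equiv.Perm (Fin n) ×
    Equiv.Perm (Fin n) => ∀ S : Set (Equiv.Perm (Fin n)),
              S = {t.1, t.1⁻¹, t.2.1, t.2.1⁻¹, t.2.2, t.2.2⁻¹} →
              (∀ g ∈ alternatingGroup (Fin n), g ∈ Subgroup.closure S) ∧
              ∀ g ∈ Subgroup.closure S,
                ∃ l : List (Equiv.Perm (Fin n)),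
                  (∀ a ∈ l, a ∈ S) ∧ l.prod = g ∧
                    (l.length : ℝ) ≤ 600 * (n : ℝ) ^ 2 * Real.log n with hgood
  have hsub : goodᶜ ⊆ Finset.univ.filter fun t : Equiv.Perm (Fin n) × Equiv.Perm (Fin n) ×
      Equiv.Perm (Fin n) => ¬ Spans (genSet t.1 t.2.1 t.2.2) (diamBound n) := by
    intro t ht
    simp only [Finset.mem_filter, Finset.mem_univ, true_and]
    intro hsp
    refine Finset.mem_compl.1 ht ?_
    simp only [hgood, Finset.mem_filter, Finset.mem_univ, true_and]
    rintro S rfl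
    refine ⟨hsp.1, fun g hg => ?_⟩
    obtain ⟨l, hl, hp, hlen⟩ := hsp.2 g hg
    exact ⟨l, hl, hp, (Nat.cast_le.2 hlen).trans (diamBound_le hn)⟩
  have hcompl : (goodᶜ.card : ℝ) ≤ 3 * (ε / 6 * (n.factorial : ℝ) ^ 3) := by
    have h1 : (goodᶜ.card : ℝ) ≤ 3 * (exceptional n).card := by
      exact_mod_cast (Finset.card_le_card hsub).trans (card_not_spans_le n)
    linarith
  have htot : (good.card : ℝ) + goodᶜ.card = (n.factorial : ℝ) ^ 3 := by
    have := Finset.card_add_card_compl good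
    rw [Fintype.card_prod, Fintype.card_prod, Fintype.card_perm, Fintype.card_fin] at this
    rw [← Nat.cast_add, this]
    push_cast
    ring
  have hpos : (0 : ℝ) < (n.factorial : ℝ) ^ 3 := by positivity
  have heq : (good.card : ℝ) / (n.factorial : ℝ) ^ 3 - 1 = - (goodᶜ.card / (n.factorial : ℝ) ^ 3) := by
    rw [← htot] at hpos ⊢
    field_simp
    ring
  rw [Real.dist_eq, heq, abs_neg, abs_of_nonneg (by positivity), div_lt_iff₀ hpos]
  nlinarith
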